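/- Let 𝒜 ⊂ ℕ be finite and let μ be a Gibbs measure for the Gauss map restricted to B(𝒜) with Hausdorff dimension dim μ > 1/2. Then for every strictly increasing sequence (s_k)_{k∈ℕ} of natural numbers, the sequence (s_k x)_{k∈ℕ} equidistributes modulo 1 for μ-almost every x; in particular, μ-almost every x is n-normal for every integer n ≥ 2. -/

import Mathlib

open MeasureTheory Filter Set Topology
open scoped ENNReal NNReal Classical Real

noncomputable section

/-- The Gauss map `T(x) = 1/x mod 1`. -/
def gaussMap (x : ℝ) : ℝ := Int.fract x⁻¹

/-- The space `X = [0,1] ∖ ℚ` of irrational numbers in the unit interval. -/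
def gaussSet : Set ℝ := {x | x ∈ Set.Icc (0:ℝ) 1 ∧ Irrational x}

/-- The first continued fraction digit `a₁(x) = ⌊1/x⌋`. -/
def cfDigit1 (x : ℝ) : ℕ := ⌊x⁻¹⌋₊

/-- The `(i+1)`-th continued fraction digit `a_{i+1}(x) = a₁(Tⁱ x)`. -/
def cfDigit (i : ℕ) (x : ℝ) : ℕ := cfDigit1 (gaussMap^[i] x)

/-- The inverse branch `T_a(x) = 1/(x+a)` of the Gauss map. -/
def invBranch1 (a : ℕ) (x : ℝ) : ℝ := (x + (a : ℝ))⁻¹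

/-- The composed inverse branch `T_𝐚 = T_{a₁} ∘ ⋯ ∘ T_{aₙ}` for `𝐚 = [a₁,…,aₙ]`. -/
def invBranch (l : List ℕ) (x : ℝ) : ℝ := l.foldr invBranch1 x

/-- The cylinder set `I_𝐚` of points of `X` whose first digits are given by `𝐚`. -/
def cylinder (l : List ℕ) : Set ℝ :=
  {x | x ∈ gaussSet ∧ ∀ i : Fin l.length, cfDigit i.1 x = l.get i}

/-- The Birkhoff sum `S_n φ = ∑_{k<n} φ ∘ T^k`. -/
def birkhoff (φ : ℝ → ℝ) (n : ℕ) (x : ℝ) : ℝ :=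
  ∑ k ∈ Finset.range n, φ (gaussMap^[k] x)

/-- The pair `(pₙ(𝐚), qₙ(𝐚))` of numerator and denominator (continuant) of the
finite continued fraction `[a₁,…,aₙ] = pₙ/qₙ`. -/
def contPQ : List ℕ → ℕ × ℕ
  | [] => (0, 1)
  | a :: l => ((contPQ l).2, a * (contPQ l).2 + (contPQ l).1)

/-- The continuant `qₙ(𝐚)`, the denominator of `[a₁,…,aₙ]` in lowest terms. -/
def contQ (l : List ℕ) : ℕ := (contPQ l).2

/-- Words of length `n` with digits in `ℕ = {1,2,…}`. -/
def Word (n : ℕ) : Type := {l : List ℕ // l.length = n ∧ ∀ a ∈ l, 0 < a}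

/-- The periodic point `𝐚^∞` with periodic continued fraction expansion repeating `𝐚`. -/
def periodicPoint (l : List ℕ) : ℝ :=
  limUnder atTop fun k : ℕ => invBranch (List.flatten (List.replicate k l)) (1/2 : ℝ)

/-- The `n`-th partition sum `∑_{𝐚 ∈ ℕⁿ} exp(S_nφ(𝐚^∞))` appearing in the pressure. -/
def partSum (φ : ℝ → ℝ) (n : ℕ) : ℝ≥0∞ :=
  ∑' l : Word n, ENNReal.ofReal (Real.exp (birkhoff φ n (periodicPoint l.1)))

/-- `φ` has (finite) pressure `P(φ) = p`, i.e. `(1/n) log ∑_{𝐚∈ℕⁿ} exp(S_nφ(𝐚^∞)) → p`. -/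
def HasPressure (φ : ℝ → ℝ) (p : ℝ) : Prop :=
  (∀ n : ℕ, 0 < n → partSum φ n ≠ ⊤) ∧
    Tendsto (fun n : ℕ => Real.log (partSum φ n).toReal / (n : ℝ)) atTop (𝓝 p)

/-- The pressure of `φ` is finite: `P(φ) < ∞`. -/
def PressureFinite (φ : ℝ → ℝ) : Prop := ∃ p : ℝ, HasPressure φ p

/-- `φ` is locally Hölder: oscillation on `n`-cylinders decays geometrically. -/
def LocHolder (φ : ℝ → ℝ) : Prop :=
  ∃ C > (0:ℝ), ∃ θ ∈ Set.Ioo (0:ℝ) 1, ∀ l : List ℕ, l ≠ [] → (∀ a ∈ l, 0 < a) →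
    ∀ x ∈ cylinder l, ∀ y ∈ cylinder l, |φ x - φ y| ≤ C * θ ^ l.length

/-- The normalization `𝓛_φ 1 = 1` of the Ruelle transfer operator of `φ`. -/
def TransferNormalized (φ : ℝ → ℝ) : Prop :=
  ∀ x ∈ gaussSet, ∑' a : ℕ+, Real.exp (φ (invBranch1 (a : ℕ) x)) = 1

/-- `μ` is invariant under the Gauss map. -/
def GaussInvariant (μ : Measure ℝ) : Prop :=
  ∀ s : Set ℝ, MeasurableSet s → μ (gaussMap ⁻¹' s) = μ s

/-- The Gibbs property for the potential `φ` (with `P(φ) = 0`):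
`C⁻¹ e^{S_nφ(T_𝐚 x)} ≤ μ(I_𝐚) ≤ C e^{S_nφ(T_𝐚 x)}`. -/
def IsGibbs (φ : ℝ → ℝ) (μ : Measure ℝ) : Prop :=
  ∃ C : ℝ, 1 ≤ C ∧ ∀ l : List ℕ, l ≠ [] → (∀ a ∈ l, 0 < a) → ∀ x ∈ gaussSet,
    C⁻¹ * Real.exp (birkhoff φ l.length (invBranch l x)) ≤ (μ (cylinder l)).toReal ∧
      (μ (cylinder l)).toReal ≤ C * Real.exp (birkhoff φ l.length (invBranch l x))

/-- The Kolmogorov–Sinai entropy of `μ`: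
`h = lim (1/n) ∑_{𝐚∈ℕⁿ} -μ(I_𝐚) log μ(I_𝐚)`. -/
def HasEntropy (μ : Measure ℝ) (h : ℝ) : Prop :=
  Tendsto (fun n : ℕ => (∑' l : Word n, Real.negMulLog (μ (cylinder l.1)).toReal) / (n : ℝ))
    atTop (𝓝 h)

/-- `log |T'| (x) = log (1/x²)` for the Gauss map. -/
def logAbsDerivGauss (x : ℝ) : ℝ := Real.log (1 / x ^ 2)

/-- The observable `ψ = -log |T'|`. -/
def gaussPsi (x : ℝ) : ℝ := -Real.log (1 / x ^ 2)

/-- The Lyapunov exponent `λ_μ = ∫ log|T'| dμ`. -/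
def lyapunov (μ : Measure ℝ) : ℝ := ∫ x, logAbsDerivGauss x ∂μ

/-- The polynomial tail condition `μ({x : a₁(x) ≥ n}) = O(n^{-δ})`. -/
def PolyTail (μ : Measure ℝ) : Prop :=
  ∃ δ > (0:ℝ), ∃ K : ℝ, ∀ n : ℕ, 0 < n →
    (μ {x | x ∈ gaussSet ∧ n ≤ cfDigit1 x}).toReal ≤ K * (n : ℝ) ^ (-δ)

/-- The Fourier transform `μ̂(ξ) = ∫ e^{-2πiξx} dμ(x)`. -/
def muFourier (μ : Measure ℝ) (ξ : ℝ) : ℂ :=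
  ∫ x, Complex.exp (-(2 * Real.pi * ξ * x : ℝ) * Complex.I) ∂μ

/-- A sequence `u` equidistributes modulo 1. -/
def EquidistributedMod1 (u : ℕ → ℝ) : Prop :=
  ∀ a b : ℝ, 0 ≤ a → a ≤ b → b ≤ 1 →
    Tendsto (fun N : ℕ =>
        (((Finset.range N).filter fun k => Int.fract (u k) ∈ Set.Ico a b).card : ℝ) / (N : ℝ))
      atTop (𝓝 (b - a))

/-- The set `B(𝒜)` of `𝒜`-badly approximable numbers: all digits lie in `𝒜`. -/
def badSet (A : Finset ℕ) : Set ℝ := {x | x ∈ gaussSet ∧ ∀ i : ℕ, cfDigit i x ∈ A}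

/-- Locally Hölder on the subsystem `B(𝒜)`. -/
def LocHolderOn (A : Finset ℕ) (φ : ℝ → ℝ) : Prop :=
  ∃ C > (0:ℝ), ∃ θ ∈ Set.Ioo (0:ℝ) 1, ∀ l : List ℕ, l ≠ [] → (∀ a ∈ l, a ∈ A) →
    ∀ x ∈ cylinder l ∩ badSet A, ∀ y ∈ cylinder l ∩ badSet A,
      |φ x - φ y| ≤ C * θ ^ l.length

/-- The Gibbs property for the Gauss map restricted to `B(𝒜)`. -/
def IsGibbsOn (A : Finset ℕ) (φ : ℝ → ℝ) (μ : Measure ℝ) : Prop :=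
  ∃ C : ℝ, 1 ≤ C ∧ ∀ l : List ℕ, l ≠ [] → (∀ a ∈ l, a ∈ A) → ∀ x ∈ badSet A,
    C⁻¹ * Real.exp (birkhoff φ l.length (invBranch l x)) ≤ (μ (cylinder l)).toReal ∧
      (μ (cylinder l)).toReal ≤ C * Real.exp (birkhoff φ l.length (invBranch l x))

/-- The `n`-regular set `A_n(ε)` of the large deviation decomposition. -/
def regSet (φ : ℝ → ℝ) (lam s ε : ℝ) (n : ℕ) : Set ℝ :=
  {x | |birkhoff gaussPsi n x / (n : ℝ) + lam| < ε ∧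
       |birkhoff φ n x / birkhoff gaussPsi n x - s| < ε}

/-- The collection `𝓡ₙ` of `n`-regular words. -/
def regWords (φ : ℝ → ℝ) (lam s ε : ℝ) (n : ℕ) : Set (List ℕ) :=
  {l | l.length = n ∧ (∀ a ∈ l, 0 < a) ∧
       ∀ k : ℕ, n / 2 ≤ k → k ≤ n → cylinder (l.take k) ⊆ regSet φ lam s ε k}

/-- The union `Rₙ` of the `n`-regular cylinders. -/
def regUnion (φ : ℝ → ℝ) (lam s ε : ℝ) (n : ℕ) : Set ℝ :=
  ⋃ l ∈ regWords φ lam s ε n, cylinder l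

end

namespace GaussGibbs

section

/-- The words of length `n` with letters in `A`. -/
def words (A : Finset ℕ) : ℕ → Finset (List ℕ)
  | 0 => {[]}
  | n + 1 => (A ×ˢ words A n).image fun p => p.1 :: p.2

theorem mem_words {A : Finset ℕ} {n : ℕ} {l : List ℕ} :
    l ∈ words A n ↔ l.length = n ∧ ∀ a ∈ l, a ∈ A := by
  induction n generalizing l with
  | zero =>
    simp only [words, Finset.mem_singleton, List.length_eq_zero_iff]
    constructor
    · rintro rfl; simp
    · exact fun h => h.1
  | succ n ih =>
    simp only [words, Finset.mem_image, Finset.mem_product, Prod.exists]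
    constructor
    · rintro ⟨a, b, ⟨ha, hb⟩, rfl⟩
      have := ih.1 hb
      simp only [List.length_cons, List.mem_cons, forall_eq_or_imp]
      exact ⟨by omega, ha, this.2⟩
    · rintro ⟨h1, h2⟩
      cases l with
      | nil => simp at h1
      | cons a b =>
        refine ⟨a, b, ⟨h2 a (by simp), ih.2 ⟨by simpa using h1, fun x hx => h2 x (by simp [hx])⟩⟩, rfl⟩

theorem sum_words_add {M : Type*} [AddCommMonoid M] (A : Finset ℕ) (n m : ℕ) (f : List ℕ → M) :
    ∑ l ∈ words A (n + m), f l = ∑ a ∈ words A n, ∑ b ∈ words A m, f (a ++ b) := by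
  rw [← Finset.sum_product']
  refine Finset.sum_nbij' (fun l => (l.take n, l.drop n)) (fun p => p.1 ++ p.2) ?_ ?_ ?_ ?_ ?_
  · intro l hl
    rw [mem_words] at hl
    simp only [Finset.mem_product, mem_words, List.length_take, List.length_drop]
    exact ⟨⟨by omega, fun a ha => hl.2 a (List.mem_of_mem_take ha)⟩,
      ⟨by omega, fun a ha => hl.2 a (List.mem_of_mem_drop ha)⟩⟩
  · rintro ⟨a, b⟩ h
    simp only [Finset.mem_product, mem_words] at h
    simp only [mem_words, List.length_append, List.mem_append]
    refine ⟨by omega, ?_⟩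
    rintro x (hx | hx)
    · exact h.1.2 x hx
    · exact h.2.2 x hx
  · intro l _; simp
  · rintro ⟨a, b⟩ h
    simp only [Finset.mem_product, mem_words] at h
    simp [← h.1.1]
  · intro l _; simp

theorem sum_words_one {M : Type*} [AddCommMonoid M] (A : Finset ℕ) (f : List ℕ → M) :
    ∑ l ∈ words A 1, f l = ∑ a ∈ A, f [a] := by
  refine Finset.sum_nbij' (fun l => l.headI) (fun a => [a]) ?_ ?_ ?_ ?_ ?_
  · intro l hl
    rw [mem_words, List.length_eq_one_iff] at hl
    obtain ⟨⟨a, rfl⟩, h⟩ := hl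
    exact h a (by simp)
  · intro a ha; simp [mem_words, ha]
  · intro l hl
    rw [mem_words, List.length_eq_one_iff] at hl
    obtain ⟨⟨a, rfl⟩, h⟩ := hl
    rfl
  · intro a _; rfl
  · intro l hl
    rw [mem_words, List.length_eq_one_iff] at hl
    obtain ⟨⟨a, rfl⟩, h⟩ := hl
    rfl

theorem card_words (A : Finset ℕ) (n : ℕ) : (words A n).card = A.card ^ n := by
  induction n with
  | zero => simp [words]
  | succ n ih =>
    rw [words, Finset.card_image_of_injective, Finset.card_product, ih, pow_succ, mul_comm]
    rintro ⟨a, b⟩ ⟨c, d⟩ h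
    simpa using h

theorem append_mem_words {A : Finset ℕ} {n m : ℕ} {a b : List ℕ} (ha : a ∈ words A n)
    (hb : b ∈ words A m) : a ++ b ∈ words A (n + m) := by
  rw [mem_words] at *
  refine ⟨by simp [ha.1, hb.1], fun x hx => ?_⟩
  rcases List.mem_append.1 hx with h | h
  exacts [ha.2 x h, hb.2 x h]

/-- The cylinder weights of a stationary quasi-Bernoulli process on the alphabet `A`. -/
structure QuasiBernoulli (A : Finset ℕ) (P : List ℕ → ℝ) (C : ℝ) : Prop where
  one_le : 1 ≤ C
  pos : ∀ l : List ℕ, (∀ a ∈ l, a ∈ A) → 0 < P l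
  nil : P [] = 1
  sum_append : ∀ l : List ℕ, (∀ a ∈ l, a ∈ A) → ∑ a ∈ A, P (l ++ [a]) = P l
  sum_cons : ∀ l : List ℕ, (∀ a ∈ l, a ∈ A) → ∑ a ∈ A, P (a :: l) = P l
  le_mul : ∀ l k : List ℕ, (∀ a ∈ l, a ∈ A) → (∀ a ∈ k, a ∈ A) → P (l ++ k) ≤ C * (P l * P k)
  mul_le : ∀ l k : List ℕ, (∀ a ∈ l, a ∈ A) → (∀ a ∈ k, a ∈ A) → P l * P k ≤ C * P (l ++ k)

namespace QuasiBernoulli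

variable {A : Finset ℕ} {P : List ℕ → ℝ} {C : ℝ}

theorem pos' (hP : QuasiBernoulli A P C) {n : ℕ} {l : List ℕ} (hl : l ∈ words A n) : 0 < P l :=
  hP.pos l (mem_words.1 hl).2

theorem sum_words_append (hP : QuasiBernoulli A P C) (n : ℕ) (l : List ℕ)
    (hl : ∀ a ∈ l, a ∈ A) : ∑ b ∈ words A n, P (l ++ b) = P l := by
  induction n with
  | zero => simp [words]
  | succ n ih =>
    rw [sum_words_add, ← ih]
    refine Finset.sum_congr rfl fun b hb => ?_
    rw [sum_words_one]
    simp_rw [← List.append_assoc]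
    apply hP.sum_append
    intro a ha
    rcases List.mem_append.1 ha with h | h
    exacts [hl a h, (mem_words.1 hb).2 a h]

theorem sum_words_prepend (hP : QuasiBernoulli A P C) (n : ℕ) (l : List ℕ)
    (hl : ∀ a ∈ l, a ∈ A) : ∑ b ∈ words A n, P (b ++ l) = P l := by
  induction n with
  | zero => simp [words]
  | succ n ih =>
    rw [add_comm, sum_words_add, Finset.sum_comm, ← ih]
    refine Finset.sum_congr rfl fun b hb => ?_
    rw [sum_words_one]
    simp only [List.cons_append, List.nil_append]
    apply hP.sum_cons
    intro a ha
    rcases List.mem_append.1 ha with h | h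
    exacts [(mem_words.1 hb).2 a h, hl a h]

theorem sum_words (hP : QuasiBernoulli A P C) (n : ℕ) : ∑ b ∈ words A n, P b = 1 := by
  have := hP.sum_words_append n [] (by simp)
  simpa [hP.nil] using this

/-- The expectation of a function of the first `n` letters. -/
theorem sum_fst (hP : QuasiBernoulli A P C) (n m : ℕ) (f : List ℕ → ℝ) :
    ∑ a ∈ words A n, ∑ b ∈ words A m, P (a ++ b) * f a = ∑ a ∈ words A n, P a * f a := by
  refine Finset.sum_congr rfl fun a ha => ?_
  rw [← Finset.sum_mul, hP.sum_words_append m a (mem_words.1 ha).2]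

theorem sum_snd (hP : QuasiBernoulli A P C) (n m : ℕ) (f : List ℕ → ℝ) :
    ∑ a ∈ words A n, ∑ b ∈ words A m, P (a ++ b) * f b = ∑ b ∈ words A m, P b * f b := by
  rw [Finset.sum_comm]
  refine Finset.sum_congr rfl fun a ha => ?_
  rw [← Finset.sum_mul, hP.sum_words_prepend n a (mem_words.1 ha).2]

end QuasiBernoulli

end

section

namespace QuasiBernoulli

variable {A : Finset ℕ} {P : List ℕ → ℝ} {C : ℝ}

/-- The mean per letter of the observable `D` over words of length `n`. -/
noncomputable def mean (A : Finset ℕ) (P D : List ℕ → ℝ) (n : ℕ) : ℝ :=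
  (∑ a ∈ words A n, P a * D a) / n

/-- The variance of `D / n` over words of length `n`. -/
noncomputable def var (A : Finset ℕ) (P D : List ℕ → ℝ) (n : ℕ) : ℝ :=
  ∑ a ∈ words A n, P a * (D a / n - mean A P D n) ^ 2

/-- The mean absolute deviation of `D / n` over words of length `n`. -/
noncomputable def dev (A : Finset ℕ) (P D : List ℕ → ℝ) (n : ℕ) : ℝ :=
  ∑ a ∈ words A n, P a * |D a / n - mean A P D n|

theorem abs_mean_le (hP : QuasiBernoulli A P C) {D : List ℕ → ℝ} {C₂ : ℝ}
    (hb : ∀ n, ∀ a ∈ words A n, |D a| ≤ C₂ * n) {n : ℕ} (hn : 1 ≤ n) : |mean A P D n| ≤ C₂ := by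
  have hn' : (0 : ℝ) < n := by exact_mod_cast hn
  rw [mean, abs_div, abs_of_pos hn', div_le_iff₀ hn']
  calc |∑ a ∈ words A n, P a * D a| ≤ ∑ a ∈ words A n, |P a * D a| :=
        Finset.abs_sum_le_sum_abs _ _
    _ ≤ ∑ a ∈ words A n, P a * (C₂ * n) := by
        refine Finset.sum_le_sum fun a ha => ?_
        rw [abs_mul, abs_of_pos (hP.pos' ha)]
        exact mul_le_mul_of_nonneg_left (hb n a ha) (hP.pos' ha).le
    _ = C₂ * n := by rw [← Finset.sum_mul, hP.sum_words, one_mul]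

theorem mean_two_mul (hP : QuasiBernoulli A P C) {D : List ℕ → ℝ} {C₁ : ℝ}
    (hD : ∀ n m, ∀ a ∈ words A n, ∀ b ∈ words A m, |D (a ++ b) - D a - D b| ≤ C₁)
    {n : ℕ} (hn : 1 ≤ n) : |mean A P D (n + n) - mean A P D n| ≤ C₁ / (2 * n) := by
  have hn' : (0 : ℝ) < n := by exact_mod_cast hn
  have h1 : mean A P D (n + n) - mean A P D n =
      (∑ a ∈ words A n, ∑ b ∈ words A n, P (a ++ b) * (D (a ++ b) - D a - D b)) / (2 * n) := by
    simp only [mul_sub, Finset.sum_sub_distrib]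
    rw [hP.sum_fst, hP.sum_snd, mean, mean, sum_words_add]
    push_cast
    field_simp
    ring
  rw [h1, abs_div, abs_of_pos (by positivity : (0 : ℝ) < 2 * n)]
  gcongr
  calc |∑ a ∈ words A n, ∑ b ∈ words A n, P (a ++ b) * (D (a ++ b) - D a - D b)|
      ≤ ∑ a ∈ words A n, ∑ b ∈ words A n, |P (a ++ b) * (D (a ++ b) - D a - D b)| :=
        (Finset.abs_sum_le_sum_abs _ _).trans
          (Finset.sum_le_sum fun _ _ => Finset.abs_sum_le_sum_abs _ _)
    _ ≤ ∑ a ∈ words A n, ∑ b ∈ words A n, P (a ++ b) * C₁ := by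
        refine Finset.sum_le_sum fun a ha => Finset.sum_le_sum fun b hb => ?_
        have := hP.pos' (append_mem_words ha hb)
        rw [abs_mul, abs_of_pos this]
        exact mul_le_mul_of_nonneg_left (hD n n a ha b hb) this.le
    _ = C₁ := by
        simp_rw [← Finset.sum_mul]
        rw [← sum_words_add A n n P, hP.sum_words, one_mul]

theorem dev_sq_le (hP : QuasiBernoulli A P C) {D : List ℕ → ℝ} {C₁ C₂ : ℝ}
    (hD : ∀ n m, ∀ a ∈ words A n, ∀ b ∈ words A m, |D (a ++ b) - D a - D b| ≤ C₁)
    (hb : ∀ n, ∀ a ∈ words A n, |D a| ≤ C₂ * n) {n : ℕ} (hn : 1 ≤ n) :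
    dev A P D n ^ 2 ≤ 4 * C * (var A P D n - var A P D (n + n) + 4 * C₁ * C₂ / n) := by
  have hn' : (0 : ℝ) < n := by exact_mod_cast hn
  have hC : 0 < C := lt_of_lt_of_le one_pos hP.one_le
  set e := mean A P D n with he
  set X : List ℕ → ℝ := fun a => D a / n - e with hX
  have hXb : ∀ a ∈ words A n, |X a| ≤ 2 * C₂ := by
    intro a ha
    have h1 : |D a / n| ≤ C₂ := by
      rw [abs_div, abs_of_pos hn', div_le_iff₀ hn']; exact hb n a ha
    have h2 := hP.abs_mean_le hb hn
    calc |X a| ≤ |D a / n| + |e| := abs_sub _ _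
      _ ≤ 2 * C₂ := by linarith
  have hXb2 : ∀ a ∈ words A (n + n), |D a / (n + n : ℕ) - mean A P D (n + n)| ≤ 2 * C₂ := by
    intro a ha
    have hn2 : (0 : ℝ) < (n + n : ℕ) := by exact_mod_cast (by omega : 0 < n + n)
    have h1 : |D a / (n + n : ℕ)| ≤ C₂ := by
      rw [abs_div, abs_of_pos hn2, div_le_iff₀ hn2]; exact hb _ a ha
    have h2 := hP.abs_mean_le hb (by omega : 1 ≤ n + n)
    calc _ ≤ |D a / (n + n : ℕ)| + |mean A P D (n + n)| := abs_sub _ _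
      _ ≤ 2 * C₂ := by linarith
  -- the pointwise inequality
  have hpt : ∀ a ∈ words A n, ∀ b ∈ words A n,
      (D (a ++ b) / (n + n : ℕ) - mean A P D (n + n)) ^ 2 ≤
        X a ^ 2 / 2 + X b ^ 2 / 2 - (max (X a) 0) * (max (-X b) 0) + 4 * C₁ * C₂ / n := by
    intro a ha b hb'
    set Y := D (a ++ b) / (n + n : ℕ) - mean A P D (n + n) with hY
    have h1 : |Y - (X a + X b) / 2| ≤ C₁ / n := by
      have h3 : Y - (X a + X b) / 2 =
          (D (a ++ b) - D a - D b) / (2 * n) - (mean A P D (n + n) - e) := by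
        simp only [hY, hX]; push_cast; field_simp; ring
      have h4 : |(D (a ++ b) - D a - D b) / (2 * n)| ≤ C₁ / (2 * n) := by
        rw [abs_div, abs_of_pos (by positivity : (0 : ℝ) < 2 * n)]
        gcongr
        exact hD n n a ha b hb'
      have h5 := hP.mean_two_mul hD hn
      rw [h3]
      calc _ ≤ _ := abs_sub _ _
        _ ≤ C₁ / (2 * n) + C₁ / (2 * n) := add_le_add h4 h5
        _ = C₁ / n := by field_simp; ring
    have h2 : |Y + (X a + X b) / 2| ≤ 4 * C₂ := by
      have h6 := hXb2 _ (append_mem_words ha hb')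
      have h7 := hXb a ha
      have h8 := hXb b hb'
      rw [abs_le] at *
      constructor <;> linarith
    have h9 : Y ^ 2 - ((X a + X b) / 2) ^ 2 ≤ 4 * C₁ * C₂ / n := by
      calc Y ^ 2 - ((X a + X b) / 2) ^ 2 = (Y - (X a + X b) / 2) * (Y + (X a + X b) / 2) := by ring
        _ ≤ |Y - (X a + X b) / 2| * |Y + (X a + X b) / 2| := by
          rw [← abs_mul]; exact le_abs_self _
        _ ≤ C₁ / n * (4 * C₂) := by
          apply mul_le_mul h1 h2 (abs_nonneg _) ((abs_nonneg _).trans h1)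
        _ = _ := by ring
    have h10 : (max (X a) 0) * (max (-X b) 0) ≤ (X a - X b) ^ 2 / 4 := by
      rcases le_total (X a) 0 with h | h
      · rw [max_eq_right h]; nlinarith [sq_nonneg (X a - X b)]
      · rcases le_total (-X b) 0 with h' | h'
        · rw [max_eq_right h']; nlinarith [sq_nonneg (X a - X b)]
        · rw [max_eq_left h, max_eq_left h']; nlinarith [sq_nonneg (X a + X b)]
    nlinarith
  have hvar : var A P D (n + n) ≤ var A P D n + 4 * C₁ * C₂ / n -
      ∑ a ∈ words A n, ∑ b ∈ words A n, P (a ++ b) * ((max (X a) 0) * (max (-X b) 0)) := by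
    rw [var, sum_words_add]
    calc _ ≤ ∑ a ∈ words A n, ∑ b ∈ words A n, P (a ++ b) *
          (X a ^ 2 / 2 + X b ^ 2 / 2 - (max (X a) 0) * (max (-X b) 0) + 4 * C₁ * C₂ / n) := by
          refine Finset.sum_le_sum fun a ha => Finset.sum_le_sum fun b hb' => ?_
          exact mul_le_mul_of_nonneg_left (hpt a ha b hb') (hP.pos' (append_mem_words ha hb')).le
      _ = _ := by
          simp only [mul_sub, mul_add, Finset.sum_sub_distrib, Finset.sum_add_distrib]
          rw [hP.sum_fst n n (fun a => X a ^ 2 / 2), hP.sum_snd n n (fun a => X a ^ 2 / 2),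
            hP.sum_fst n n (fun _ => 4 * C₁ * C₂ / n), ← Finset.sum_mul, hP.sum_words, var]
          simp only [hX, he, mul_div_assoc', ← Finset.sum_div]
          ring
  have hsum0 : ∑ a ∈ words A n, P a * X a = 0 := by
    simp only [hX, mul_sub, Finset.sum_sub_distrib, ← Finset.sum_mul, hP.sum_words]
    rw [he, mean]
    simp only [mul_div_assoc', ← Finset.sum_div, one_mul, sub_self]
  have hpm : (∑ a ∈ words A n, P a * max (X a) 0) - ∑ a ∈ words A n, P a * max (-X a) 0 = 0 := by
    refine Eq.trans ?_ hsum0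
    rw [← Finset.sum_sub_distrib]
    refine Finset.sum_congr rfl fun a _ => ?_
    rcases le_total (X a) 0 with h | h
    · rw [max_eq_right h, max_eq_left (by linarith)]; ring
    · rw [max_eq_left h, max_eq_right (by linarith)]; ring
  have hpp : (∑ a ∈ words A n, P a * max (X a) 0) + ∑ a ∈ words A n, P a * max (-X a) 0 =
      dev A P D n := by
    rw [dev, ← Finset.sum_add_distrib]
    refine Finset.sum_congr rfl fun a _ => ?_
    change _ = P a * |X a|
    rcases le_total (X a) 0 with h | h
    · rw [max_eq_right h, max_eq_left (by linarith), abs_of_nonpos h]; ring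
    · rw [max_eq_left h, max_eq_right (by linarith), abs_of_nonneg h]; ring
  have hlow : (∑ a ∈ words A n, P a * max (X a) 0) * (∑ a ∈ words A n, P a * max (-X a) 0) ≤
      C * ∑ a ∈ words A n, ∑ b ∈ words A n, P (a ++ b) * ((max (X a) 0) * (max (-X b) 0)) := by
    rw [Finset.sum_mul_sum, Finset.mul_sum]
    refine Finset.sum_le_sum fun a ha => ?_
    rw [Finset.mul_sum]
    refine Finset.sum_le_sum fun b hb' => ?_
    have h1 := hP.mul_le a b (mem_words.1 ha).2 (mem_words.1 hb').2
    have h2 : 0 ≤ max (X a) 0 * max (-X b) 0 := by positivity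
    nlinarith
  set p := ∑ a ∈ words A n, P a * max (X a) 0
  set q := ∑ a ∈ words A n, P a * max (-X a) 0
  have hpq : p = q := by linarith
  rw [← hpp, ← hpq]
  rw [← hpq] at hlow
  nlinarith

theorem exists_dev_lt (hP : QuasiBernoulli A P C) {D : List ℕ → ℝ} {C₁ C₂ : ℝ}
    (hD : ∀ n m, ∀ a ∈ words A n, ∀ b ∈ words A m, |D (a ++ b) - D a - D b| ≤ C₁)
    (hb : ∀ n, ∀ a ∈ words A n, |D a| ≤ C₂ * n) {ε : ℝ} (hε : 0 < ε) (n₀ : ℕ) :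
    ∃ n, n₀ ≤ n ∧ dev A P D n < ε := by
  by_contra! hcon
  have hC : 0 < C := lt_of_lt_of_le one_pos hP.one_le
  set d := ε ^ 2 / (8 * C) with hd
  have hdpos : 0 < d := by positivity
  obtain ⟨k₁, hk₁⟩ := exists_nat_gt (|4 * C₁ * C₂| / d)
  set k₀ := max n₀ (max k₁ 1) with hk₀
  have hstep : ∀ n, k₀ ≤ n → var A P D (n + n) ≤ var A P D n - d := by
    intro n hn
    have hn1 : 1 ≤ n := le_trans (by simp [hk₀]) hn
    have hn' : (0 : ℝ) < n := by exact_mod_cast hn1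
    have h1 := hP.dev_sq_le hD hb hn1
    have h2 : ε ≤ dev A P D n := hcon n (le_trans (by simp [hk₀]) hn)
    have h3 : 4 * C₁ * C₂ / n ≤ d := by
      rw [div_le_iff₀ hn']
      rw [div_lt_iff₀ hdpos] at hk₁
      have h4 : (k₁ : ℝ) ≤ n := by exact_mod_cast le_trans (by simp [hk₀]) hn
      have := le_abs_self (4 * C₁ * C₂)
      nlinarith
    have h5 : ε ^ 2 ≤ dev A P D n ^ 2 := by gcongr
    have h6 : ε ^ 2 = 8 * C * d := by rw [hd]; field_simp
    have h7 : 4 * C * (2 * d) ≤ 4 * C * (var A P D n - var A P D (n + n) + 4 * C₁ * C₂ / n) := by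
      linarith
    have h8 := le_of_mul_le_mul_left h7 (by positivity)
    linarith
  have hiter : ∀ j : ℕ, var A P D (2 ^ (k₀ + j)) ≤ var A P D (2 ^ k₀) - j * d := by
    intro j
    induction j with
    | zero => simp
    | succ j ih =>
      have h1 := hstep (2 ^ (k₀ + j)) ((Nat.lt_two_pow_self).le.trans
        (Nat.pow_le_pow_right (by norm_num) (by omega)))
      rw [← two_mul, ← pow_succ'] at h1
      rw [← add_assoc]
      push_cast
      linarith
  obtain ⟨j, hj⟩ := exists_nat_gt (var A P D (2 ^ k₀) / d)
  rw [div_lt_iff₀ hdpos] at hj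
  have h0 : 0 ≤ var A P D (2 ^ (k₀ + j)) :=
    Finset.sum_nonneg fun a ha => mul_nonneg (hP.pos' ha).le (sq_nonneg _)
  linarith [hiter j]

/-- One-sided large deviations for an almost additive observable of positive mean. -/
theorem exists_sum_nonpos_le (hP : QuasiBernoulli A P C) {D : List ℕ → ℝ} {C₁ C₂ e : ℝ}
    (hD : ∀ n m, ∀ a ∈ words A n, ∀ b ∈ words A m, |D (a ++ b) - D a - D b| ≤ C₁)
    (hb : ∀ n, ∀ a ∈ words A n, |D a| ≤ C₂ * n) (he : 0 < e)
    (hmean : Tendsto (mean A P D) atTop (𝓝 e)) :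
    ∃ K η : ℝ, 0 < K ∧ 0 < η ∧ η < 1 ∧
      ∀ n, ∑ a ∈ (words A n).filter (fun a => D a ≤ 0), P a ≤ K * η ^ n := by
  have hC : 0 < C := lt_of_lt_of_le one_pos hP.one_le
  have hC₁ : 0 ≤ C₁ := by
    have := hD 0 0 [] (by simp [words]) [] (by simp [words])
    exact (abs_nonneg _).trans this
  obtain ⟨n₁, hn₁⟩ := eventually_atTop.1 (hmean.eventually (lt_mem_nhds (half_lt_self he)))
  obtain ⟨n₂, hn₂⟩ := exists_nat_gt (8 * C₁ / e)
  obtain ⟨n, hn, hdev⟩ := hP.exists_dev_lt hD hb (ε := e / (8 * C)) (by positivity)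
    (max n₁ (max n₂ 1))
  have hn1 : 1 ≤ n := le_trans (by simp) hn
  have hn' : (0 : ℝ) < n := by exact_mod_cast hn1
  have hmn : e / 2 < mean A P D n := hn₁ n (le_trans (by simp) hn)
  have hC₁n : C₁ ≤ n * e / 8 := by
    rw [div_lt_iff₀ he] at hn₂
    have : (n₂ : ℝ) ≤ n := by exact_mod_cast le_trans (by simp) hn
    nlinarith
  have hC₂ : 0 ≤ C₂ := (abs_nonneg _).trans (hP.abs_mean_le hb hn1)
  set M := C₂ * n + C₁ + 1 with hM
  have hMpos : 0 < M := by positivity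
  -- the conditional mean of a block
  have hcond : ∀ u : List ℕ, (∀ a ∈ u, a ∈ A) →
      P u * (3 / 8 * (n * e)) ≤ ∑ b ∈ words A n, P (u ++ b) * D b := by
    intro u hu
    have h1 : ∑ b ∈ words A n, P (u ++ b) * |D b / n - mean A P D n| ≤ P u * (e / 8) := by
      calc _ ≤ ∑ b ∈ words A n, C * (P u * P b) * |D b / n - mean A P D n| := by
            refine Finset.sum_le_sum fun b hb' => ?_
            exact mul_le_mul_of_nonneg_right (hP.le_mul u b hu (mem_words.1 hb').2) (abs_nonneg _)
        _ = C * P u * dev A P D n := by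
            rw [dev, Finset.mul_sum]; exact Finset.sum_congr rfl fun b _ => by ring
        _ ≤ C * P u * (e / (8 * C)) := by
            have := hP.pos u hu
            gcongr
        _ = P u * (e / 8) := by field_simp
    have h2 : ∑ b ∈ words A n, P (u ++ b) * D b ≥
        ∑ b ∈ words A n, (n * mean A P D n * P (u ++ b) -
          n * (P (u ++ b) * |D b / n - mean A P D n|)) := by
      refine Finset.sum_le_sum fun b hb' => ?_
      have h3 : 0 < P (u ++ b) := hP.pos _ fun a ha => by
        rcases List.mem_append.1 ha with h | h
        exacts [hu a h, (mem_words.1 hb').2 a h]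
      have h4 : D b = n * (D b / n) := by field_simp
      have h5 := neg_abs_le (D b / n - mean A P D n)
      have h6 : n * mean A P D n - n * |D b / n - mean A P D n| ≤ D b := by
        nlinarith
      nlinarith
    rw [Finset.sum_sub_distrib, ← Finset.mul_sum, ← Finset.mul_sum,
      hP.sum_words_append n u hu] at h2
    have h7 := hP.pos u hu
    have h8 : (n : ℝ) * (∑ b ∈ words A n, P (u ++ b) * |D b / n - mean A P D n|) ≤
      n * (P u * (e / 8)) := by gcongr
    have h9 : (n : ℝ) * (e / 2) * P u ≤ n * mean A P D n * P u := by gcongr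
    linarith
  set t := min (1 / M) (n * e / 8 / M ^ 2) with ht
  have htpos : 0 < t := by positivity
  have htM : t * M ≤ 1 := by
    have : t ≤ 1 / M := min_le_left _ _
    calc t * M ≤ 1 / M * M := by gcongr
      _ = 1 := by field_simp
  have htM2 : t * M ^ 2 ≤ n * e / 8 := by
    have : t ≤ n * e / 8 / M ^ 2 := min_le_right _ _
    calc t * M ^ 2 ≤ n * e / 8 / M ^ 2 * M ^ 2 := by gcongr
      _ = n * e / 8 := by field_simp
  set r := 1 - t * (n * e) / 8 with hr
  have hr1 : r < 1 := by rw [hr]; have : 0 < t * (n * e) := by positivity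
                         linarith
  have hblock : ∀ u : List ℕ, (∀ a ∈ u, a ∈ A) →
      ∑ b ∈ words A n, P (u ++ b) * Real.exp (-t * (D b - C₁)) ≤ P u * r := by
    intro u hu
    have hle : ∀ b ∈ words A n, Real.exp (-t * (D b - C₁)) ≤
        (1 + t * C₁ + t ^ 2 * M ^ 2) - t * D b := by
      intro b hb'
      have h1 : |D b - C₁| ≤ M := by
        have := hb n b hb'
        calc |D b - C₁| ≤ |D b| + |C₁| := abs_sub _ _
          _ ≤ M := by rw [abs_of_nonneg hC₁]; linarith
      have h2 : |-t * (D b - C₁)| ≤ 1 := by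
        rw [abs_mul, abs_neg, abs_of_pos htpos]
        exact (mul_le_mul_of_nonneg_left h1 htpos.le).trans htM
      have h3 := Real.abs_exp_sub_one_sub_id_le h2
      have h4 : (-t * (D b - C₁)) ^ 2 ≤ t ^ 2 * M ^ 2 := by
        rw [mul_pow, neg_sq, ← sq_abs (D b - C₁)]
        gcongr
      have h5 := (abs_le.1 h3).2
      linarith
    calc _ ≤ ∑ b ∈ words A n, P (u ++ b) * ((1 + t * C₁ + t ^ 2 * M ^ 2) - t * D b) := by
          refine Finset.sum_le_sum fun b hb' => ?_
          refine mul_le_mul_of_nonneg_left (hle b hb') (hP.pos _ fun a ha => ?_).le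
          rcases List.mem_append.1 ha with h | h
          exacts [hu a h, (mem_words.1 hb').2 a h]
      _ = P u * (1 + t * C₁ + t ^ 2 * M ^ 2) - t * ∑ b ∈ words A n, P (u ++ b) * D b := by
          simp only [mul_sub, Finset.sum_sub_distrib]
          rw [← Finset.sum_mul, hP.sum_words_append n u hu, Finset.mul_sum]
          congr 1
          exact Finset.sum_congr rfl fun b _ => by ring
      _ ≤ P u * (1 + t * C₁ + t ^ 2 * M ^ 2) - t * (P u * (3 / 8 * (n * e))) := by
          gcongr
          exact hcond u hu
      _ ≤ P u * r := by
          have h1 := hP.pos u hu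
          have h2 : t * C₁ ≤ t * (n * e / 8) := by gcongr
          have h3 : t ^ 2 * M ^ 2 ≤ t * (n * e / 8) := by
            calc t ^ 2 * M ^ 2 = t * (t * M ^ 2) := by ring
              _ ≤ _ := by gcongr
          have h4 : 1 + t * C₁ + t ^ 2 * M ^ 2 - t * (3 / 8 * (n * e)) ≤ r := by
            rw [hr]; linarith
          nlinarith
  have hr0 : 0 < r := by
    have h1 := hblock [] (by simp)
    rw [hP.nil, one_mul] at h1
    refine lt_of_lt_of_le (Finset.sum_pos (fun b hb' => ?_) ?_) h1
    · exact mul_pos (by simpa using hP.pos' hb') (Real.exp_pos _)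
    · by_contra hne
      rw [Finset.not_nonempty_iff_eq_empty] at hne
      have := hP.sum_words n
      simp [hne] at this
  have hZ : ∀ j : ℕ, ∑ a ∈ words A (j * n), P a * Real.exp (-t * D a) ≤
      Real.exp (-t * D []) * r ^ j := by
    intro j
    induction j with
    | zero => simp [words, hP.nil]
    | succ j ih =>
      rw [add_mul, one_mul, sum_words_add]
      calc _ ≤ ∑ a ∈ words A (j * n), ∑ b ∈ words A n,
            Real.exp (-t * D a) * (P (a ++ b) * Real.exp (-t * (D b - C₁))) := by
            refine Finset.sum_le_sum fun a ha => Finset.sum_le_sum fun b hb' => ?_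
            have h1 := (abs_le.1 (hD _ _ a ha b hb')).1
            have h2 := hP.pos' (append_mem_words ha hb')
            rw [mul_left_comm, ← Real.exp_add]
            refine mul_le_mul_of_nonneg_left (Real.exp_le_exp.2 ?_) h2.le
            nlinarith
        _ ≤ ∑ a ∈ words A (j * n), Real.exp (-t * D a) * (P a * r) := by
            refine Finset.sum_le_sum fun a ha => ?_
            rw [← Finset.mul_sum]
            exact mul_le_mul_of_nonneg_left (hblock a (mem_words.1 ha).2) (Real.exp_pos _).le
        _ = (∑ a ∈ words A (j * n), P a * Real.exp (-t * D a)) * r := by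
            rw [Finset.sum_mul]; exact Finset.sum_congr rfl fun a _ => by ring
        _ ≤ Real.exp (-t * D []) * r ^ j * r := by gcongr
        _ = _ := by ring
  set E := Real.exp (-t * D []) * Real.exp (t * (C₂ * n + C₁)) with hE
  have hfinal : ∀ N, ∑ a ∈ (words A N).filter (fun a => D a ≤ 0), P a ≤ E * r ^ (N / n) := by
    intro N
    have hN : N = (N / n) * n + N % n := by rw [mul_comm]; exact (Nat.div_add_mod N n).symm
    calc ∑ a ∈ (words A N).filter (fun a => D a ≤ 0), P a
        ≤ ∑ a ∈ words A N, P a * Real.exp (-t * D a) := by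
          rw [Finset.sum_filter]
          refine Finset.sum_le_sum fun a ha => ?_
          have h1 := hP.pos' ha
          split_ifs with h
          · have h2 : 1 ≤ Real.exp (-t * D a) := Real.one_le_exp (by nlinarith)
            nlinarith
          · positivity
      _ = ∑ a ∈ words A (N / n * n), ∑ b ∈ words A (N % n),
            P (a ++ b) * Real.exp (-t * D (a ++ b)) := by
          rw [← sum_words_add A _ _ fun a => P a * Real.exp (-t * D a), ← hN]
      _ ≤ ∑ a ∈ words A (N / n * n), ∑ b ∈ words A (N % n),
            P (a ++ b) * (Real.exp (-t * D a) * Real.exp (t * (C₂ * n + C₁))) := by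
          refine Finset.sum_le_sum fun a ha => Finset.sum_le_sum fun b hb' => ?_
          have h1 := (abs_le.1 (hD _ _ a ha b hb')).1
          have h2 := hP.pos' (append_mem_words ha hb')
          have h3 := (abs_le.1 (hb _ b hb')).1
          have h4 : ((N % n : ℕ) : ℝ) ≤ n := by exact_mod_cast (Nat.mod_lt N hn1).le
          have h5 : C₂ * ((N % n : ℕ) : ℝ) ≤ C₂ * n := by gcongr
          rw [← Real.exp_add]
          refine mul_le_mul_of_nonneg_left (Real.exp_le_exp.2 ?_) h2.le
          nlinarith
      _ = (∑ a ∈ words A (N / n * n), P a * Real.exp (-t * D a)) *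
            Real.exp (t * (C₂ * n + C₁)) := by
          rw [hP.sum_fst _ _ (fun a => Real.exp (-t * D a) * Real.exp (t * (C₂ * n + C₁))),
            Finset.sum_mul]
          exact Finset.sum_congr rfl fun a _ => by ring
      _ ≤ Real.exp (-t * D []) * r ^ (N / n) * Real.exp (t * (C₂ * n + C₁)) := by
          gcongr
          exact hZ _
      _ = _ := by rw [hE]; ring
  refine ⟨E / r, r ^ (1 / (n : ℝ)), by positivity, by positivity,
    Real.rpow_lt_one hr0.le hr1 (by positivity), fun N => (hfinal N).trans ?_⟩
  rw [← Real.rpow_natCast (r ^ (1 / (n : ℝ))), ← Real.rpow_mul hr0.le, div_mul_eq_mul_div,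
    mul_div_assoc]
  refine mul_le_mul_of_nonneg_left ?_ (by positivity)
  rw [le_div_iff₀ hr0, ← pow_succ, ← Real.rpow_natCast]
  refine Real.rpow_le_rpow_of_exponent_ge hr0 hr1.le ?_
  rw [one_div, inv_mul_le_iff₀ hn']
  have : N < n * (N / n + 1) := Nat.lt_mul_div_succ N hn1
  exact_mod_cast this.le

end QuasiBernoulli

end

section

/-- The pair of denominators `(qₙ, qₙ₋₁)` of the last two convergents of `[a₁, …, aₙ]`. -/
def dens (l : List ℕ) : ℕ × ℕ := l.foldl (fun s a => (a * s.1 + s.2, s.1)) (1, 0)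

/-- The denominator `qₙ` of the continued fraction `[a₁, …, aₙ]`. -/
def den (l : List ℕ) : ℕ := (dens l).1

/-- The denominator `qₙ₋₁` of the last but one convergent of `[a₁, …, aₙ]`. -/
def den' (l : List ℕ) : ℕ := (dens l).2

@[simp] theorem den_nil : den [] = 1 := rfl
@[simp] theorem den'_nil : den' [] = 0 := rfl

@[simp] theorem den_concat (l : List ℕ) (a : ℕ) : den (l ++ [a]) = a * den l + den' l := by
  simp [den, den', dens, List.foldl_append]

@[simp] theorem den'_concat (l : List ℕ) (a : ℕ) : den' (l ++ [a]) = den l := by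
  simp [den, den', dens, List.foldl_append]

theorem forall_mem_concat {p : ℕ → Prop} {l : List ℕ} {a : ℕ} :
    (∀ x ∈ l ++ [a], p x) ↔ (∀ x ∈ l, p x) ∧ p a := by
  simp [or_imp, forall_and]

theorem one_le_den {l : List ℕ} (hl : ∀ a ∈ l, 1 ≤ a) : 1 ≤ den l ∧ den' l ≤ den l := by
  induction l using List.reverseRecOn with
  | nil => simp
  | append_singleton l a ih =>
    rw [forall_mem_concat] at hl
    have := ih hl.1
    rw [den_concat, den'_concat]
    constructor <;> nlinarith [hl.2]

theorem den_pos {l : List ℕ} (hl : ∀ a ∈ l, 1 ≤ a) : 0 < den l := (one_le_den hl).1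

theorem den'_le_den {l : List ℕ} (hl : ∀ a ∈ l, 1 ≤ a) : den' l ≤ den l := (one_le_den hl).2

theorem den_mul_den_le (u c : List ℕ) :
    den u * den c ≤ den (u ++ c) ∧ den u * den' c ≤ den' (u ++ c) := by
  induction c using List.reverseRecOn with
  | nil => simp
  | append_singleton c a ih =>
    rw [← List.append_assoc, den_concat, den'_concat, den_concat, den'_concat]
    exact ⟨by nlinarith [ih.1, ih.2, Nat.zero_le a], ih.1⟩

theorem den_append_le_aux {u : List ℕ} (hu : ∀ a ∈ u, 1 ≤ a) (c : List ℕ) (hc : ∀ a ∈ c, 1 ≤ a) :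
    c ≠ [] → den (u ++ c) ≤ 2 * (den u * den c) ∧ den' (u ++ c) ≤ 2 * (den u * den' c) := by
  induction c using List.reverseRecOn with
  | nil => simp
  | append_singleton c a ih =>
    intro _
    rw [forall_mem_concat] at hc
    rw [← List.append_assoc, den_concat, den'_concat, den_concat, den'_concat]
    by_cases h : c = []
    · subst h
      have h1 := den'_le_den hu
      simp only [List.append_nil, den_nil, den'_nil]
      constructor
      · nlinarith [hc.2, Nat.zero_le (den u)]
      · omega
    · have := ih hc.1 h
      exact ⟨by nlinarith [this.1, this.2, Nat.zero_le a], this.1⟩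

theorem den_append_le {u c : List ℕ} (hu : ∀ a ∈ u, 1 ≤ a) (hc : ∀ a ∈ c, 1 ≤ a) :
    den (u ++ c) ≤ 2 * (den u * den c) := by
  by_cases h : c = []
  · subst h; simp; omega
  · exact (den_append_le_aux hu c hc h).1

theorem den_concat_le {K : ℕ} {l : List ℕ} {a : ℕ} (hl : ∀ a ∈ l, 1 ≤ a) (ha : a + 1 ≤ K) :
    den (l ++ [a]) ≤ K * den l := by
  have := den'_le_den hl
  rw [den_concat]
  nlinarith

theorem den_le_pow {K : ℕ} {l : List ℕ} (hl : ∀ a ∈ l, 1 ≤ a ∧ a + 1 ≤ K) :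
    den l ≤ K ^ l.length := by
  induction l using List.reverseRecOn with
  | nil => simp
  | append_singleton l a ih =>
    rw [forall_mem_concat] at hl
    refine (den_concat_le (fun x hx => (hl.1 x hx).1) hl.2.2).trans ?_
    rw [List.length_append, List.length_singleton, pow_succ, mul_comm]
    exact Nat.mul_le_mul_right _ (ih hl.1)

theorem two_pow_le_den_mul {l : List ℕ} (hl : ∀ a ∈ l, 1 ≤ a) (h : l ≠ []) :
    2 ^ l.length ≤ 2 * (den l * den' l) := by
  induction l using List.reverseRecOn with
  | nil => simp at h
  | append_singleton l a ih =>
    rw [forall_mem_concat] at hl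
    rw [List.length_append, List.length_singleton, den_concat, den'_concat]
    by_cases hn : l = []
    · subst hn; simp; exact hl.2
    · have h1 := ih hl.1 hn
      have h2 := den'_le_den hl.1
      have h3 : 2 * den' l ≤ a * den l + den' l := by nlinarith [hl.2]
      rw [pow_succ]
      nlinarith [Nat.zero_le (den l)]

theorem two_pow_le_den_sq {l : List ℕ} (hl : ∀ a ∈ l, 1 ≤ a) :
    2 ^ l.length ≤ 2 * den l ^ 2 := by
  by_cases h : l = []
  · subst h; simp
  · have := two_pow_le_den_mul hl h
    have h2 := den'_le_den hl
    nlinarith [Nat.zero_le (den l)]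

theorem le_mul_den' {K : ℕ} {l : List ℕ} (hl : ∀ a ∈ l, 1 ≤ a ∧ a + 1 ≤ K) (h : l ≠ []) :
    den l ≤ K * den' l := by
  induction l using List.reverseRecOn with
  | nil => simp at h
  | append_singleton l a _ =>
    rw [forall_mem_concat] at hl
    rw [den'_concat]
    exact den_concat_le (fun x hx => (hl.1 x hx).1) hl.2.2

theorem abs_det_append (u v c : List ℕ) :
    |(den' (u ++ c) : ℤ) * den (v ++ c) - den' (v ++ c) * den (u ++ c)| =
      |(den' u : ℤ) * den v - den' v * den u| := by
  induction c using List.reverseRecOn with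
  | nil => simp
  | append_singleton c a ih =>
    rw [← ih, ← List.append_assoc, ← List.append_assoc, den_concat, den'_concat, den_concat,
      den'_concat, ← abs_neg]
    push_cast
    congr 1
    ring

/-- The distance between the pairs of denominators of two words. -/
noncomputable def denDist (a b : List ℕ) : ℝ :=
  max |(den b : ℝ) - den a| |(den' b : ℝ) - den' a|

theorem den_mul_le_det {K : ℕ} {u v : List ℕ} {x y : ℕ}
    (hu : ∀ a ∈ u, 1 ≤ a ∧ a + 1 ≤ K) (hv : ∀ a ∈ v, 1 ≤ a ∧ a + 1 ≤ K)
    (hlen : u.length = v.length) (hK : 1 ≤ K) (hxy : x < y) :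
    (den u * den v : ℤ) ≤ K * |(den u : ℤ) * den (v ++ [y]) - den v * den (u ++ [x])| := by
  have hu1 := one_le_den fun a ha => (hu a ha).1
  have hv1 := one_le_den fun a ha => (hv a ha).1
  have h1 : (den u : ℤ) * den (v ++ [y]) - den v * den (u ++ [x]) =
      (y - x) * (den u * den v) + den u * den' v - den v * den' u := by
    rw [den_concat, den_concat]; push_cast; ring
  rw [h1]
  have h2 : ((1 : ℤ)) ≤ y - x := by omega
  zify at hu1 hv1 hK
  have h0 : (0 : ℤ) ≤ den u * den v := by positivity
  by_cases h : u = []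
  · have hv' : v = [] := by subst h; exact List.length_eq_zero_iff.1 hlen.symm
    subst h hv'
    have : (1 : ℤ) ≤ |(y : ℤ) - x| := h2.trans (le_abs_self _)
    simp
    nlinarith
  · have hv' : v ≠ [] := by
      intro hv'; subst hv'; exact h (List.length_eq_zero_iff.1 hlen)
    have h3 := le_mul_den' hv hv'
    zify at h3
    calc (den u * den v : ℤ) ≤ den u * (K * den' v) := by gcongr
      _ = K * (den u * den' v) := by ring
      _ ≤ K * |((y : ℤ) - x) * (den u * den v) + den u * den' v - den v * den' u| := by
        refine mul_le_mul_of_nonneg_left (le_trans ?_ (le_abs_self _)) (by positivity)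
        have h4 : (den v * den' u : ℤ) ≤ den u * den v := by nlinarith
        nlinarith

theorem den_mul_le_det' {K : ℕ} {u v : List ℕ} {x y : ℕ}
    (hu : ∀ a ∈ u, 1 ≤ a ∧ a + 1 ≤ K) (hv : ∀ a ∈ v, 1 ≤ a ∧ a + 1 ≤ K)
    (hlen : u.length = v.length) (hK : 1 ≤ K) (hxy : x ≠ y) :
    (den u * den v : ℤ) ≤ K * |(den u : ℤ) * den (v ++ [y]) - den v * den (u ++ [x])| := by
  rcases lt_or_gt_of_ne hxy with h | h
  · exact den_mul_le_det hu hv hlen hK h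
  · have := den_mul_le_det hv hu hlen.symm hK h
    rw [abs_sub_comm, mul_comm (den u : ℤ)]
    exact this

theorem den_le_mul_denDist {K : ℕ} {u v c : List ℕ} {x y : ℕ}
    (hu : ∀ a ∈ u, 1 ≤ a ∧ a + 1 ≤ K) (hv : ∀ a ∈ v, 1 ≤ a ∧ a + 1 ≤ K)
    (hc : ∀ a ∈ c, 1 ≤ a ∧ a + 1 ≤ K) (hx : 1 ≤ x ∧ x + 1 ≤ K) (hy : 1 ≤ y ∧ y + 1 ≤ K)
    (hlen : u.length = v.length) (hxy : x ≠ y) :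
    (den (v ++ [y] ++ c) : ℝ) ≤
      8 * K ^ 3 * den c ^ 2 * denDist (u ++ [x] ++ c) (v ++ [y] ++ c) := by
  have hK : 1 ≤ K := by omega
  have h1 := den_mul_le_det' hu hv hlen hK hxy
  have h2 := abs_det_append (u ++ [x]) (v ++ [y]) c
  have hux : ∀ a ∈ u ++ [x], 1 ≤ a := forall_mem_concat.2 ⟨fun a ha => (hu a ha).1, hx.1⟩
  have hvy : ∀ a ∈ v ++ [y], 1 ≤ a := forall_mem_concat.2 ⟨fun a ha => (hv a ha).1, hy.1⟩
  have hc' : ∀ a ∈ c, 1 ≤ a := fun a ha => (hc a ha).1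
  have h3 : den (u ++ [x] ++ c) ≤ 2 * ((K * den u) * den c) :=
    (den_append_le hux hc').trans (by
      gcongr; exact den_concat_le (fun a ha => (hu a ha).1) hx.2)
  have h4 : den (v ++ [y] ++ c) ≤ 2 * ((K * den v) * den c) :=
    (den_append_le hvy hc').trans (by
      gcongr; exact den_concat_le (fun a ha => (hv a ha).1) hy.2)
  have hall : ∀ a ∈ u ++ [x] ++ c, 1 ≤ a := by
    intro a ha
    rcases List.mem_append.1 ha with h | h
    exacts [hux a h, hc' a h]
  have h5 := one_le_den hall
  rw [den'_concat, den'_concat] at h2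
  rw [← h2] at h1
  set q := den (u ++ [x] ++ c)
  set q' := den' (u ++ [x] ++ c)
  set r := den (v ++ [y] ++ c)
  set r' := den' (v ++ [y] ++ c)
  set M := denDist (u ++ [x] ++ c) (v ++ [y] ++ c) with hM
  have h6 : |(q' : ℝ) * r - r' * q| ≤ q * (2 * M) := by
    have e1 : (q' : ℝ) * r - r' * q = q' * (r - q) - q * (r' - q') := by ring
    have e2 : |(r : ℝ) - q| ≤ M := le_max_left _ _
    have e3 : |(r' : ℝ) - q'| ≤ M := le_max_right _ _
    have e4 : (q' : ℝ) ≤ q := by exact_mod_cast h5.2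
    have e5 : (0 : ℝ) ≤ q' := by positivity
    rw [e1]
    calc _ ≤ |(q' : ℝ) * (r - q)| + |(q : ℝ) * (r' - q')| := abs_sub _ _
      _ = q' * |(r : ℝ) - q| + q * |(r' : ℝ) - q'| := by
        rw [abs_mul, abs_mul, abs_of_nonneg e5, abs_of_nonneg (e5.trans e4)]
      _ ≤ q * M + q * M := by gcongr; 
      _ = _ := by ring
  have h7 : (den u * den v : ℝ) ≤ K * |(q' : ℝ) * r - r' * q| := by exact_mod_cast h1
  have h3' : (q : ℝ) ≤ 2 * ((K * den u) * den c) := by exact_mod_cast h3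
  have h4' : (r : ℝ) ≤ 2 * ((K * den v) * den c) := by exact_mod_cast h4
  have hq : (0 : ℝ) < q := by exact_mod_cast h5.1
  have h8 : (q : ℝ) * r ≤ q * (8 * K ^ 3 * den c ^ 2 * M) := by
    calc (q : ℝ) * r ≤ (2 * ((K * den u) * den c)) * (2 * ((K * den v) * den c)) := by gcongr
      _ = 4 * K ^ 2 * den c ^ 2 * (den u * den v) := by ring
      _ ≤ 4 * K ^ 2 * den c ^ 2 * (K * (q * (2 * M))) := by
        refine mul_le_mul_of_nonneg_left (h7.trans ?_) (by positivity)
        exact mul_le_mul_of_nonneg_left h6 (by positivity)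
      _ = _ := by ring
  exact le_of_mul_le_mul_left h8 hq

theorem exists_common_suffix {a b : List ℕ} (hlen : a.length = b.length) (hab : a ≠ b) :
    ∃ u v c x y, a = u ++ [x] ++ c ∧ b = v ++ [y] ++ c ∧ u.length = v.length ∧ x ≠ y := by
  induction a using List.reverseRecOn generalizing b with
  | nil => exact absurd (List.length_eq_zero_iff.1 hlen.symm).symm hab
  | append_singleton a x ih =>
    rcases List.eq_nil_or_concat b with rfl | ⟨b, y, rfl⟩
    · simp at hlen
    · rw [List.concat_eq_append] at *
      have hl : a.length = b.length := by simpa using hlen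
      by_cases hxy : x = y
      · subst hxy
        obtain ⟨u, v, c, x', y', rfl, rfl, h1, h2⟩ := ih hl (fun h => hab (by rw [h]))
        exact ⟨u, v, c ++ [x], x', y', by simp, by simp, h1, h2⟩
      · exact ⟨a, b, [], x, y, by simp, by simp, hl, hxy⟩

/-- The affine function `qₙ + qₙ₋₁ y`. -/
noncomputable def aff (l : List ℕ) (y : ℝ) : ℝ := den l + den' l * y

theorem den_le_aff (l : List ℕ) {y : ℝ} (hy : 0 ≤ y) : (den l : ℝ) ≤ aff l y := by
  rw [aff]; have : (0 : ℝ) ≤ den' l * y := by positivity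
  linarith

theorem aff_pos {l : List ℕ} (hl : ∀ a ∈ l, 1 ≤ a) {y : ℝ} (hy : 0 ≤ y) : 0 < aff l y :=
  lt_of_lt_of_le (by exact_mod_cast den_pos hl) (den_le_aff l hy)

theorem aff_le {l : List ℕ} (hl : ∀ a ∈ l, 1 ≤ a) {y : ℝ} (hy1 : y ≤ 1) :
    aff l y ≤ 2 * den l := by
  have : (den' l : ℝ) ≤ den l := by exact_mod_cast den'_le_den hl
  rw [aff]; nlinarith

theorem hasDerivAt_aff (l : List ℕ) (y : ℝ) : HasDerivAt (aff l) (den' l) y := by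
  have h : HasDerivAt (fun z : ℝ => (den l : ℝ) + den' l * z) (den' l * 1) y :=
    ((hasDerivAt_id' y).const_mul (den' l : ℝ)).const_add (den l : ℝ)
  rw [mul_one] at h
  exact h

@[simp] theorem invBranch_nil (y : ℝ) : invBranch [] y = y := rfl
@[simp] theorem invBranch_cons (a : ℕ) (l : List ℕ) (y : ℝ) :
    invBranch (a :: l) y = (invBranch l y + a)⁻¹ := rfl

theorem invBranch_append (u v : List ℕ) (y : ℝ) :
    invBranch (u ++ v) y = invBranch u (invBranch v y) := by
  simp [invBranch, List.foldr_append]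

theorem hasDerivAt_invBranch {l : List ℕ} (hl : ∀ a ∈ l, 1 ≤ a) {y : ℝ} (hy : 0 ≤ y) :
    HasDerivAt (invBranch l) ((-1) ^ l.length / aff l y ^ 2) y := by
  induction l using List.reverseRecOn generalizing y with
  | nil =>
    have : invBranch [] = id := by ext; simp
    rw [this]
    simpa [aff] using hasDerivAt_id y
  | append_singleton l a ih =>
    rw [forall_mem_concat] at hl
    have ha : (1 : ℝ) ≤ a := by exact_mod_cast hl.2
    have hpos : 0 < y + a := by linarith
    have h1 : HasDerivAt (fun y : ℝ => (y + a)⁻¹) (-1 / (y + a) ^ 2) y := by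
      exact ((hasDerivAt_id' y).add_const (a : ℝ)).fun_inv hpos.ne'
    have h2 := (ih hl.1 (y := (y + a)⁻¹) (by positivity)).comp y h1
    have h3 : invBranch (l ++ [a]) = invBranch l ∘ fun y : ℝ => (y + a)⁻¹ := by
      ext z; rw [invBranch_append]; rfl
    rw [h3]
    refine h2.congr_deriv ?_
    have h4 : aff (l ++ [a]) y = (y + a) * aff l (y + a)⁻¹ := by
      simp only [aff, den_concat, den'_concat]; push_cast; field_simp; ring
    have h5 := aff_pos hl.1 (inv_nonneg.2 hpos.le)
    rw [h4, List.length_append, List.length_singleton]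
    field_simp
    ring

theorem invBranch_mem_Icc {l : List ℕ} (hl : ∀ a ∈ l, 1 ≤ a) {y : ℝ} (hy : y ∈ Icc (0 : ℝ) 1) :
    invBranch l y ∈ Icc (0 : ℝ) 1 := by
  induction l with
  | nil => exact hy
  | cons a l ih =>
    have h := ih fun x hx => hl x (by simp [hx])
    have ha : (1 : ℝ) ≤ a := by exact_mod_cast hl a (by simp)
    rw [invBranch_cons]
    refine ⟨inv_nonneg.2 (by linarith [h.1]), inv_le_one_of_one_le₀ (by linarith [h.1])⟩

end

section

/-- The additive character `e(x) = exp(2πix)`. -/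
noncomputable def e (x : ℝ) : ℂ := Complex.exp ((2 * π * x : ℝ) * Complex.I)

@[simp] theorem norm_e (x : ℝ) : ‖e x‖ = 1 := Complex.norm_exp_ofReal_mul_I _

theorem e_add (x y : ℝ) : e (x + y) = e x * e y := by
  rw [e, e, e, ← Complex.exp_add]; congr 1; push_cast; ring

theorem conj_e (x : ℝ) : (starRingEnd ℂ) (e x) = e (-x) := by
  rw [e, e, ← Complex.exp_conj]; congr 1
  simp only [map_mul, Complex.conj_ofReal, Complex.conj_I]; push_cast; ring

theorem continuous_e : Continuous e := by unfold e; fun_prop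

theorem hasDerivAt_e (x : ℝ) : HasDerivAt e (2 * π * Complex.I * e x) x := by
  have h1 : HasDerivAt (fun x : ℝ => ((x : ℝ) : ℂ)) 1 x := Complex.ofRealCLM.hasDerivAt
  have h2 := ((h1.const_mul (2 * π : ℂ)).mul_const Complex.I).cexp
  have h3 : e = fun x : ℝ => Complex.exp (2 * π * (x : ℂ) * Complex.I) := by
    ext x; rw [e]; push_cast; rfl
  rw [h3]
  refine h2.congr_deriv ?_
  ring

theorem norm_integral_e_le {Φ Φ' G G' : ℝ → ℝ} {p c α β η B : ℝ} (hαβ : α ≤ β) (h1 : β - α ≤ 1)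
    (hΦ : ∀ x ∈ Icc α β, HasDerivAt Φ (Φ' x) x) (hG : ∀ x ∈ Icc α β, HasDerivAt G (G' x) x)
    (hGc : ContinuousOn G' (Icc α β)) (hL : ∀ x ∈ Icc α β, Φ' x * G x = p + c * x) (hη : 0 < η)
    (hLη : ∀ x ∈ Icc α β, η ≤ |p + c * x|) (hGB : ∀ x ∈ Icc α β, |G x| ≤ B)
    (hGB' : ∀ x ∈ Icc α β, |G' x| ≤ 5 * B) :
    ‖∫ x in α..β, e (Φ x)‖ ≤ 9 * B / η := by
  have hB : 0 ≤ B := (abs_nonneg _).trans (hGB α (left_mem_Icc.2 hαβ))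
  have hL0 : ∀ x ∈ Icc α β, p + c * x ≠ 0 := fun x hx h => by
    have := hLη x hx; rw [h, abs_zero] at this; linarith
  have hLd : ∀ x : ℝ, HasDerivAt (fun x : ℝ => p + c * x) c x := fun x => by
    simpa using ((hasDerivAt_id' x).const_mul c).const_add p
  set H : ℝ → ℝ := fun x => G x / (p + c * x) with hH
  set H' : ℝ → ℝ := fun x => (G' x * (p + c * x) - G x * c) / (p + c * x) ^ 2 with hH'
  have hHd : ∀ x ∈ Icc α β, HasDerivAt H (H' x) x := fun x hx => (hG x hx).div (hLd x) (hL0 x hx)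
  have hHb : ∀ x ∈ Icc α β, |H x| ≤ B / η := fun x hx => by
    rw [hH]; simp only [abs_div]
    exact div_le_div₀ hB (hGB x hx) hη (hLη x hx)
  have hEd : ∀ x ∈ Icc α β, HasDerivAt (fun x => e (Φ x)) (2 * π * Complex.I * e (Φ x) * Φ' x) x :=
    fun x hx => by
      have := (hasDerivAt_e (Φ x)).scomp x (hΦ x hx)
      refine this.congr_deriv ?_
      rw [Complex.real_smul]; ring
  have hUd : ∀ x ∈ Icc α β, HasDerivAt (fun x => e (Φ x) * (H x : ℂ))
      (2 * π * Complex.I * e (Φ x) + e (Φ x) * (H' x : ℂ)) x := fun x hx => by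
    refine ((hEd x hx).mul (hHd x hx).ofReal_comp).congr_deriv ?_
    have h3 : Φ' x * H x = 1 := by
      rw [hH]; simp only; rw [← mul_div_assoc, hL x hx, div_self (hL0 x hx)]
    have h4 : (Φ' x : ℂ) * (H x : ℂ) = 1 := by exact_mod_cast h3
    linear_combination (2 * π * Complex.I * e (Φ x)) * h4
  have hEc : ContinuousOn (fun x => e (Φ x)) (Icc α β) := fun x hx =>
    (hEd x hx).continuousAt.continuousWithinAt
  have hLc : ContinuousOn (fun x : ℝ => p + c * x) (Icc α β) := by fun_prop
  have hGcont : ContinuousOn G (Icc α β) := fun x hx => (hG x hx).continuousAt.continuousWithinAt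
  have hHc : ContinuousOn H' (Icc α β) :=
    ((hGc.mul hLc).sub (hGcont.mul continuousOn_const)).div (hLc.pow 2)
      fun x hx => pow_ne_zero 2 (hL0 x hx)
  have hEHc : ContinuousOn (fun x => e (Φ x) * (H' x : ℂ)) (Icc α β) :=
    hEc.mul (Complex.continuous_ofReal.comp_continuousOn hHc)
  have hi1 : IntervalIntegrable (fun x => 2 * π * Complex.I * e (Φ x)) volume α β :=
    (continuousOn_const.mul hEc).intervalIntegrable_of_Icc hαβ
  have hi2 : IntervalIntegrable (fun x => e (Φ x) * (H' x : ℂ)) volume α β :=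
    hEHc.intervalIntegrable_of_Icc hαβ
  have key := intervalIntegral.integral_eq_sub_of_hasDerivAt
    (fun x hx => hUd x (by rwa [uIcc_of_le hαβ] at hx)) (hi1.add hi2)
  rw [intervalIntegral.integral_add hi1 hi2, intervalIntegral.integral_const_mul] at key
  -- the variation of `1 / L`
  have hRd : ∀ x ∈ Icc α β, HasDerivAt (fun x => -(p + c * x)⁻¹) (c / (p + c * x) ^ 2) x :=
    fun x hx => by
      refine ((hLd x).fun_inv (hL0 x hx)).neg.congr_deriv ?_
      ring
  have hRc : ContinuousOn (fun x : ℝ => c / (p + c * x) ^ 2) (Icc α β) :=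
    continuousOn_const.div (hLc.pow 2) fun x hx => pow_ne_zero 2 (hL0 x hx)
  have hRi : IntervalIntegrable (fun x : ℝ => c / (p + c * x) ^ 2) volume α β :=
    hRc.intervalIntegrable_of_Icc hαβ
  have hR := intervalIntegral.integral_eq_sub_of_hasDerivAt
    (fun x hx => hRd x (by rwa [uIcc_of_le hαβ] at hx)) hRi
  have hinv : ∀ x ∈ Icc α β, |(p + c * x)⁻¹| ≤ 1 / η := fun x hx => by
    rw [abs_inv, ← one_div]; exact one_div_le_one_div_of_le hη (hLη x hx)
  have hα := left_mem_Icc.2 hαβ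
  have hβ := right_mem_Icc.2 hαβ
  have hR2 : ∫ x in α..β, |c| / (p + c * x) ^ 2 ≤ 2 / η := by
    have : ∫ x in α..β, |c| / (p + c * x) ^ 2 = |∫ x in α..β, c / (p + c * x) ^ 2| := by
      rcases le_total 0 c with hc | hc
      · rw [abs_of_nonneg hc, abs_of_nonneg]
        exact intervalIntegral.integral_nonneg hαβ fun x _ => by positivity
      · rw [abs_of_nonpos hc, abs_of_nonpos]
        · rw [← intervalIntegral.integral_neg]; congr 1; ext x; ring
        · rw [← neg_nonneg, ← intervalIntegral.integral_neg]
          refine intervalIntegral.integral_nonneg hαβ fun x _ => ?_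
          rw [← neg_div]; exact div_nonneg (by linarith) (sq_nonneg _)
    rw [this, hR]
    have := abs_sub (-(p + c * β)⁻¹) (-(p + c * α)⁻¹)
    rw [abs_neg, abs_neg] at this
    have e1 := hinv α hα
    have e2 := hinv β hβ
    calc _ ≤ _ := this
      _ ≤ 1 / η + 1 / η := add_le_add e2 e1
      _ = _ := by ring
  have hbd : ‖∫ x in α..β, e (Φ x) * (H' x : ℂ)‖ ≤
      ∫ x in α..β, (5 * B / η + B * (|c| / (p + c * x) ^ 2)) := by
    have hRi' : IntervalIntegrable (fun x : ℝ => |c| / (p + c * x) ^ 2) volume α β :=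
      (continuousOn_const.div (hLc.pow 2)
        fun x hx => pow_ne_zero 2 (hL0 x hx)).intervalIntegrable_of_Icc hαβ
    refine intervalIntegral.norm_integral_le_of_norm_le hαβ (Eventually.of_forall fun x hx => ?_)
      (intervalIntegrable_const.add (hRi'.const_mul B))
    have hx' : x ∈ Icc α β := Ioc_subset_Icc_self hx
    rw [norm_mul, norm_e, one_mul, Complex.norm_real, Real.norm_eq_abs]
    have hl := hL0 x hx'
    have : H' x = G' x / (p + c * x) - G x * (c / (p + c * x) ^ 2) := by
      rw [hH']; field_simp
    rw [this]
    refine (abs_sub _ _).trans (add_le_add ?_ ?_)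
    · rw [abs_div]
      exact div_le_div₀ (by positivity) (hGB' x hx') hη (hLη x hx')
    · rw [abs_mul, abs_div, abs_of_nonneg (sq_nonneg (p + c * x))]
      exact mul_le_mul_of_nonneg_right (hGB x hx') (by positivity)
  have hbd2 : ∫ x in α..β, (5 * B / η + B * (|c| / (p + c * x) ^ 2)) ≤ 7 * B / η := by
    have hRi' : IntervalIntegrable (fun x : ℝ => |c| / (p + c * x) ^ 2) volume α β :=
      (continuousOn_const.div (hLc.pow 2)
        fun x hx => pow_ne_zero 2 (hL0 x hx)).intervalIntegrable_of_Icc hαβ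
    rw [intervalIntegral.integral_add intervalIntegrable_const (hRi'.const_mul B),
      intervalIntegral.integral_const, intervalIntegral.integral_const_mul, smul_eq_mul]
    have e1 : (β - α) * (5 * B / η) ≤ 1 * (5 * B / η) :=
      mul_le_mul_of_nonneg_right h1 (by positivity)
    have e2 := mul_le_mul_of_nonneg_left hR2 hB
    calc _ ≤ 1 * (5 * B / η) + B * (2 / η) := add_le_add e1 e2
      _ = _ := by ring
  have hfin : ‖2 * π * Complex.I * ∫ x in α..β, e (Φ x)‖ ≤ 9 * B / η := by
    rw [eq_sub_of_add_eq key]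
    refine (norm_sub_le _ _).trans ((add_le_add (norm_sub_le _ _) (hbd.trans hbd2)).trans ?_)
    rw [norm_mul, norm_mul, norm_e, norm_e, Complex.norm_real, Complex.norm_real,
      Real.norm_eq_abs, Real.norm_eq_abs, one_mul, one_mul]
    calc _ ≤ B / η + B / η + 7 * B / η :=
          add_le_add (add_le_add (hHb β hβ) (hHb α hα)) le_rfl
      _ = _ := by ring
  refine le_trans ?_ hfin
  rw [norm_mul, norm_mul, norm_mul, Complex.norm_I, Complex.norm_real, Complex.norm_ofNat,
    Real.norm_eq_abs, abs_of_pos Real.pi_pos]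
  nlinarith [Real.pi_gt_three, norm_nonneg (∫ x in α..β, e (Φ x))]

end

section

theorem continuous_aff (l : List ℕ) : Continuous (aff l) := by unfold aff; fun_prop

theorem norm_integral_e_branch_le_of_le {K : ℕ} {a b : List ℕ} (ha : ∀ x ∈ a, 1 ≤ x)
    (hb : ∀ x ∈ b, 1 ≤ x) (hlen : a.length = b.length) {Q ξ α β η : ℝ} (hQ : 1 ≤ Q)
    (ha1 : Q ≤ den a) (ha2 : den a ≤ K * Q) (hb1 : Q ≤ den b) (hb2 : den b ≤ K * Q)
    (hξ : Q ^ 3 ≤ ξ) (hα : 0 ≤ α) (hαβ : α ≤ β) (hβ : β ≤ 1) (hη : 0 < η)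
    (hLη : ∀ x ∈ Icc α β, η ≤ |((den b : ℝ) - den a) + ((den' b : ℝ) - den' a) * x|) :
    ‖∫ x in α..β, e (ξ * (invBranch a x - invBranch b x))‖ ≤ 72 * K ^ 4 / η := by
  have hQ0 : 0 < Q := by linarith
  have hξ0 : 0 < ξ := lt_of_lt_of_le (by positivity) hξ
  set s : ℝ := (-1) ^ a.length with hs
  have hs2 : s * s = 1 := by rw [hs, ← pow_add, ← two_mul, pow_mul]; simp
  have hsabs : |s| = 1 := by rw [hs, abs_pow]; simp
  have h0 : ∀ x ∈ Icc α β, 0 ≤ x := fun x hx => hα.trans hx.1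
  have h1 : ∀ x ∈ Icc α β, x ≤ 1 := fun x hx => hx.2.trans hβ
  set G : ℝ → ℝ := fun x => s / ξ * ((aff a x ^ 2 * aff b x ^ 2) / (aff a x + aff b x)) with hG
  set G' : ℝ → ℝ := fun x => G x * (2 * (den' a / aff a x) + 2 * (den' b / aff b x) -
    (den' a + den' b) / (aff a x + aff b x)) with hG'
  have hGd : ∀ x ∈ Icc α β, HasDerivAt G (G' x) x := fun x hx => by
    have pa := aff_pos ha (h0 x hx)
    have pb := aff_pos hb (h0 x hx)
    have hn := ((hasDerivAt_aff a x).fun_pow 2).mul ((hasDerivAt_aff b x).fun_pow 2)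
    have hd := (hasDerivAt_aff a x).add (hasDerivAt_aff b x)
    refine ((hn.div hd (by simpa using (add_pos pa pb).ne')).const_mul (s / ξ)).congr_deriv ?_
    simp only [hG', hG, Pi.add_apply, Pi.mul_apply]
    field_simp
    push_cast
    ring
  have hGB : ∀ x ∈ Icc α β, |G x| ≤ 8 * (K : ℝ) ^ 4 := fun x hx => by
    have pa := aff_pos ha (h0 x hx)
    have pb := aff_pos hb (h0 x hx)
    have la := (aff_le ha (h1 x hx)).trans (mul_le_mul_of_nonneg_left ha2 zero_le_two)
    have lb := (aff_le hb (h1 x hx)).trans (mul_le_mul_of_nonneg_left hb2 zero_le_two)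
    have ga := ha1.trans (den_le_aff a (h0 x hx))
    have gb := hb1.trans (den_le_aff b (h0 x hx))
    simp only [hG]
    rw [abs_mul, abs_div, hsabs, abs_of_pos hξ0, abs_of_pos (by positivity),
      div_mul_div_comm, one_mul, div_le_iff₀ (by positivity)]
    calc aff a x ^ 2 * aff b x ^ 2 ≤ (2 * (K * Q)) ^ 2 * (2 * (K * Q)) ^ 2 := by gcongr
      _ = 8 * K ^ 4 * (Q ^ 3 * (Q + Q)) := by ring
      _ ≤ 8 * K ^ 4 * (ξ * (aff a x + aff b x)) := by gcongr
  have hGB' : ∀ x ∈ Icc α β, |G' x| ≤ 5 * (8 * (K : ℝ) ^ 4) := fun x hx => by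
    have pa := aff_pos ha (h0 x hx)
    have pb := aff_pos hb (h0 x hx)
    have da : (den' a : ℝ) ≤ aff a x :=
      (by exact_mod_cast den'_le_den ha : (den' a : ℝ) ≤ den a).trans (den_le_aff a (h0 x hx))
    have db : (den' b : ℝ) ≤ aff b x :=
      (by exact_mod_cast den'_le_den hb : (den' b : ℝ) ≤ den b).trans (den_le_aff b (h0 x hx))
    have q1 : (den' a : ℝ) / aff a x ≤ 1 := (div_le_one pa).2 da
    have q2 : (den' b : ℝ) / aff b x ≤ 1 := (div_le_one pb).2 db
    have q3 : ((den' a : ℝ) + den' b) / (aff a x + aff b x) ≤ 1 :=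
      (div_le_one (add_pos pa pb)).2 (add_le_add da db)
    have r1 : 0 ≤ (den' a : ℝ) / aff a x := by positivity
    have r2 : 0 ≤ (den' b : ℝ) / aff b x := by positivity
    have r3 : 0 ≤ ((den' a : ℝ) + den' b) / (aff a x + aff b x) := by positivity
    simp only [hG']
    rw [abs_mul, mul_comm]
    exact mul_le_mul (abs_le.2 ⟨by linarith, by linarith⟩) (hGB x hx) (abs_nonneg _) (by norm_num)
  have hGc : ContinuousOn G' (Icc α β) := by
    have c1 : ContinuousOn G (Icc α β) := fun x hx => (hGd x hx).continuousAt.continuousWithinAt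
    refine c1.mul (((continuousOn_const.mul (continuousOn_const.div
      (continuous_aff a).continuousOn ?_)).add (continuousOn_const.mul (continuousOn_const.div
      (continuous_aff b).continuousOn ?_))).sub (continuousOn_const.div
      ((continuous_aff a).add (continuous_aff b)).continuousOn ?_))
    · exact fun x hx => (aff_pos ha (h0 x hx)).ne'
    · exact fun x hx => (aff_pos hb (h0 x hx)).ne'
    · exact fun x hx => (add_pos (aff_pos ha (h0 x hx)) (aff_pos hb (h0 x hx))).ne'
  have hΦ : ∀ x ∈ Icc α β, HasDerivAt (fun x => ξ * (invBranch a x - invBranch b x))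
      (ξ * (s / aff a x ^ 2 - s / aff b x ^ 2)) x := fun x hx => by
    have d1 := hasDerivAt_invBranch ha (h0 x hx)
    have d2 := hasDerivAt_invBranch hb (h0 x hx)
    rw [← hlen] at d2
    exact (d1.sub d2).const_mul ξ
  refine (norm_integral_e_le hαβ (by linarith) hΦ hGd hGc (fun x hx => ?_) hη hLη hGB hGB').trans
    (le_of_eq (by ring))
  have pa := aff_pos ha (h0 x hx)
  have pb := aff_pos hb (h0 x hx)
  have : ξ * (s / aff a x ^ 2 - s / aff b x ^ 2) * G x = s * s * (aff b x - aff a x) := by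
    simp only [hG]; field_simp; ring
  rw [this, hs2, aff, aff]
  ring

theorem norm_integral_e_branch_le {K : ℕ} {a b : List ℕ} (ha : ∀ x ∈ a, 1 ≤ x)
    (hb : ∀ x ∈ b, 1 ≤ x) (hlen : a.length = b.length) {Q ξ M : ℝ} (hQ : 1 ≤ Q)
    (ha1 : Q ≤ den a) (ha2 : den a ≤ K * Q) (hb1 : Q ≤ den b) (hb2 : den b ≤ K * Q)
    (hξ : Q ^ 3 ≤ ξ) (hM : 1 ≤ M) (hMeq : M = denDist a b) :
    ‖∫ x in (0 : ℝ)..1, e (ξ * (invBranch a x - invBranch b x))‖ ≤ (576 * K ^ 4 + 2) / √M := by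
  have hM0 : 0 < M := by linarith
  have hsq : 0 < √M := Real.sqrt_pos.2 hM0
  have hsq1 : √M * √M = M := Real.mul_self_sqrt hM0.le
  have hsq2 : √M ≤ M := by
    have : 1 ≤ √M := Real.one_le_sqrt.2 hM
    nlinarith
  have hbase := fun {α β η : ℝ} => @norm_integral_e_branch_le_of_le K a b ha hb hlen Q ξ α β η hQ
    ha1 ha2 hb1 hb2 hξ
  set p : ℝ := (den b : ℝ) - den a with hp
  set c : ℝ := (den' b : ℝ) - den' a with hc
  have hMpc : M = max |p| |c| := hMeq
  have hK : (0 : ℝ) ≤ 72 * K ^ 4 := by positivity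
  by_cases hcM : |c| < M / 4
  · have hpM : |p| = M := by
      rcases max_choice |p| |c| with h | h
      · rw [hMpc, h]
      · rw [h] at hMpc; linarith
    refine (hbase le_rfl zero_le_one le_rfl (η := M / 2) (by linarith) ?_).trans ?_
    · intro x hx
      have e1 : |c * x| ≤ M / 4 := by
        rw [abs_mul, abs_of_nonneg hx.1]
        nlinarith [hx.1, hx.2, abs_nonneg c]
      have e2 := abs_sub_abs_le_abs_sub p (-(c * x))
      rw [abs_neg, sub_neg_eq_add] at e2
      linarith
    · rw [div_le_div_iff₀ (by linarith) hsq]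
      nlinarith
  · push Not at hcM
    have hc0 : c ≠ 0 := fun h => by rw [h, abs_zero] at hcM; linarith
    set z : ℝ := -p / c with hz
    set τ : ℝ := 1 / √M with hτ
    have hτ0 : 0 < τ := by positivity
    set α : ℝ := max 0 (min 1 (z - τ)) with hα
    set β : ℝ := max 0 (min 1 (z + τ)) with hβ
    have hα0 : 0 ≤ α := le_max_left _ _
    have hβ1 : β ≤ 1 := max_le zero_le_one (min_le_left _ _)
    have hαβ : α ≤ β := max_le_max_left _ (min_le_min_left _ (by linarith))
    have hβα : β - α ≤ 2 * τ := by
      rw [hα, hβ]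
      rcases le_total (z - τ) 1 with h1 | h1 <;> rcases le_total (z + τ) 1 with h2 | h2 <;>
      rcases le_total (z - τ) 0 with h3 | h3 <;> rcases le_total (z + τ) 0 with h4 | h4 <;>
      simp [h1, h2, h3, h4] <;> linarith
    have hL : ∀ x : ℝ, τ ≤ |x - z| → √M / 4 ≤ |p + c * x| := fun x hx => by
      have : p + c * x = c * (x - z) := by rw [hz]; field_simp; ring
      rw [this, abs_mul]
      calc √M / 4 = √M * √M / 4 * τ := by rw [hτ]; field_simp
        _ = M / 4 * τ := by rw [hsq1]
        _ ≤ |c| * |x - z| := by gcongr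
    have i1 : ‖∫ x in (0 : ℝ)..α, e (ξ * (invBranch a x - invBranch b x))‖ ≤
        72 * K ^ 4 / (√M / 4) := by
      by_cases h : z - τ ≤ 0
      · have : α = 0 := max_eq_left ((min_le_right _ _).trans h)
        rw [this, intervalIntegral.integral_same, norm_zero]; positivity
      · push Not at h
        refine hbase le_rfl hα0 (hαβ.trans hβ1) (by positivity) fun x hx => hL x ?_
        have : α ≤ z - τ := max_le h.le (min_le_right _ _)
        rw [abs_sub_comm]
        exact le_trans (by linarith [hx.2]) (le_abs_self _)
    have i3 : ‖∫ x in β..(1 : ℝ), e (ξ * (invBranch a x - invBranch b x))‖ ≤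
        72 * K ^ 4 / (√M / 4) := by
      by_cases h : 1 ≤ z + τ
      · have : β = 1 := by rw [hβ, min_eq_left h]; simp
        rw [this, intervalIntegral.integral_same, norm_zero]; positivity
      · push Not at h
        refine hbase (hα0.trans hαβ) hβ1 le_rfl (by positivity) fun x hx => hL x ?_
        have : z + τ ≤ β := by rw [hβ, min_eq_right h.le]; exact le_max_right _ _
        exact le_trans (by linarith [hx.1]) (le_abs_self _)
    have i2 : ‖∫ x in α..β, e (ξ * (invBranch a x - invBranch b x))‖ ≤ 2 * τ := by
      have := intervalIntegral.norm_integral_le_of_norm_le_const (a := α) (b := β) (C := 1)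
        (f := fun x => e (ξ * (invBranch a x - invBranch b x))) fun x _ => (norm_e _).le
      rw [one_mul, abs_of_nonneg (by linarith)] at this
      exact this.trans hβα
    have hcont : ContinuousOn (fun x => e (ξ * (invBranch a x - invBranch b x))) (Icc 0 1) :=
      continuous_e.comp_continuousOn (continuousOn_const.mul (ContinuousOn.sub
        (fun x hx => (hasDerivAt_invBranch ha hx.1).continuousAt.continuousWithinAt)
        (fun x hx => (hasDerivAt_invBranch hb hx.1).continuousAt.continuousWithinAt)))
    have hii : ∀ u v : ℝ, 0 ≤ u → u ≤ v → v ≤ 1 → IntervalIntegrable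
        (fun x => e (ξ * (invBranch a x - invBranch b x))) volume u v := fun u v hu huv hv =>
      (hcont.mono (Icc_subset_Icc hu hv)).intervalIntegrable_of_Icc huv
    rw [← intervalIntegral.integral_add_adjacent_intervals
      (hii 0 β le_rfl (hα0.trans hαβ) hβ1) (hii β 1 (hα0.trans hαβ) hβ1 le_rfl),
      ← intervalIntegral.integral_add_adjacent_intervals
      (hii 0 α le_rfl hα0 (hαβ.trans hβ1)) (hii α β hα0 hαβ hβ1)]
    refine (norm_add_le _ _).trans ((add_le_add ((norm_add_le _ _).trans (add_le_add i1 i2))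
      i3).trans (le_of_eq ?_))
    rw [hτ]
    field_simp
    ring

theorem norm_integral_e_suffix_le {K : ℕ} {u v c : List ℕ} {x y : ℕ}
    (hu : ∀ a ∈ u, 1 ≤ a ∧ a + 1 ≤ K) (hv : ∀ a ∈ v, 1 ≤ a ∧ a + 1 ≤ K)
    (hc : ∀ a ∈ c, 1 ≤ a ∧ a + 1 ≤ K) (hx : 1 ≤ x ∧ x + 1 ≤ K) (hy : 1 ≤ y ∧ y + 1 ≤ K)
    (hlen : u.length = v.length) (hxy : x ≠ y) {Q ξ : ℝ} (hQ : 1 ≤ Q)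
    (ha1 : Q ≤ den (u ++ [x] ++ c)) (ha2 : den (u ++ [x] ++ c) ≤ K * Q)
    (hb1 : Q ≤ den (v ++ [y] ++ c)) (hb2 : den (v ++ [y] ++ c) ≤ K * Q) (hξ : Q ^ 3 ≤ ξ) :
    ‖∫ z in (0 : ℝ)..1, e (ξ * (invBranch (u ++ [x] ++ c) z - invBranch (v ++ [y] ++ c) z))‖ ≤
      (576 * K ^ 4 + 2) * (3 * K ^ 2) * (den c / √Q) := by
  have hK : 1 ≤ K := by omega
  have hK' : (1 : ℝ) ≤ K := by exact_mod_cast hK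
  have hd := den_le_mul_denDist hu hv hc hx hy hlen hxy
  set M := denDist (u ++ [x] ++ c) (v ++ [y] ++ c) with hM
  have hall : ∀ {u : List ℕ} {x : ℕ}, (∀ a ∈ u, 1 ≤ a ∧ a + 1 ≤ K) → 1 ≤ x →
      ∀ a ∈ u ++ [x] ++ c, 1 ≤ a := by
    intro u x hu hx a ha
    rcases List.mem_append.1 ha with h | h
    · rcases List.mem_append.1 h with h | h
      exacts [(hu a h).1, by rw [List.mem_singleton.1 h]; exact hx]
    · exact (hc a h).1
  have hc0 : (1 : ℝ) ≤ den c := by exact_mod_cast den_pos fun a ha => (hc a ha).1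
  have hMpos : 0 < M := by
    by_contra h
    push Not at h
    have : 8 * (K : ℝ) ^ 3 * den c ^ 2 * M ≤ 0 := mul_nonpos_of_nonneg_of_nonpos (by positivity) h
    linarith
  have hM1 : 1 ≤ M := by
    obtain ⟨m, hm⟩ : ∃ m : ℤ, M = m :=
      ⟨max |(den (v ++ [y] ++ c) : ℤ) - den (u ++ [x] ++ c)|
        |(den' (v ++ [y] ++ c) : ℤ) - den' (u ++ [x] ++ c)|, by rw [hM, denDist]; push_cast; rfl⟩
    rw [hm] at hMpos ⊢
    have : 0 < m := by exact_mod_cast hMpos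
    exact_mod_cast this
  have hlen' : (u ++ [x] ++ c).length = (v ++ [y] ++ c).length := by simp [hlen]
  refine (norm_integral_e_branch_le (hall hu hx.1) (hall hv hy.1) hlen' hQ ha1 ha2 hb1 hb2 hξ hM1
    hM).trans ?_
  have hQ0 : 0 < Q := by linarith
  rw [div_eq_mul_inv, mul_assoc]
  refine mul_le_mul_of_nonneg_left ?_ (by positivity)
  have h9 : Q ≤ (3 * K ^ 2 * den c) ^ 2 * M := by
    refine (hb1.trans hd).trans ?_
    have : (K : ℝ) ^ 3 ≤ K ^ 4 := pow_le_pow_right₀ hK' (by norm_num)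
    have h8 : 8 * (K : ℝ) ^ 3 * den c ^ 2 ≤ (3 * K ^ 2 * den c) ^ 2 := by
      have h7 : 8 * (K : ℝ) ^ 3 ≤ 9 * K ^ 4 := by nlinarith [pow_pos (by linarith : (0:ℝ) < K) 3]
      calc _ ≤ 9 * (K : ℝ) ^ 4 * den c ^ 2 := by gcongr
        _ = _ := by ring
    gcongr
  have h10 : √Q ≤ 3 * K ^ 2 * den c * √M := by
    calc √Q ≤ √((3 * K ^ 2 * den c) ^ 2 * M) := Real.sqrt_le_sqrt h9
      _ = _ := by rw [Real.sqrt_mul (sq_nonneg _), Real.sqrt_sq (by positivity)]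
  have hsq : 0 < √M := Real.sqrt_pos.2 hMpos
  have hsQ : 0 < √Q := Real.sqrt_pos.2 hQ0
  rw [inv_le_iff_one_le_mul₀ hsq, ← mul_div_assoc, div_mul_eq_mul_div, le_div_iff₀ hsQ, one_mul]
  exact h10

end

section

/-- The words whose denominator reaches the level `Q` with their last letter. -/
def IsStop (Q : ℝ) (a : List ℕ) : Prop := Q ≤ den a ∧ ∀ i < a.length, (den (a.take i) : ℝ) < Q

theorem IsStop.den_le {K : ℕ} {Q : ℝ} {a : List ℕ} (h : IsStop Q a) (hQ : 1 < Q)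
    (ha : ∀ x ∈ a, 1 ≤ x ∧ x + 1 ≤ K) : (den a : ℝ) ≤ K * Q := by
  rcases List.eq_nil_or_concat a with rfl | ⟨l, x, rfl⟩
  · have := h.1; simp at this; linarith
  · rw [List.concat_eq_append] at *
    have h1 := h.2 l.length (by simp)
    rw [List.take_left] at h1
    rw [forall_mem_concat] at ha
    have h2 : (den (l ++ [x]) : ℝ) ≤ K * den l := by
      exact_mod_cast den_concat_le (fun y hy => (ha.1 y hy).1) ha.2.2
    exact h2.trans (mul_le_mul_of_nonneg_left h1.le (by positivity))

/-- The words of length `n` that stop at level `Q`. -/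
noncomputable def stops (A : Finset ℕ) (Q : ℝ) (n : ℕ) : Finset (List ℕ) :=
  (words A n).filter (IsStop Q)

theorem sum_words_eq_sum_stops {M : Type*} [AddCommMonoid M] {A : Finset ℕ} {Q : ℝ} {N m : ℕ}
    (hN : ∀ a ∈ words A N, Q ≤ den a) (hm : N ≤ m) (f : List ℕ → M) :
    ∑ c ∈ words A m, f c =
      ∑ n ∈ Finset.range (N + 1), ∑ a ∈ stops A Q n, ∑ b ∈ words A (m - n), f (a ++ b) := by
  have h1 : ∀ c ∈ words A m,
      f c = ∑ n ∈ Finset.range (N + 1), if IsStop Q (c.take n) then f c else 0 := by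
    intro c hc
    rw [mem_words] at hc
    have hex : ∃ n, Q ≤ den (c.take n) := ⟨N, hN _ (mem_words.2 ⟨by simp; omega,
      fun a ha => hc.2 a (List.mem_of_mem_take ha)⟩)⟩
    have hle : Nat.find hex ≤ N := Nat.find_min' hex (hN _ (mem_words.2 ⟨by simp; omega,
      fun a ha => hc.2 a (List.mem_of_mem_take ha)⟩))
    have hiff : ∀ n ≤ N, (IsStop Q (c.take n) ↔ n = Nat.find hex) := by
      intro n hn
      rw [eq_comm, Nat.find_eq_iff]
      refine and_congr Iff.rfl ?_
      have hl : (c.take n).length = n := by simp; omega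
      rw [hl]
      refine forall₂_congr fun i hi => ?_
      rw [List.take_take, min_eq_left hi.le, not_le]
    rw [Finset.sum_eq_single (Nat.find hex)]
    · rw [if_pos ((hiff _ hle).2 rfl)]
    · intro n hn hne
      rw [if_neg fun h => hne ((hiff n (by simpa [Nat.lt_succ_iff] using hn)).1 h)]
    · exact fun h => absurd (Finset.mem_range.2 (by omega)) h
  rw [Finset.sum_congr rfl h1, Finset.sum_comm]
  refine Finset.sum_congr rfl fun n hn => ?_
  have hnm : m = n + (m - n) := by simp at hn; omega
  conv_lhs => rw [hnm]
  rw [sum_words_add, stops, Finset.sum_filter]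
  refine Finset.sum_congr rfl fun a ha => ?_
  have hlen := (mem_words.1 ha).1
  split_ifs with h
  · refine Finset.sum_congr rfl fun b _ => ?_
    rw [← hlen, List.take_left, if_pos h]
  · refine Finset.sum_eq_zero fun b _ => ?_
    rw [← hlen, List.take_left, if_neg h]

theorem drop_mem_words {A : Finset ℕ} {n : ℕ} {a : List ℕ} (ha : a ∈ words A n) (j : ℕ) :
    a.drop j ∈ words A (n - j) := by
  rw [mem_words] at *
  exact ⟨by simp [ha.1], fun x hx => ha.2 x (List.mem_of_mem_drop hx)⟩

theorem QuasiBernoulli.sum_drop {A : Finset ℕ} {P : List ℕ → ℝ} {C : ℝ}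
    (hP : QuasiBernoulli A P C) {n j : ℕ} (hj : j ≤ n) (f : List ℕ → ℝ) :
    ∑ b ∈ words A n, P b * f (b.drop j) = ∑ c ∈ words A (n - j), P c * f c := by
  have hn : n = j + (n - j) := by omega
  conv_lhs => rw [hn]
  rw [sum_words_add, ← hP.sum_snd j (n - j) f]
  refine Finset.sum_congr rfl fun a ha => Finset.sum_congr rfl fun b _ => ?_
  rw [← (mem_words.1 ha).1, List.drop_left]

/-- The constant in the bound for the oscillatory integrals of pairs of branches. -/
noncomputable def oscConst (K : ℕ) : ℝ := (576 * K ^ 4 + 2) * (3 * K ^ 2)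

theorem norm_integral_e_pair_le {A : Finset ℕ} {K : ℕ} (hA : ∀ a ∈ A, 1 ≤ a ∧ a + 1 ≤ K)
    (hK : 1 ≤ K) {n : ℕ} {a b : List ℕ} (ha : a ∈ words A n) (hb : b ∈ words A n) {Q ξ : ℝ}
    (hQ : 1 ≤ Q)
    (ha1 : Q ≤ den a) (ha2 : den a ≤ K * Q) (hb1 : Q ≤ den b) (hb2 : den b ≤ K * Q)
    (hξ : Q ^ 3 ≤ ξ) :
    ‖∫ z in (0 : ℝ)..1, e (ξ * (invBranch a z - invBranch b z))‖ ≤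
      oscConst K / √Q * ∑ j ∈ Finset.range (n + 1),
        if a.drop j = b.drop j then (den (a.drop j) : ℝ) else 0 := by
  have hK' : (1 : ℝ) ≤ K := by exact_mod_cast hK
  have hnn : ∀ j ∈ Finset.range (n + 1),
      0 ≤ if a.drop j = b.drop j then (den (a.drop j) : ℝ) else 0 := fun j _ => by
    split_ifs <;> positivity
  have hsQ : 0 < √Q := Real.sqrt_pos.2 (by linarith)
  have hc0 : 1 ≤ oscConst K := by
    have h1 : (1 : ℝ) ≤ K ^ 2 := one_le_pow₀ hK'
    have h2 : (1 : ℝ) ≤ K ^ 4 := one_le_pow₀ hK'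
    rw [oscConst]; nlinarith
  by_cases hab : a = b
  · subst hab
    have h1 : Q ≤ ∑ j ∈ Finset.range (n + 1),
        if a.drop j = a.drop j then (den (a.drop j) : ℝ) else 0 := by
      refine le_trans ?_ (Finset.single_le_sum hnn (Finset.mem_range.2 (Nat.succ_pos n)))
      simp [ha1]
    have h2 : ‖∫ z in (0 : ℝ)..1, e (ξ * (invBranch a z - invBranch a z))‖ ≤ 1 := by simp
    refine h2.trans (le_trans ?_ (mul_le_mul_of_nonneg_left h1 (by positivity)))
    rw [div_mul_eq_mul_div, le_div_iff₀ hsQ, one_mul]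
    have h3 : √Q ≤ Q := by
      have : 1 ≤ √Q := Real.one_le_sqrt.2 hQ
      nlinarith [Real.mul_self_sqrt (by linarith : (0:ℝ) ≤ Q)]
    nlinarith
  · have hla := (mem_words.1 ha).1
    have hlb := (mem_words.1 hb).1
    obtain ⟨u, v, c, x, y, rfl, rfl, hlen, hxy⟩ :=
      exists_common_suffix (hla.trans hlb.symm) hab
    have haA := fun z hz => hA z ((mem_words.1 ha).2 z hz)
    have hbA := fun z hz => hA z ((mem_words.1 hb).2 z hz)
    refine (norm_integral_e_suffix_le (fun z hz => haA z (by simp [hz]))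
      (fun z hz => hbA z (by simp [hz])) (fun z hz => haA z (by simp [hz])) (haA x (by simp))
      (hbA y (by simp)) hlen hxy hQ ha1 ha2 hb1 hb2 hξ).trans ?_
    rw [div_mul_eq_mul_div, ← mul_div_assoc, ← oscConst]
    have hj : u.length + 1 ∈ Finset.range (n + 1) := by
      rw [← hla]; simp
    have hd1 : (u ++ [x] ++ c).drop (u.length + 1) = c := by
      rw [List.drop_left']; simp
    have hd2 : (v ++ [y] ++ c).drop (u.length + 1) = c := by
      rw [List.drop_left']; simp [hlen]
    have := Finset.single_le_sum hnn hj
    rw [hd1, hd2, if_pos rfl] at this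
    gcongr

theorem continuousOn_invBranch {l : List ℕ} (hl : ∀ a ∈ l, 1 ≤ a) :
    ContinuousOn (invBranch l) (Icc 0 1) := fun _ hx =>
  (hasDerivAt_invBranch hl hx.1).continuousAt.continuousWithinAt

theorem continuousOn_e_invBranch {l : List ℕ} (hl : ∀ a ∈ l, 1 ≤ a) (ξ : ℝ) :
    ContinuousOn (fun y => e (ξ * invBranch l y)) (Icc 0 1) :=
  continuous_e.comp_continuousOn (continuousOn_const.mul (continuousOn_invBranch hl))

/-- The trigonometric sum over the branches in `S`. -/
noncomputable def trigSum (S : Finset (List ℕ)) (β : List ℕ → ℝ) (ξ y : ℝ) : ℂ :=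
  ∑ a ∈ S, β a * e (ξ * invBranch a y)

theorem continuousOn_trigSum {S : Finset (List ℕ)} (hS : ∀ l ∈ S, ∀ a ∈ l, 1 ≤ a)
    (β : List ℕ → ℝ) (ξ : ℝ) : ContinuousOn (trigSum S β ξ) (Icc 0 1) :=
  continuousOn_finsetSum _ fun a ha => continuousOn_const.mul (continuousOn_e_invBranch (hS a ha) ξ)

theorem integral_norm_sq_trigSum_le {A : Finset ℕ} {P : List ℕ → ℝ} {C : ℝ}
    (hP : QuasiBernoulli A P C) {K : ℕ} (hA : ∀ a ∈ A, 1 ≤ a ∧ a + 1 ≤ K) (hK : 1 ≤ K) {n : ℕ}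
    {S : Finset (List ℕ)} (hS : S ⊆ words A n) {Q ξ B C' : ℝ} (hQ : 1 ≤ Q)
    (hSQ : ∀ a ∈ S, Q ≤ den a ∧ (den a : ℝ) ≤ K * Q) (hξ : Q ^ 3 ≤ ξ)
    (hB : ∀ a ∈ S, ∀ j ≤ n, den (a.drop j) * P (a.drop j) ≤ B) (hB0 : 0 ≤ B) {β : List ℕ → ℝ}
    (hβ : ∀ a ∈ S, |β a| ≤ C' * P a) :
    ∫ y in (0 : ℝ)..1, ‖trigSum S β ξ y‖ ^ 2 ≤ C' ^ 2 * (oscConst K * ((n + 1) * B)) / √Q := by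
  have hS1 : ∀ l ∈ S, ∀ a ∈ l, 1 ≤ a := fun l hl a ha => (hA a ((mem_words.1 (hS hl)).2 a ha)).1
  have hsQ : 0 < √Q := Real.sqrt_pos.2 (by linarith)
  have hosc : 0 ≤ oscConst K := by rw [oscConst]; positivity
  have hsq : ∀ y, ((‖trigSum S β ξ y‖ ^ 2 : ℝ) : ℂ) =
      ∑ a ∈ S, ∑ b ∈ S, (β a * β b : ℂ) * e (ξ * (invBranch a y - invBranch b y)) := fun y => by
    push_cast
    rw [← Complex.mul_conj', trigSum, map_sum, Finset.sum_mul_sum]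
    refine Finset.sum_congr rfl fun a _ => Finset.sum_congr rfl fun b _ => ?_
    rw [map_mul, Complex.conj_ofReal, conj_e, mul_sub, sub_eq_add_neg (ξ * invBranch a y), e_add]
    ring
  have hii : ∀ a ∈ S, ∀ b ∈ S, IntervalIntegrable (fun y => (β a * β b : ℂ) *
      e (ξ * (invBranch a y - invBranch b y))) volume 0 1 := fun a ha b hb =>
    ContinuousOn.intervalIntegrable_of_Icc zero_le_one (continuousOn_const.mul
      (continuous_e.comp_continuousOn (continuousOn_const.mul
        ((continuousOn_invBranch (hS1 a ha)).sub (continuousOn_invBranch (hS1 b hb))))))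
  have h1 : ∫ y in (0 : ℝ)..1, ‖trigSum S β ξ y‖ ^ 2 ≤
      ∑ a ∈ S, ∑ b ∈ S, |β a| * |β b| *
        ‖∫ y in (0 : ℝ)..1, e (ξ * (invBranch a y - invBranch b y))‖ := by
    calc _ ≤ ‖∫ y in (0 : ℝ)..1, ((‖trigSum S β ξ y‖ ^ 2 : ℝ) : ℂ)‖ := by
          rw [intervalIntegral.integral_ofReal, Complex.norm_real]; exact le_abs_self _
      _ = ‖∑ a ∈ S, ∑ b ∈ S, (β a * β b : ℂ) *
          ∫ y in (0 : ℝ)..1, e (ξ * (invBranch a y - invBranch b y))‖ := by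
          simp_rw [hsq]
          rw [intervalIntegral.integral_finsetSum fun a ha => by
            simpa only [Finset.sum_fn] using IntervalIntegrable.sum S (fun b hb => hii a ha b hb)]
          congr 1
          refine Finset.sum_congr rfl fun a ha => ?_
          rw [intervalIntegral.integral_finsetSum fun b hb => hii a ha b hb]
          exact Finset.sum_congr rfl fun b _ => intervalIntegral.integral_const_mul _ _
      _ ≤ _ := by
          refine (norm_sum_le _ _).trans (Finset.sum_le_sum fun a _ =>
            (norm_sum_le _ _).trans (Finset.sum_le_sum fun b _ => ?_))
          rw [norm_mul, norm_mul, Complex.norm_real, Complex.norm_real, Real.norm_eq_abs,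
            Real.norm_eq_abs]
  have hPnn : ∀ a ∈ words A n, 0 ≤ P a := fun a ha => (hP.pos' ha).le
  have h2 : ∀ a ∈ S, ∑ b ∈ words A n, P b * (∑ j ∈ Finset.range (n + 1),
      if a.drop j = b.drop j then (den (a.drop j) : ℝ) else 0) ≤ (n + 1) * B := fun a ha => by
    simp_rw [Finset.mul_sum]
    rw [Finset.sum_comm]
    have : ∀ j ∈ Finset.range (n + 1), ∑ b ∈ words A n,
        P b * (if a.drop j = b.drop j then (den (a.drop j) : ℝ) else 0) ≤ B := fun j hj => by
      have hjn : j ≤ n := by simpa [Nat.lt_succ_iff] using hj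
      rw [hP.sum_drop hjn (fun c => if a.drop j = c then (den (a.drop j) : ℝ) else 0)]
      simp only [mul_ite, mul_zero]
      rw [Finset.sum_ite_eq, if_pos (drop_mem_words (hS ha) j), mul_comm]
      exact hB a ha j hjn
    refine (Finset.sum_le_sum this).trans (le_of_eq ?_)
    rw [Finset.sum_const, Finset.card_range, nsmul_eq_mul]; push_cast; ring
  by_cases hSe : S = ∅
  · subst hSe; simp [trigSum]; positivity
  obtain ⟨a₀, ha₀⟩ := Finset.nonempty_iff_ne_empty.2 hSe
  have hC' : 0 ≤ C' := by
    have := (abs_nonneg _).trans (hβ a₀ ha₀)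
    exact nonneg_of_mul_nonneg_left this (hP.pos' (hS ha₀))
  have hin : ∀ a ∈ S, ∀ b ∈ S, |β a| * |β b| *
      ‖∫ y in (0 : ℝ)..1, e (ξ * (invBranch a y - invBranch b y))‖ ≤
      C' ^ 2 * (oscConst K / √Q) * (P a * (P b * ∑ j ∈ Finset.range (n + 1),
        if a.drop j = b.drop j then (den (a.drop j) : ℝ) else 0)) := fun a ha b hb => by
    have := norm_integral_e_pair_le hA hK (hS ha) (hS hb) hQ (hSQ a ha).1 (hSQ a ha).2
      (hSQ b hb).1 (hSQ b hb).2 hξ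
    have pa := hPnn a (hS ha)
    have pb := hPnn b (hS hb)
    calc _ ≤ (C' * P a) * (C' * P b) * (oscConst K / √Q * ∑ j ∈ Finset.range (n + 1),
        if a.drop j = b.drop j then (den (a.drop j) : ℝ) else 0) := by
          gcongr
          exacts [hβ a ha, hβ b hb]
      _ = _ := by ring
  calc _ ≤ _ := h1
    _ ≤ ∑ a ∈ S, ∑ b ∈ S, C' ^ 2 * (oscConst K / √Q) * (P a * (P b * ∑ j ∈ Finset.range (n + 1),
        if a.drop j = b.drop j then (den (a.drop j) : ℝ) else 0)) :=
      Finset.sum_le_sum fun a ha => Finset.sum_le_sum fun b hb => hin a ha b hb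
    _ = C' ^ 2 * (oscConst K / √Q) * ∑ a ∈ S, P a * ∑ b ∈ S, (P b * ∑ j ∈ Finset.range (n + 1),
        if a.drop j = b.drop j then (den (a.drop j) : ℝ) else 0) := by
      simp_rw [← Finset.mul_sum]
    _ ≤ C' ^ 2 * (oscConst K / √Q) * ∑ a ∈ S, P a * ((n + 1) * B) := by
      refine mul_le_mul_of_nonneg_left (Finset.sum_le_sum fun a ha =>
        mul_le_mul_of_nonneg_left (le_trans ?_ (h2 a ha)) (hPnn a (hS ha))) (by positivity)
      refine Finset.sum_le_sum_of_subset_of_nonneg hS fun b hb _ => mul_nonneg (hPnn b hb) ?_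
      exact Finset.sum_nonneg fun j _ => by split_ifs <;> positivity
    _ ≤ C' ^ 2 * (oscConst K / √Q) * (1 * ((n + 1) * B)) := by
      rw [← Finset.sum_mul]
      refine mul_le_mul_of_nonneg_left (mul_le_mul_of_nonneg_right ?_ (by positivity))
        (by positivity)
      rw [← hP.sum_words n]
      exact Finset.sum_le_sum_of_subset_of_nonneg hS fun b hb _ => hPnn b hb
    _ = _ := by ring

end

section

theorem norm_e_sub_le (x y : ℝ) : ‖e x - e y‖ ≤ 2 * π * |x - y| := by
  have := convex_univ.norm_image_sub_le_of_norm_hasDerivWithin_le (f := e) (C := 2 * π)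
    (fun z _ => (hasDerivAt_e z).hasDerivWithinAt) (fun z _ => by
      rw [norm_mul, norm_mul, norm_mul, norm_e, Complex.norm_I, Complex.norm_real,
        Complex.norm_ofNat, Real.norm_eq_abs, abs_of_pos Real.pi_pos, mul_one, mul_one])
    (mem_univ y) (mem_univ x)
  simpa using this

theorem abs_invBranch_sub_le {l : List ℕ} (hl : ∀ a ∈ l, 1 ≤ a) {x y : ℝ}
    (hx : x ∈ Icc (0 : ℝ) 1) (hy : y ∈ Icc (0 : ℝ) 1) :
    |invBranch l x - invBranch l y| ≤ 1 / (den l : ℝ) ^ 2 * |x - y| := by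
  have hd : (0 : ℝ) < den l := by exact_mod_cast den_pos hl
  have := (convex_Icc (0 : ℝ) 1).norm_image_sub_le_of_norm_hasDerivWithin_le (f := invBranch l)
    (C := 1 / (den l : ℝ) ^ 2)
    (fun z hz => (hasDerivAt_invBranch hl hz.1).hasDerivWithinAt) (fun z hz => by
      rw [norm_div, norm_pow, norm_neg, norm_one, one_pow, norm_pow, Real.norm_eq_abs,
        abs_of_pos (aff_pos hl hz.1)]
      exact one_div_le_one_div_of_le (by positivity)
        (pow_le_pow_left₀ hd.le (den_le_aff l hz.1) 2)) hy hx
  simpa using this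

theorem invBranch_injective (l : List ℕ) : Function.Injective (invBranch l) := by
  induction l with
  | nil => exact fun x y h => h
  | cons a l ih =>
    intro x y h
    rw [invBranch_cons, invBranch_cons, inv_inj, add_left_inj] at h
    exact ih h

theorem invBranch_mem_Ioo {l : List ℕ} (hl : ∀ a ∈ l, 1 ≤ a) {y : ℝ} (hy : y ∈ Ioo (0 : ℝ) 1) :
    invBranch l y ∈ Ioo (0 : ℝ) 1 := by
  induction l with
  | nil => exact hy
  | cons a l ih =>
    have h := ih fun x hx => hl x (by simp [hx])
    have ha : (1 : ℝ) ≤ a := by exact_mod_cast hl a (by simp)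
    rw [invBranch_cons]
    exact ⟨inv_pos.2 (by linarith [h.1]), inv_lt_one_of_one_lt₀ (by linarith [h.1])⟩

theorem eq_of_invBranch_eq {d d' : List ℕ} (hd : ∀ a ∈ d, 1 ≤ a) (hd' : ∀ a ∈ d', 1 ≤ a)
    (hlen : d.length = d'.length) {y y' : ℝ} (hy : y ∈ Ioo (0 : ℝ) 1) (hy' : y' ∈ Ioo (0 : ℝ) 1)
    (h : invBranch d y = invBranch d' y') : d = d' := by
  induction d generalizing d' with
  | nil => exact (List.length_eq_zero_iff.1 hlen.symm).symm
  | cons a l ih =>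
    cases d' with
    | nil => simp at hlen
    | cons a' l' =>
      have hl := fun x hx => hd x (List.mem_cons_of_mem a hx)
      have hl' := fun x hx => hd' x (List.mem_cons_of_mem a' hx)
      rw [invBranch_cons, invBranch_cons, inv_inj] at h
      have h1 := invBranch_mem_Ioo hl hy
      have h2 := invBranch_mem_Ioo hl' hy'
      have haa : a = a' := by
        have e1 : (a : ℝ) < a' + 1 := by linarith [h1.1, h2.2]
        have e2 : (a' : ℝ) < a + 1 := by linarith [h1.2, h2.1]
        have e1' : a < a' + 1 := by exact_mod_cast e1
        have e2' : a' < a + 1 := by exact_mod_cast e2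
        omega
      subst haa
      rw [ih hl hl' (by simpa using hlen) (by linarith)]

theorem integral_comp_invBranch_le {l : List ℕ} (hl : ∀ a ∈ l, 1 ≤ a) {g : ℝ → ℝ}
    (hg : ContinuousOn g (Icc 0 1)) (hg0 : ∀ x, 0 ≤ g x) :
    ∫ y in (0 : ℝ)..1, g (invBranch l y) ≤
      4 * den l ^ 2 * ∫ x in invBranch l '' Ioo 0 1, g x := by
  have hd : (0 : ℝ) < den l := by exact_mod_cast den_pos hl
  rw [integral_image_eq_integral_abs_deriv_smul measurableSet_Ioo
    (fun x hx => (hasDerivAt_invBranch hl hx.1.le).hasDerivWithinAt)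
    (invBranch_injective l).injOn, intervalIntegral.integral_of_le zero_le_one,
    integral_Ioc_eq_integral_Ioo, ← integral_const_mul]
  have hc : ContinuousOn (fun y => g (invBranch l y)) (Icc 0 1) :=
    hg.comp (continuousOn_invBranch hl) fun y hy => invBranch_mem_Icc hl hy
  have hc2 : ContinuousOn (fun y => 4 * (den l : ℝ) ^ 2 *
      (|(-1) ^ l.length / aff l y ^ 2| • g (invBranch l y))) (Icc 0 1) := by
    refine continuousOn_const.mul (ContinuousOn.smul (ContinuousOn.abs (continuousOn_const.div
      ((continuous_aff l).pow 2).continuousOn fun y hy => ?_)) hc)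
    exact pow_ne_zero 2 (aff_pos hl hy.1).ne'
  refine setIntegral_mono_on (hc.integrableOn_Icc.mono_set Ioo_subset_Icc_self)
    (hc2.integrableOn_Icc.mono_set Ioo_subset_Icc_self) measurableSet_Ioo fun y hy => ?_
  have hpos := aff_pos hl hy.1.le
  rw [smul_eq_mul, abs_div, abs_pow, abs_neg, abs_one, one_pow, abs_of_pos (by positivity),
    ← mul_assoc]
  refine le_mul_of_one_le_left (hg0 _) ?_
  rw [mul_one_div, le_div_iff₀ (by positivity), one_mul]
  calc aff l y ^ 2 ≤ (2 * den l) ^ 2 := pow_le_pow_left₀ hpos.le (aff_le hl hy.2.le) 2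
    _ = _ := by ring

theorem sum_integral_comp_invBranch_le {n : ℕ} {S : Finset (List ℕ)}
    (hS : ∀ d ∈ S, d.length = n ∧ ∀ a ∈ d, 1 ≤ a) {g : ℝ → ℝ} (hg : ContinuousOn g (Icc 0 1))
    (hg0 : ∀ x, 0 ≤ g x) {p : List ℕ → ℝ} {B : ℝ} (hp : ∀ d ∈ S, 0 ≤ p d)
    (hB : ∀ d ∈ S, p d * den d ^ 2 ≤ B) (hB0 : 0 ≤ B) :
    ∑ d ∈ S, p d * ∫ y in (0 : ℝ)..1, g (invBranch d y) ≤ 4 * B * ∫ y in (0 : ℝ)..1, g y := by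
  have hsub : ∀ d ∈ S, invBranch d '' Ioo 0 1 ⊆ Icc (0 : ℝ) 1 := fun d hd => by
    rintro _ ⟨y, hy, rfl⟩
    exact Ioo_subset_Icc_self (invBranch_mem_Ioo (hS d hd).2 hy)
  have hmeas : ∀ d ∈ S, MeasurableSet (invBranch d '' Ioo (0 : ℝ) 1) := fun d hd =>
    measurableSet_Ioo.image_of_continuousOn_injOn
      ((continuousOn_invBranch (hS d hd).2).mono Ioo_subset_Icc_self) (invBranch_injective d).injOn
  calc _ ≤ ∑ d ∈ S, 4 * B * ∫ x in invBranch d '' Ioo 0 1, g x := by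
        refine Finset.sum_le_sum fun d hd => ?_
        have h0 : 0 ≤ ∫ x in invBranch d '' Ioo 0 1, g x := integral_nonneg fun x => hg0 x
        calc _ ≤ p d * (4 * den d ^ 2 * ∫ x in invBranch d '' Ioo 0 1, g x) :=
              mul_le_mul_of_nonneg_left (integral_comp_invBranch_le (hS d hd).2 hg hg0) (hp d hd)
          _ = 4 * (p d * den d ^ 2) * ∫ x in invBranch d '' Ioo 0 1, g x := by ring
          _ ≤ _ := by gcongr; exact hB d hd
    _ = 4 * B * ∫ x in ⋃ d ∈ S, invBranch d '' Ioo 0 1, g x := by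
        rw [← Finset.mul_sum, integral_biUnion_finset S hmeas]
        · intro d hd d' hd' hne
          rw [Function.onFun, Set.disjoint_left]
          rintro _ ⟨y, hy, rfl⟩ ⟨y', hy', h⟩
          exact hne (eq_of_invBranch_eq (hS d hd).2 (hS d' hd').2
            ((hS d hd).1.trans (hS d' hd').1.symm) hy hy' h.symm)
        · exact fun d hd => hg.integrableOn_Icc.mono_set (hsub d hd)
    _ ≤ _ := by
        rw [intervalIntegral.integral_of_le zero_le_one, ← integral_Icc_eq_integral_Ioc]
        refine mul_le_mul_of_nonneg_left ?_ (by positivity)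
        exact setIntegral_mono_set hg.integrableOn_Icc (Eventually.of_forall hg0)
          (Set.iUnion₂_subset hsub).eventuallyLE

variable {A : Finset ℕ} {P : List ℕ → ℝ} {C : ℝ}

theorem norm_trigSum_le (hP : QuasiBernoulli A P C) {n : ℕ} {S : Finset (List ℕ)}
    (hS : S ⊆ words A n) {C' : ℝ} {β : List ℕ → ℝ} (hC' : 0 ≤ C')
    (hβ : ∀ a ∈ S, |β a| ≤ C' * P a) (ξ y : ℝ) : ‖trigSum S β ξ y‖ ≤ C' := by
  calc _ ≤ ∑ a ∈ S, ‖(β a : ℂ) * e (ξ * invBranch a y)‖ := norm_sum_le _ _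
    _ ≤ ∑ a ∈ S, C' * P a := Finset.sum_le_sum fun a ha => by
      rw [norm_mul, norm_e, mul_one, Complex.norm_real]; exact hβ a ha
    _ ≤ ∑ a ∈ words A n, C' * P a := Finset.sum_le_sum_of_subset_of_nonneg hS
      fun a ha _ => mul_nonneg hC' (hP.pos' ha).le
    _ = C' := by rw [← Finset.mul_sum, hP.sum_words, mul_one]

theorem norm_trigSum_sub_le (hP : QuasiBernoulli A P C) {n : ℕ} {S : Finset (List ℕ)}
    (hS : S ⊆ words A n) (hA : ∀ a ∈ A, 1 ≤ a) {C' : ℝ} {β : List ℕ → ℝ} (hC' : 0 ≤ C')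
    (hβ : ∀ a ∈ S, |β a| ≤ C' * P a) {Q ξ : ℝ} (hQ : 0 < Q) (hSQ : ∀ a ∈ S, Q ≤ den a)
    (hξ : 0 ≤ ξ) {x y : ℝ} (hx : x ∈ Icc (0 : ℝ) 1) (hy : y ∈ Icc (0 : ℝ) 1) :
    ‖trigSum S β ξ x - trigSum S β ξ y‖ ≤ C' * (2 * π * ξ / Q ^ 2 * |x - y|) := by
  rw [trigSum, trigSum, ← Finset.sum_sub_distrib]
  calc _ ≤ ∑ a ∈ S, ‖(β a : ℂ) * e (ξ * invBranch a x) - β a * e (ξ * invBranch a y)‖ :=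
        norm_sum_le _ _
    _ ≤ ∑ a ∈ S, C' * P a * (2 * π * ξ / Q ^ 2 * |x - y|) := Finset.sum_le_sum fun a ha => by
      have hl : ∀ x ∈ a, 1 ≤ x := fun z hz => hA z ((mem_words.1 (hS ha)).2 z hz)
      rw [← mul_sub, norm_mul, Complex.norm_real]
      refine mul_le_mul (hβ a ha) ?_ (norm_nonneg _) (mul_nonneg hC' (hP.pos' (hS ha)).le)
      refine (norm_e_sub_le _ _).trans ?_
      rw [← mul_sub, abs_mul, abs_of_nonneg hξ]
      calc _ ≤ 2 * π * (ξ * (1 / (den a : ℝ) ^ 2 * |x - y|)) := by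
            gcongr; exact abs_invBranch_sub_le hl hx hy
        _ ≤ 2 * π * (ξ * (1 / Q ^ 2 * |x - y|)) := by
            gcongr; exact hSQ a ha
        _ = _ := by ring
    _ ≤ ∑ a ∈ words A n, C' * P a * (2 * π * ξ / Q ^ 2 * |x - y|) :=
      Finset.sum_le_sum_of_subset_of_nonneg hS
        fun a ha _ => mul_nonneg (mul_nonneg hC' (hP.pos' ha).le) (by positivity)
    _ = _ := by rw [← Finset.sum_mul, ← Finset.mul_sum, hP.sum_words, mul_one]

theorem sum_norm_sq_trigSum_le (hP : QuasiBernoulli A P C) {n : ℕ} {S : Finset (List ℕ)}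
    (hS : S ⊆ words A n) (hA : ∀ a ∈ A, 1 ≤ a) {C' : ℝ} {β : List ℕ → ℝ} (hC' : 0 ≤ C')
    (hβ : ∀ a ∈ S, |β a| ≤ C' * P a) {Q R ξ : ℝ} (hQ : 0 < Q) (hR : 0 < R)
    (hSQ : ∀ a ∈ S, Q ≤ den a) (hξ : 0 ≤ ξ) {good : List ℕ → Prop} {N M : ℕ}
    (hN : ∀ a ∈ words A N, R ≤ den a) (hM : N ≤ M) {ε B : ℝ} (hB0 : 0 ≤ B)
    (hbad : ∀ l ≤ N, ∑ d ∈ (stops A R l).filter (fun d => ¬ good d), P d ≤ ε)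
    (hgood : ∀ l, ∀ d ∈ stops A R l, good d → P d * den d ^ 2 ≤ B)
    {x₀ : ℝ} (hx₀ : x₀ ∈ Icc (0 : ℝ) 1) :
    ∑ b ∈ words A M, P b * ‖trigSum S β ξ (invBranch b x₀)‖ ^ 2 ≤
      (N + 1) * (C' ^ 2 * ε + 4 * π * C' ^ 2 * (ξ / (Q ^ 2 * R ^ 2)) +
        4 * B * ∫ y in (0 : ℝ)..1, ‖trigSum S β ξ y‖ ^ 2) := by
  set F := trigSum S β ξ with hF
  have hS1 : ∀ l ∈ S, ∀ a ∈ l, 1 ≤ a := fun l hl a ha => hA a ((mem_words.1 (hS hl)).2 a ha)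
  have hFc : ContinuousOn (fun y => ‖F y‖ ^ 2) (Icc 0 1) :=
    (continuousOn_trigSum hS1 β ξ).norm.pow 2
  have hFb : ∀ y, ‖F y‖ ≤ C' := norm_trigSum_le hP hS hC' hβ ξ
  have hst : ∀ l, ∀ d ∈ stops A R l, d ∈ words A l ∧ (∀ a ∈ d, a ∈ A) ∧ (∀ a ∈ d, 1 ≤ a) ∧
      R ≤ den d := fun l d hd => by
    rw [stops, Finset.mem_filter] at hd
    have h2 := (mem_words.1 hd.1).2
    exact ⟨hd.1, h2, fun a ha => hA a (h2 a ha), hd.2.1⟩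
  set I : List ℕ → ℝ := fun d => ∫ y in (0 : ℝ)..1, ‖F (invBranch d y)‖ ^ 2 with hI
  set o : ℝ := 4 * π * C' ^ 2 * (ξ / (Q ^ 2 * R ^ 2)) with ho
  have ho0 : 0 ≤ o := by positivity
  have hpt : ∀ l, ∀ d ∈ stops A R l, ∀ x ∈ Icc (0 : ℝ) 1,
      ‖F (invBranch d x)‖ ^ 2 ≤ I d + o := fun l d hd x hx => by
    obtain ⟨-, -, hd1, hdR⟩ := hst l d hd
    have hcc : ContinuousOn (fun y => ‖F (invBranch d y)‖ ^ 2) (Icc 0 1) :=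
      hFc.comp (continuousOn_invBranch hd1) fun y hy => invBranch_mem_Icc hd1 hy
    have hle : ∀ y ∈ Icc (0 : ℝ) 1, ‖F (invBranch d x)‖ ^ 2 - o ≤ ‖F (invBranch d y)‖ ^ 2 :=
        fun y hy => by
      have h1 := norm_trigSum_sub_le hP hS hA hC' hβ hQ hSQ hξ (invBranch_mem_Icc hd1 hx)
        (invBranch_mem_Icc hd1 hy)
      have h2 : |invBranch d x - invBranch d y| ≤ 1 / R ^ 2 := by
        refine (abs_invBranch_sub_le hd1 hx hy).trans ?_
        have : |x - y| ≤ 1 := abs_le.2 ⟨by linarith [hx.1, hy.2], by linarith [hx.2, hy.1]⟩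
        calc _ ≤ 1 / (den d : ℝ) ^ 2 * 1 := by gcongr
          _ ≤ _ := by rw [mul_one]; gcongr
      have h3 : ‖F (invBranch d x)‖ - ‖F (invBranch d y)‖ ≤
          C' * (2 * π * ξ / Q ^ 2 * (1 / R ^ 2)) :=
        (norm_sub_norm_le _ _).trans (h1.trans (by gcongr))
      have h4 := hFb (invBranch d x)
      have h5 := hFb (invBranch d y)
      have h6 := norm_nonneg (F (invBranch d x))
      have h7 := norm_nonneg (F (invBranch d y))
      have h8 : o = 2 * C' * (C' * (2 * π * ξ / Q ^ 2 * (1 / R ^ 2))) := by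
        rw [ho]; field_simp; ring
      have h9 : 0 ≤ C' * (2 * π * ξ / Q ^ 2 * (1 / R ^ 2)) := by positivity
      rw [h8]
      nlinarith
    have := intervalIntegral.integral_mono_on (μ := volume) zero_le_one
      (intervalIntegrable_const (c := ‖F (invBranch d x)‖ ^ 2 - o))
      (hcc.intervalIntegrable_of_Icc zero_le_one) hle
    rw [intervalIntegral.integral_const, sub_zero, one_smul] at this
    simp only [hI]
    linarith
  have hI0 : ∀ d, 0 ≤ I d := fun d =>
    intervalIntegral.integral_nonneg zero_le_one fun y _ => by positivity
  rw [sum_words_eq_sum_stops hN hM]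
  have hl : ∀ l ∈ Finset.range (N + 1), ∑ d ∈ stops A R l, ∑ g ∈ words A (M - l),
      P (d ++ g) * ‖F (invBranch (d ++ g) x₀)‖ ^ 2 ≤
      C' ^ 2 * ε + o + 4 * B * ∫ y in (0 : ℝ)..1, ‖F y‖ ^ 2 := fun l hl => by
    have hlN : l ≤ N := by simpa [Nat.lt_succ_iff] using hl
    have hPd : ∀ d ∈ stops A R l, 0 ≤ P d := fun d hd => (hP.pos d (hst l d hd).2.1).le
    have hone : ∀ d ∈ stops A R l, ∀ c, (∀ g ∈ words A (M - l),
        ‖F (invBranch (d ++ g) x₀)‖ ^ 2 ≤ c) → ∑ g ∈ words A (M - l),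
        P (d ++ g) * ‖F (invBranch (d ++ g) x₀)‖ ^ 2 ≤ P d * c := fun d hd c hc => by
      rw [← hP.sum_words_append (M - l) d (hst l d hd).2.1, Finset.sum_mul]
      exact Finset.sum_le_sum fun g hg => mul_le_mul_of_nonneg_left (hc g hg)
        (hP.pos' (append_mem_words (hst l d hd).1 hg)).le
    rw [← Finset.sum_filter_add_sum_filter_not _ good]
    have hbad' : ∑ d ∈ (stops A R l).filter (fun d => ¬ good d), ∑ g ∈ words A (M - l),
        P (d ++ g) * ‖F (invBranch (d ++ g) x₀)‖ ^ 2 ≤ C' ^ 2 * ε := by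
      calc _ ≤ ∑ d ∈ (stops A R l).filter (fun d => ¬ good d), P d * C' ^ 2 :=
            Finset.sum_le_sum fun d hd => hone d (Finset.mem_of_mem_filter d hd) _ fun g _ =>
              pow_le_pow_left₀ (norm_nonneg _) (hFb _) 2
        _ ≤ _ := by
            rw [← Finset.sum_mul, mul_comm]
            exact mul_le_mul_of_nonneg_left (hbad l hlN) (sq_nonneg _)
    have hgood' : ∑ d ∈ (stops A R l).filter good, ∑ g ∈ words A (M - l),
        P (d ++ g) * ‖F (invBranch (d ++ g) x₀)‖ ^ 2 ≤
        4 * B * (∫ y in (0 : ℝ)..1, ‖F y‖ ^ 2) + o := by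
      calc _ ≤ ∑ d ∈ (stops A R l).filter good, P d * (I d + o) :=
            Finset.sum_le_sum fun d hd => by
              have hd' := Finset.mem_of_mem_filter d hd
              refine hone d hd' _ fun g hg => ?_
              rw [invBranch_append]
              refine hpt l d hd' _ (invBranch_mem_Icc (fun a ha => ?_) hx₀)
              exact hA a ((mem_words.1 hg).2 a ha)
        _ = ∑ d ∈ (stops A R l).filter good, P d * I d +
            (∑ d ∈ (stops A R l).filter good, P d) * o := by
            rw [Finset.sum_mul, ← Finset.sum_add_distrib]
            exact Finset.sum_congr rfl fun d _ => mul_add _ _ _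
        _ ≤ 4 * B * (∫ y in (0 : ℝ)..1, ‖F y‖ ^ 2) + 1 * o := by
            refine add_le_add ?_ (mul_le_mul_of_nonneg_right ?_ ho0)
            · refine sum_integral_comp_invBranch_le (n := l) (fun d hd => ?_) hFc
                (fun x => sq_nonneg _) (fun d hd => hPd d (Finset.mem_of_mem_filter d hd))
                (fun d hd => ?_) hB0
              · have := hst l d (Finset.mem_of_mem_filter d hd)
                exact ⟨(mem_words.1 this.1).1, this.2.2.1⟩
              · rw [Finset.mem_filter] at hd
                exact hgood l d hd.1 hd.2
            · rw [← hP.sum_words l]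
              refine Finset.sum_le_sum_of_subset_of_nonneg (fun d hd => ?_)
                fun d hd _ => (hP.pos' hd).le
              exact (hst l d (Finset.mem_of_mem_filter d hd)).1
        _ = _ := by rw [one_mul]
    linarith
  refine (Finset.sum_le_sum hl).trans (le_of_eq ?_)
  rw [Finset.sum_const, Finset.card_range, nsmul_eq_mul]; push_cast; ring

end

section

/-- Cylinder weights `W` comparable to `P`, with Hölder distortion. -/
structure GibbsWeights (A : Finset ℕ) (P W : List ℕ → ℝ) (C θ : ℝ) : Prop
    extends QuasiBernoulli A P C where
  weight_pos : ∀ l : List ℕ, (∀ a ∈ l, a ∈ A) → 0 < W l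
  weight_le : ∀ l : List ℕ, (∀ a ∈ l, a ∈ A) → W l ≤ C * P l
  le_weight : ∀ l : List ℕ, (∀ a ∈ l, a ∈ A) → P l ≤ C * W l
  theta_pos : 0 < θ
  theta_lt_one : θ < 1
  distortion : ∀ l c b : List ℕ, (∀ a ∈ l, a ∈ A) → (∀ a ∈ c, a ∈ A) → (∀ a ∈ b, a ∈ A) → c ≠ [] →
    |W (l ++ (c ++ b)) / W (c ++ b) - W (l ++ c) / W c| ≤ C * θ ^ c.length * P l

namespace GibbsWeights

variable {A : Finset ℕ} {P W : List ℕ → ℝ} {C θ : ℝ}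

theorem div_le (h : GibbsWeights A P W C θ) {l c : List ℕ} (hl : ∀ a ∈ l, a ∈ A)
    (hc : ∀ a ∈ c, a ∈ A) : |W (l ++ c) / W c| ≤ C ^ 3 * P l := by
  have hlc : ∀ a ∈ l ++ c, a ∈ A := fun a ha => (List.mem_append.1 ha).elim (hl a) (hc a)
  have hC : 0 < C := one_pos.trans_le h.one_le
  have hP := h.pos l hl
  rw [abs_of_pos (div_pos (h.weight_pos _ hlc) (h.weight_pos _ hc)), div_le_iff₀ (h.weight_pos _ hc)]
  calc W (l ++ c) ≤ C * P (l ++ c) := h.weight_le _ hlc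
    _ ≤ C * (C * (P l * P c)) := by gcongr; exact h.le_mul l c hl hc
    _ ≤ C * (C * (P l * (C * W c))) := by gcongr; exact h.le_weight c hc
    _ = _ := by ring

theorem sum_weight_le (h : GibbsWeights A P W C θ) (n : ℕ) : ∑ a ∈ words A n, W a ≤ C := by
  calc _ ≤ ∑ a ∈ words A n, C * P a :=
        Finset.sum_le_sum fun a ha => h.weight_le a (mem_words.1 ha).2
    _ = C := by rw [← Finset.mul_sum, h.sum_words, mul_one]

theorem norm_trigSum_words_le (h : GibbsWeights A P W C θ) (n : ℕ) (ξ y : ℝ) :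
    ‖trigSum (words A n) W ξ y‖ ≤ C :=
  GaussGibbs.norm_trigSum_le h.toQuasiBernoulli subset_rfl (zero_le_one.trans h.one_le) (fun a ha => by
    rw [abs_of_pos (h.weight_pos a (mem_words.1 ha).2)]
    exact h.weight_le a (mem_words.1 ha).2) ξ y

/-- The contribution of the branches that start with a word of length `n` from `S`. -/
theorem norm_sum_le_of_subset (h : GibbsWeights A P W C θ) {n k M : ℕ} (hk : 0 < k)
    {S G : Finset (List ℕ)} (hS : S ⊆ words A n) (hG : G ⊆ S) {ε V t ξ x₀ : ℝ}
    (hε : ∑ a ∈ S \ G, P a ≤ ε) (ht : 0 < t)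
    (hV : ∀ c ∈ words A k, ∑ b ∈ words A (k + M),
      P b * ‖trigSum G (fun a => W (a ++ c) / W c) ξ (invBranch b x₀)‖ ^ 2 ≤ V) :
    ‖∑ a ∈ S, ∑ b ∈ words A (k + M), (W (a ++ b) : ℂ) * e (ξ * invBranch (a ++ b) x₀)‖ ≤
      C * ε + C ^ 2 * θ ^ k + C * t + C / t * (A.card ^ k * V) := by
  have hC : 0 < C := one_pos.trans_le h.one_le
  have hθ := h.theta_pos
  have hmem : ∀ {i : ℕ} {l : List ℕ}, l ∈ words A i → ∀ a ∈ l, a ∈ A := fun hl => (mem_words.1 hl).2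
  have hmem2 : ∀ {l c : List ℕ}, (∀ a ∈ l, a ∈ A) → (∀ a ∈ c, a ∈ A) → ∀ a ∈ l ++ c, a ∈ A :=
    fun hl hc a ha => (List.mem_append.1 ha).elim (hl a) (hc a)
  have hWbad : ∑ a ∈ S \ G, ∑ b ∈ words A (k + M), W (a ++ b) ≤ C * ε := by
    calc _ ≤ ∑ a ∈ S \ G, C * P a := by
          refine Finset.sum_le_sum fun a ha => ?_
          have ha' := hmem (hS (Finset.sdiff_subset ha))
          rw [← h.sum_words_append (k + M) a ha', Finset.mul_sum]
          exact Finset.sum_le_sum fun b hb => h.weight_le _ (hmem2 ha' (hmem hb))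
      _ ≤ C * ε := by rw [← Finset.mul_sum]; gcongr
  have hbad : ‖∑ a ∈ S \ G, ∑ b ∈ words A (k + M),
      (W (a ++ b) : ℂ) * e (ξ * invBranch (a ++ b) x₀)‖ ≤ C * ε := by
    refine (norm_sum_le _ _).trans ((Finset.sum_le_sum fun a ha => ?_).trans hWbad)
    refine (norm_sum_le _ _).trans (Finset.sum_le_sum fun b hb => ?_)
    have ha' := hmem (hS (Finset.sdiff_subset ha))
    rw [norm_mul, norm_e, mul_one, Complex.norm_real, Real.norm_eq_abs,
      abs_of_pos (h.weight_pos _ (hmem2 ha' (hmem hb)))]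
  have hPG : ∑ a ∈ G, P a ≤ 1 := by
    rw [← h.sum_words n]
    exact Finset.sum_le_sum_of_subset_of_nonneg (hG.trans hS) fun a ha _ => (h.pos' ha).le
  have hterm : ∀ c ∈ words A k, ∀ b ∈ words A M,
      ‖∑ a ∈ G, (W (a ++ (c ++ b)) : ℂ) * e (ξ * invBranch (a ++ (c ++ b)) x₀)‖ ≤
      W (c ++ b) * (C * θ ^ k) + W (c ++ b) * t + C / t *
        (P (c ++ b) * ‖trigSum G (fun a => W (a ++ c) / W c) ξ (invBranch (c ++ b) x₀)‖ ^ 2) := by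
    intro c hc b hb
    have hcb := hmem2 (hmem hc) (hmem hb)
    have hW := h.weight_pos _ hcb
    set F := trigSum G (fun a => W (a ++ c) / W c) ξ (invBranch (c ++ b) x₀) with hF
    have hc0 : c ≠ [] := by
      rintro rfl; have := (mem_words.1 hc).1; simp at this; omega
    have hsplit : ∑ a ∈ G, (W (a ++ (c ++ b)) : ℂ) * e (ξ * invBranch (a ++ (c ++ b)) x₀) =
        W (c ++ b) * (∑ a ∈ G, ((W (a ++ (c ++ b)) / W (c ++ b) - W (a ++ c) / W c : ℝ) : ℂ) *
          e (ξ * invBranch a (invBranch (c ++ b) x₀)) + F) := by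
      rw [hF, trigSum, ← Finset.sum_add_distrib, Finset.mul_sum]
      refine Finset.sum_congr rfl fun a _ => ?_
      rw [invBranch_append a]
      have : (W (c ++ b) : ℂ) ≠ 0 := by exact_mod_cast hW.ne'
      push_cast
      field_simp
      ring
    have h1 : ‖∑ a ∈ G, ((W (a ++ (c ++ b)) / W (c ++ b) - W (a ++ c) / W c : ℝ) : ℂ) *
          e (ξ * invBranch a (invBranch (c ++ b) x₀))‖ ≤ C * θ ^ k := by
      calc _ ≤ ∑ a ∈ G, C * θ ^ k * P a := by
            refine (norm_sum_le _ _).trans (Finset.sum_le_sum fun a ha => ?_)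
            rw [norm_mul, norm_e, mul_one, Complex.norm_real, Real.norm_eq_abs]
            have := h.distortion a c b (hmem (hS (hG ha))) (hmem hc) (hmem hb) hc0
            rwa [(mem_words.1 hc).1] at this
        _ ≤ C * θ ^ k * 1 := by rw [← Finset.mul_sum]; gcongr
        _ = _ := mul_one _
    have h2 : ‖F‖ ≤ t + 1 / t * ‖F‖ ^ 2 := by
      have : 0 ≤ (‖F‖ - t) ^ 2 := sq_nonneg _
      rw [← sub_nonneg]
      have h3 : t + 1 / t * ‖F‖ ^ 2 - ‖F‖ = ((‖F‖ - t) ^ 2 + t * ‖F‖) / t := by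
        field_simp; ring
      rw [h3]; positivity
    rw [hsplit, norm_mul, Complex.norm_real, Real.norm_eq_abs, abs_of_pos hW]
    calc _ ≤ W (c ++ b) * (C * θ ^ k + (t + 1 / t * ‖F‖ ^ 2)) := by
          gcongr; exact (norm_add_le _ _).trans (add_le_add h1 h2)
      _ = W (c ++ b) * (C * θ ^ k) + W (c ++ b) * t + 1 / t * (W (c ++ b) * ‖F‖ ^ 2) := by ring
      _ ≤ W (c ++ b) * (C * θ ^ k) + W (c ++ b) * t + 1 / t * (C * P (c ++ b) * ‖F‖ ^ 2) := by
          gcongr; exact h.weight_le _ hcb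
      _ = _ := by ring
  have hV' : ∑ c ∈ words A k, ∑ b ∈ words A M, P (c ++ b) *
      ‖trigSum G (fun a => W (a ++ c) / W c) ξ (invBranch (c ++ b) x₀)‖ ^ 2 ≤ A.card ^ k * V := by
    calc _ ≤ ∑ c ∈ words A k, V := by
          refine Finset.sum_le_sum fun c hc => le_trans ?_ (hV c hc)
          rw [sum_words_add]
          exact Finset.single_le_sum (f := fun c' => ∑ b ∈ words A M, P (c' ++ b) *
            ‖trigSum G (fun a => W (a ++ c) / W c) ξ (invBranch (c' ++ b) x₀)‖ ^ 2)
            (fun c' hc' => Finset.sum_nonneg fun b hb =>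
              mul_nonneg (h.pos _ (hmem2 (hmem hc') (hmem hb))).le (sq_nonneg _)) hc
      _ = _ := by rw [Finset.sum_const, card_words, nsmul_eq_mul, Nat.cast_pow]
  have hWsum : ∑ c ∈ words A k, ∑ b ∈ words A M, W (c ++ b) ≤ C := by
    rw [← sum_words_add]; exact h.sum_weight_le _
  have hgood : ‖∑ a ∈ G, ∑ b ∈ words A (k + M),
      (W (a ++ b) : ℂ) * e (ξ * invBranch (a ++ b) x₀)‖ ≤
      C ^ 2 * θ ^ k + C * t + C / t * (A.card ^ k * V) := by
    rw [Finset.sum_comm, sum_words_add]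
    calc _ ≤ ∑ c ∈ words A k, ∑ b ∈ words A M,
          (W (c ++ b) * (C * θ ^ k) + W (c ++ b) * t + C / t * (P (c ++ b) *
            ‖trigSum G (fun a => W (a ++ c) / W c) ξ (invBranch (c ++ b) x₀)‖ ^ 2)) :=
          (norm_sum_le _ _).trans (Finset.sum_le_sum fun c hc =>
            (norm_sum_le _ _).trans (Finset.sum_le_sum fun b hb => hterm c hc b hb))
      _ = (∑ c ∈ words A k, ∑ b ∈ words A M, W (c ++ b)) * (C * θ ^ k) +
          (∑ c ∈ words A k, ∑ b ∈ words A M, W (c ++ b)) * t +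
          C / t * ∑ c ∈ words A k, ∑ b ∈ words A M, P (c ++ b) *
            ‖trigSum G (fun a => W (a ++ c) / W c) ξ (invBranch (c ++ b) x₀)‖ ^ 2 := by
          simp only [Finset.sum_add_distrib, Finset.sum_mul, Finset.mul_sum]
      _ ≤ C * (C * θ ^ k) + C * t + C / t * (A.card ^ k * V) := by gcongr
      _ = _ := by ring
  rw [← Finset.sum_sdiff hG]
  refine (norm_add_le _ _).trans ((add_le_add hbad hgood).trans_eq ?_)
  ring

end GibbsWeights

/-- The mass of the words with a long suffix satisfying `p`. -/
theorem QuasiBernoulli.sum_exists_drop_le {A : Finset ℕ} {P : List ℕ → ℝ} {C : ℝ}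
    (hP : QuasiBernoulli A P C) {p : List ℕ → Prop} {K η : ℝ} (hK : 0 ≤ K) (hη : 0 ≤ η) (hη1 : η ≤ 1)
    (hp : ∀ n, ∑ a ∈ (words A n).filter p, P a ≤ K * η ^ n) (n k : ℕ) :
    ∑ a ∈ (words A n).filter (fun a => ∃ j ≤ n, k ≤ n - j ∧ p (a.drop j)), P a ≤
      (n + 1) * (K * η ^ k) := by
  calc _ ≤ ∑ a ∈ words A n, ∑ j ∈ Finset.range (n + 1),
        (if k ≤ n - j then P a * (if p (a.drop j) then 1 else 0) else 0) := by
        rw [Finset.sum_filter]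
        refine Finset.sum_le_sum fun a ha => ?_
        have hnn : ∀ j ∈ Finset.range (n + 1),
            0 ≤ (if k ≤ n - j then P a * (if p (a.drop j) then 1 else 0) else 0) := fun j _ => by
          have := (hP.pos' ha).le
          split_ifs <;> simp [this]
        split_ifs with hh
        · obtain ⟨j, hj, hkj, hpj⟩ := hh
          refine le_trans ?_ (Finset.single_le_sum hnn (Finset.mem_range.2 (Nat.lt_succ_of_le hj)))
          simp [hkj, hpj]
        · exact Finset.sum_nonneg hnn
    _ ≤ ∑ j ∈ Finset.range (n + 1), K * η ^ k := by
        rw [Finset.sum_comm]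
        refine Finset.sum_le_sum fun j hj => ?_
        split_ifs with hkj
        · rw [hP.sum_drop (Nat.lt_succ_iff.1 (Finset.mem_range.1 hj)) fun c => if p c then 1 else 0]
          calc _ = ∑ c ∈ (words A (n - j)).filter p, P c := by
                rw [Finset.sum_filter]; simp
            _ ≤ K * η ^ (n - j) := hp _
            _ ≤ _ := mul_le_mul_of_nonneg_left (pow_le_pow_of_le_one hη hη1 hkj) hK
        · simp; positivity
    _ = _ := by simp

end

section

theorem QuasiBernoulli.le_one {A : Finset ℕ} {P : List ℕ → ℝ} {C : ℝ} (hP : QuasiBernoulli A P C)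
    {l : List ℕ} (hl : ∀ a ∈ l, a ∈ A) : P l ≤ 1 := by
  rw [← hP.sum_words l.length]
  exact Finset.single_le_sum (f := P) (fun a ha => (hP.pos' ha).le) (mem_words.2 ⟨rfl, hl⟩)

namespace GibbsWeights

variable {A : Finset ℕ} {P W : List ℕ → ℝ} {C θ : ℝ}

theorem norm_trigSum_words_le_of_params (h : GibbsWeights A P W C θ) {K : ℕ}
    (hA : ∀ a ∈ A, 1 ≤ a ∧ a + 1 ≤ K) (hK : 1 ≤ K) (hAK : A.card ≤ K) {Q R ξ : ℝ} (hQ : 1 < Q)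
    (hR : 1 < R)
    (hξ : Q ^ 3 ≤ ξ) {N k j₀ m : ℕ} (hk : 0 < k) (hNQ : ∀ a ∈ words A N, Q ≤ den a)
    (hNR : ∀ a ∈ words A N, R ≤ den a) (hm : 2 * N + k ≤ m) {p : List ℕ → Prop} {K₀ η : ℝ}
    (hK₀ : 0 ≤ K₀) (hη : 0 ≤ η) (hη1 : η ≤ 1)
    (hp : ∀ n, ∑ a ∈ (words A n).filter p, P a ≤ K₀ * η ^ n)
    (hgood : ∀ a : List ℕ, (∀ x ∈ a, x ∈ A) → ¬ p a → den a * P a ≤ 1) {B : ℝ} (hB : 0 ≤ B)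
    (hgoodB : ∀ a : List ℕ, (∀ x ∈ a, x ∈ A) → ¬ p a → (den a : ℝ) ≤ K * R → P a * den a ^ 2 ≤ B)
    (hj₀ : ∀ a : List ℕ, (∀ x ∈ a, x ∈ A) → R ≤ den a → j₀ ≤ a.length) {t : ℝ} (ht : 0 < t)
    {x₀ : ℝ} (hx₀ : x₀ ∈ Icc (0 : ℝ) 1) :
    ‖trigSum (words A m) W ξ x₀‖ ≤ (N + 1) * (C * ((N + 1) * (K₀ * η ^ k)) + C ^ 2 * θ ^ k + C * t +
      C / t * (K ^ k * ((N + 1) * ((C ^ 3) ^ 2 * (K₀ * η ^ j₀) +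
        4 * π * (C ^ 3) ^ 2 * (ξ / (Q ^ 2 * R ^ 2)) +
        4 * B * ((C ^ 3) ^ 2 * (oscConst K * ((N + 1) * K ^ k)) / √Q))))) := by
  have hC : 0 < C := one_pos.trans_le h.one_le
  have hθ := h.theta_pos
  have hC3 : 0 ≤ C ^ 3 := by positivity
  have hK' : (1 : ℝ) ≤ K := by exact_mod_cast hK
  have hP := h.toQuasiBernoulli
  have hosc : 0 ≤ oscConst K := by rw [oscConst]; positivity
  have hmem : ∀ {i : ℕ} {l : List ℕ}, l ∈ words A i → ∀ a ∈ l, a ∈ A := fun hl => (mem_words.1 hl).2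
  set V := (N + 1) * ((C ^ 3) ^ 2 * (K₀ * η ^ j₀) +
        4 * π * (C ^ 3) ^ 2 * (ξ / (Q ^ 2 * R ^ 2)) +
        4 * B * ((C ^ 3) ^ 2 * (oscConst K * ((N + 1) * K ^ k)) / √Q)) with hVdef
  have hξ0 : 0 ≤ ξ := le_trans (by positivity) hξ
  have hV0 : 0 ≤ V := by rw [hVdef]; positivity
  rw [trigSum, sum_words_eq_sum_stops hNQ (by omega)]
  calc _ ≤ ∑ n ∈ Finset.range (N + 1), (C * ((N + 1) * (K₀ * η ^ k)) + C ^ 2 * θ ^ k + C * t +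
        C / t * (K ^ k * V)) := by
        refine (norm_sum_le _ _).trans (Finset.sum_le_sum fun n hn => ?_)
        have hnN : n ≤ N := Nat.lt_succ_iff.1 (Finset.mem_range.1 hn)
        have hnN' : (n : ℝ) ≤ N := by exact_mod_cast hnN
        set G := (stops A Q n).filter (fun a => ¬ ∃ j ≤ n, k ≤ n - j ∧ p (a.drop j)) with hG
        have hsub : stops A Q n ⊆ words A n := Finset.filter_subset _ _
        have hGs : G ⊆ stops A Q n := Finset.filter_subset _ _
        have hmn : m - n = k + (m - n - k) := by omega
        have hGQ : ∀ a ∈ G, Q ≤ den a ∧ (den a : ℝ) ≤ K * Q := fun a ha => by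
          have h1 := (Finset.mem_filter.1 (hGs ha)).2
          exact ⟨h1.1, h1.den_le hQ fun x hx => hA x (hmem (hsub (hGs ha)) x hx)⟩
        have hε : ∑ a ∈ stops A Q n \ G, P a ≤ (N + 1) * (K₀ * η ^ k) := by
          refine le_trans ?_ ((hP.sum_exists_drop_le hK₀ hη hη1 hp n k).trans
            (by gcongr))
          refine Finset.sum_le_sum_of_subset_of_nonneg (fun a ha => ?_)
            fun a ha _ => (hP.pos' (Finset.filter_subset _ _ ha)).le
          rw [Finset.mem_sdiff, hG, Finset.mem_filter, not_and, not_not] at ha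
          exact Finset.mem_filter.2 ⟨hsub ha.1, ha.2 ha.1⟩
        have hV : ∀ c ∈ words A k, ∑ b ∈ words A (k + (m - n - k)),
            P b * ‖trigSum G (fun a => W (a ++ c) / W c) ξ (invBranch b x₀)‖ ^ 2 ≤ V := by
          intro c hc
          have hβ : ∀ a ∈ G, |W (a ++ c) / W c| ≤ C ^ 3 * P a := fun a ha =>
            h.div_le (hmem (hsub (hGs ha))) (hmem hc)
          have hI := integral_norm_sq_trigSum_le hP hA hK (hGs.trans hsub) hQ.le hGQ hξ
            (B := (K : ℝ) ^ k) (fun a ha j hj => by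
              have haw := hsub (hGs ha)
              have hd := drop_mem_words haw j
              have hPd := hP.pos' hd
              by_cases hkj : k ≤ n - j
              · have hnp : ¬ p (a.drop j) := fun hpa => (Finset.mem_filter.1 ha).2 ⟨j, hj, hkj, hpa⟩
                exact (hgood _ (hmem hd) hnp).trans (one_le_pow₀ hK')
              · have h1 : (den (a.drop j) : ℝ) ≤ K ^ (a.drop j).length := by
                  exact_mod_cast den_le_pow fun x hx => hA x (hmem hd x hx)
                have h2 : (K : ℝ) ^ (a.drop j).length ≤ K ^ k := by
                  refine pow_le_pow_right₀ hK' ?_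
                  rw [(mem_words.1 hd).1]; omega
                calc _ ≤ (K : ℝ) ^ k * 1 := by
                      gcongr
                      exacts [h1.trans h2, hP.le_one (hmem hd)]
                  _ = _ := mul_one _) (by positivity) hβ
          have hmain := sum_norm_sq_trigSum_le hP (hGs.trans hsub) (fun a ha => (hA a ha).1) hC3 hβ
            (Q := Q) (R := R) (by linarith) (by linarith) (fun a ha => (hGQ a ha).1) hξ0
            (good := fun d => ¬ p d) (N := N) (M := k + (m - n - k)) hNR (by omega)
            (ε := K₀ * η ^ j₀) (B := B) hB (fun l _ => by
              simp only [not_not]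
              by_cases hl : j₀ ≤ l
              · calc _ ≤ ∑ d ∈ (words A l).filter p, P d :=
                      Finset.sum_le_sum_of_subset_of_nonneg
                        (Finset.filter_subset_filter _ (Finset.filter_subset _ _))
                        fun a ha _ => (hP.pos' (Finset.filter_subset _ _ ha)).le
                  _ ≤ K₀ * η ^ l := hp l
                  _ ≤ _ := mul_le_mul_of_nonneg_left (pow_le_pow_of_le_one hη hη1 hl) hK₀
              · rw [Finset.filter_eq_empty_iff.2, Finset.sum_empty]
                · positivity
                · intro d hd _
                  have hdw := Finset.mem_filter.1 hd
                  have := hj₀ d (hmem hdw.1) hdw.2.1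
                  rw [(mem_words.1 hdw.1).1] at this
                  omega) (fun l d hd hg => by
              have hdw := Finset.mem_filter.1 hd
              exact hgoodB d (hmem hdw.1) hg
                (hdw.2.den_le hR fun x hx => hA x (hmem hdw.1 x hx))) hx₀
          refine hmain.trans ?_
          rw [hVdef]
          gcongr
          refine hI.trans ?_
          gcongr
        have hmain := h.norm_sum_le_of_subset (M := m - n - k) hk hsub hGs hε ht hV
        rw [hmn]
        refine hmain.trans ?_
        have hcard : (A.card : ℝ) ^ k ≤ K ^ k :=
          pow_le_pow_left₀ (Nat.cast_nonneg _) (by exact_mod_cast hAK) k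
        exact add_le_add_right (mul_le_mul_of_nonneg_left
          (mul_le_mul_of_nonneg_right hcard hV0) (by positivity)) _
    _ = _ := by rw [Finset.sum_const, Finset.card_range, nsmul_eq_mul]; push_cast; ring

end GibbsWeights

end

section

theorem exists_pow_mul_le {ρ : ℝ} (hρ : 0 < ρ) (hρ1 : ρ < 1) (n : ℕ) :
    ∃ c τ : ℝ, 0 < c ∧ 0 < τ ∧ τ < 1 ∧ ∀ k : ℕ, ((k : ℝ) + 1) ^ n * ρ ^ k ≤ c * τ ^ k := by
  have hs1 : √ρ < 1 := by rw [Real.sqrt_lt' one_pos]; linarith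
  have hs0 : 0 < √ρ := Real.sqrt_pos.2 hρ
  have ht := tendsto_pow_const_mul_const_pow_of_abs_lt_one n (r := √ρ) (by rwa [abs_of_pos hs0])
  obtain ⟨M, hM⟩ := ht.bddAbove_range
  have hM' : ∀ k : ℕ, (k : ℝ) ^ n * √ρ ^ k ≤ M := fun k => hM ⟨k, rfl⟩
  refine ⟨(|M| + 1) / √ρ, √ρ, by positivity, hs0, hs1, fun k => ?_⟩
  have h1 := hM' (k + 1)
  have h2 : ((k : ℝ) + 1) ^ n * √ρ ^ k ≤ (|M| + 1) / √ρ := by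
    rw [le_div_iff₀ hs0]
    have : M ≤ |M| := le_abs_self M
    push_cast at h1
    rw [pow_succ] at h1
    linarith
  calc ((k : ℝ) + 1) ^ n * ρ ^ k = ((k : ℝ) + 1) ^ n * √ρ ^ k * √ρ ^ k := by
        rw [mul_assoc, ← mul_pow, Real.mul_self_sqrt hρ.le]
    _ ≤ _ := by gcongr

namespace GibbsWeights

variable {A : Finset ℕ} {P W : List ℕ → ℝ} {C θ : ℝ}

set_option maxHeartbeats 400000 in
/-- Decay of the trigonometric sums at frequencies between `exp (6sk)` and `exp (6s(k+1))`. -/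
theorem norm_trigSum_words_le_pow (h : GibbsWeights A P W C θ) {K : ℕ}
    (hA : ∀ a ∈ A, 1 ≤ a ∧ a + 1 ≤ K) (hK : 2 ≤ K) (hAK : A.card ≤ K) {δ : ℝ} (hδ : 0 < δ)
    (hδ1 : δ ≤ 1 / 2) {K₀ η : ℝ} (hK₀ : 0 < K₀) (hη : 0 < η) (hη1 : η < 1)
    (hp : ∀ n, ∑ a ∈ (words A n).filter
      (fun a => 0 ≤ Real.log (P a) + (1 + 2 * δ) * Real.log (den a)), P a ≤ K₀ * η ^ n)
    {x₀ : ℝ} (hx₀ : x₀ ∈ Icc (0 : ℝ) 1) :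
    ∃ s c τ : ℝ, 0 < s ∧ 0 < c ∧ 0 < τ ∧ τ < 1 ∧ ∀ k : ℕ, 0 < k → ∀ ξ : ℝ,
      Real.exp (6 * s * k) ≤ ξ → ξ ≤ Real.exp (6 * s * (k + 1)) →
      ∃ m₀, ∀ m ≥ m₀, ‖trigSum (words A m) W ξ x₀‖ ≤ c * τ ^ k := by
  have hC : 0 < C := one_pos.trans_le h.one_le
  have hK2 : (2 : ℝ) ≤ K := by exact_mod_cast hK
  have hlK : 0 < Real.log K := Real.log_pos (by linarith)
  have hlη : Real.log η < 0 := Real.log_neg hη hη1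
  have hosc : 0 ≤ oscConst K := by rw [oscConst]; positivity
  obtain ⟨s, hs1, hs2⟩ : ∃ s : ℝ, 4 * Real.log K ^ 2 / (-Real.log η) ≤ s ∧ 5 * Real.log K / δ ≤ s :=
    ⟨_, le_max_left _ _, le_max_right _ _⟩
  have hs : 0 < s := lt_of_lt_of_le (by positivity) hs2
  rw [div_le_iff₀ (by linarith)] at hs1
  rw [div_le_iff₀ hδ] at hs2
  obtain ⟨L, hL⟩ := pow_unbounded_of_one_lt (2 * Real.exp (4 * s)) (one_lt_two : (1 : ℝ) < 2)
  set V₁ := C ^ 6 * K₀ + 4 * π * C ^ 6 * Real.exp (6 * s) + 4 * K * C ^ 6 * oscConst K with hV₁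
  have hV₁0 : 0 ≤ V₁ := by positivity
  set ρ := max (max η θ) (K : ℝ)⁻¹ with hρdef
  have hKinv : (K : ℝ)⁻¹ < 1 := inv_lt_one_of_one_lt₀ (by linarith)
  have hρ0 : 0 < ρ := lt_of_lt_of_le hη ((le_max_left _ _).trans (le_max_left _ _))
  have hρ1 : ρ < 1 := max_lt (max_lt hη1 h.theta_lt_one) hKinv
  obtain ⟨c, τ, hc, hτ, hτ1, hcτ⟩ := exists_pow_mul_le hρ0 hρ1 3
  refine ⟨s, (L + 1) ^ 3 * (C * K₀ + C ^ 2 + C + C * V₁) * c, τ, hs, by positivity, hτ, hτ1,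
    fun k hk ξ hξ1 hξ2 => ⟨2 * (L * k) + k, fun m hm => ?_⟩⟩
  have hk' : (1 : ℝ) ≤ k := by exact_mod_cast hk
  have hsk : 0 < s * k := by positivity
  have hδsk : 0 < δ * (s * k) := by positivity
  set Q := Real.exp (2 * s * k) with hQ
  set R := Real.exp ((1 + δ) * s * k) with hR
  set u := (K : ℝ) ^ k with hu
  have hu1 : 1 ≤ u := one_le_pow₀ (by linarith)
  have hu0 : 0 < u := by linarith
  have hul : ∀ n : ℕ, (u ^ n)⁻¹ = Real.exp (-(n * (k * Real.log K))) := fun n => by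
    rw [Real.exp_neg, Real.exp_nat_mul, Real.exp_nat_mul, Real.exp_log (by linarith)]
  have hRQ : R ≤ Q := Real.exp_le_exp.2 (by
    linarith [mul_nonneg (sub_nonneg.2 hδ1) hsk.le])
  have hNQ : ∀ a ∈ words A (L * k), Q ≤ den a := fun a ha => by
    have h1 := two_pow_le_den_sq (l := a) fun x hx => (hA x ((mem_words.1 ha).2 x hx)).1
    rw [(mem_words.1 ha).1] at h1
    have h2 : (2 : ℝ) ^ (L * k) ≤ 2 * (den a : ℝ) ^ 2 := by exact_mod_cast h1
    rw [← pow_le_pow_iff_left₀ (Real.exp_pos _).le (Nat.cast_nonneg _) two_ne_zero]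
    have h3 : (2 * Real.exp (4 * s)) ^ k ≤ (2 : ℝ) ^ (L * k) := by
      rw [pow_mul]; exact pow_le_pow_left₀ (by positivity) hL.le k
    have h4 : 2 * Q ^ 2 ≤ (2 * Real.exp (4 * s)) ^ k := by
      rw [mul_pow, hQ, ← Real.exp_nat_mul, ← Real.exp_nat_mul]
      have : (2 : ℝ) ≤ 2 ^ k := le_self_pow₀ one_le_two hk.ne'
      refine mul_le_mul this (le_of_eq ?_) (Real.exp_pos _).le (by positivity)
      congr 1; push_cast; ring
    linarith
  have hmain := h.norm_trigSum_words_le_of_params hA (by omega) hAK (Q := Q) (R := R) (ξ := ξ)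
    (Real.one_lt_exp_iff.2 (by linarith)) (Real.one_lt_exp_iff.2 (by linarith))
    (by rw [hQ, ← Real.exp_nat_mul]; refine le_trans (le_of_eq ?_) hξ1; congr 1; push_cast; ring)
    (N := L * k) (k := k) (j₀ := ⌈s * k / Real.log K⌉₊) (m := m) hk hNQ
    (fun a ha => hRQ.trans (hNQ a ha)) hm hK₀.le hη.le hη1.le hp
    (fun a ha hpa => by
      have hP := h.pos a ha
      have hd : (1 : ℝ) ≤ den a := by exact_mod_cast den_pos fun x hx => (hA x (ha x hx)).1
      have hld := Real.log_nonneg hd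
      rw [not_le] at hpa
      rw [← Real.log_nonpos_iff (by positivity), Real.log_mul (by positivity) hP.ne']
      linarith [mul_nonneg hδ.le hld])
    (B := K * Real.exp ((1 - δ) * s * k)) (by positivity)
    (fun a ha hpa hdR => by
      have hP := h.pos a ha
      have hd : (1 : ℝ) ≤ den a := by exact_mod_cast den_pos fun x hx => (hA x (ha x hx)).1
      have hld := Real.log_nonneg hd
      rw [not_le] at hpa
      have h1 : Real.log (den a) ≤ Real.log K + (1 + δ) * s * k := by
        rw [← Real.log_exp ((1 + δ) * s * k), ← Real.log_mul (by positivity) (Real.exp_pos _).ne']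
        exact Real.log_le_log (by linarith) hdR
      rw [← Real.log_le_log_iff (by positivity) (by positivity), Real.log_mul hP.ne' (by positivity),
        Real.log_pow, Real.log_mul (by positivity) (Real.exp_pos _).ne', Real.log_exp]
      have h2 : (1 - 2 * δ) * Real.log (den a) ≤ (1 - 2 * δ) * (Real.log K + (1 + δ) * s * k) :=
        mul_le_mul_of_nonneg_left h1 (by linarith)
      have h3 : 0 ≤ δ ^ 2 * (s * k) := by positivity
      have h4 : 0 ≤ δ * Real.log K := by positivity
      push_cast
      linarith)
    (fun a ha hRa => by
      rw [Nat.ceil_le, div_le_iff₀ hlK]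
      have h1 : (den a : ℝ) ≤ K ^ a.length := by
        exact_mod_cast den_le_pow fun x hx => hA x (ha x hx)
      have h2 := Real.log_le_log (Real.exp_pos _) (hRa.trans h1)
      rw [Real.log_exp, Real.log_pow] at h2
      linarith)
    (t := (u ^ 2)⁻¹) (by positivity) hx₀
  have hj₀ : η ^ ⌈s * k / Real.log K⌉₊ ≤ (u ^ 4)⁻¹ := by
    rw [hul, ← Real.log_le_iff_le_exp (by positivity), Real.log_pow]
    have h1 := Nat.le_ceil (s * k / Real.log K)
    have h2 := mul_le_mul_of_nonpos_right h1 hlη.le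
    refine h2.trans ?_
    rw [div_mul_eq_mul_div, div_le_iff₀ hlK]
    push_cast
    linarith [mul_le_mul_of_nonneg_right hs1 (Nat.cast_nonneg k)]
  have hexp : Real.exp (-(δ * s * k)) ≤ (u ^ 5)⁻¹ := by
    rw [hul]; refine Real.exp_le_exp.2 ?_; push_cast
    linarith [mul_le_mul_of_nonneg_right hs2 (Nat.cast_nonneg k)]
  have hξQR : ξ / (Q ^ 2 * R ^ 2) ≤ Real.exp (6 * s) * (u ^ 4)⁻¹ := by
    have h1 : Real.exp (-(δ * s * k)) ≤ (u ^ 4)⁻¹ :=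
      hexp.trans (inv_anti₀ (by positivity) (pow_le_pow_right₀ hu1 (by norm_num)))
    refine le_trans ?_ (mul_le_mul_of_nonneg_left h1 (Real.exp_pos _).le)
    rw [div_le_iff₀ (by positivity)]
    refine hξ2.trans ?_
    rw [hQ, hR, ← Real.exp_nat_mul, ← Real.exp_nat_mul, ← Real.exp_add, ← Real.exp_add,
      ← Real.exp_add]
    refine Real.exp_le_exp.2 ?_
    push_cast
    linarith
  have hsqrt : √Q = Real.exp (s * k) := by
    rw [hQ, Real.sqrt_eq_iff_mul_self_eq (Real.exp_pos _).le (Real.exp_pos _).le, ← Real.exp_add]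
    congr 1; ring
  set n := ((L * k : ℕ) : ℝ) + 1 with hn
  have hn1 : 1 ≤ n := by rw [hn]; linarith [Nat.cast_nonneg (α := ℝ) (L * k)]
  have hnL : n ≤ (L + 1) * (k + 1) := by
    rw [hn]; push_cast; linarith [Nat.cast_nonneg (α := ℝ) L]
  have hV : n * ((C ^ 3) ^ 2 * (K₀ * η ^ ⌈s * k / Real.log K⌉₊) +
        4 * π * (C ^ 3) ^ 2 * (ξ / (Q ^ 2 * R ^ 2)) +
        4 * (K * Real.exp ((1 - δ) * s * k)) *
          ((C ^ 3) ^ 2 * (oscConst K * (n * u)) / √Q)) ≤ n ^ 2 * V₁ * (u ^ 4)⁻¹ := by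
    have hlast : 4 * (K * Real.exp ((1 - δ) * s * k)) *
        ((C ^ 3) ^ 2 * (oscConst K * (n * u)) / √Q) =
        4 * K * C ^ 6 * oscConst K * n * u * Real.exp (-(δ * s * k)) := by
      have : Real.exp ((1 - δ) * s * k) = Real.exp (-(δ * s * k)) * √Q := by
        rw [hsqrt, ← Real.exp_add]; congr 1; ring
      rw [this]
      have : √Q ≠ 0 := by rw [hsqrt]; exact (Real.exp_pos _).ne'
      field_simp
    have hu5 : u * (u ^ 5)⁻¹ = (u ^ 4)⁻¹ := by field_simp
    have h1 : (C ^ 3) ^ 2 * (K₀ * η ^ ⌈s * k / Real.log K⌉₊) ≤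
        n * ((C ^ 3) ^ 2 * (K₀ * (u ^ 4)⁻¹)) :=
      le_trans (by gcongr) (le_mul_of_one_le_left (by positivity) hn1)
    have h2 : 4 * π * (C ^ 3) ^ 2 * (ξ / (Q ^ 2 * R ^ 2)) ≤
        n * (4 * π * (C ^ 3) ^ 2 * (Real.exp (6 * s) * (u ^ 4)⁻¹)) :=
      le_trans (mul_le_mul_of_nonneg_left hξQR (by positivity))
        (le_mul_of_one_le_left (by positivity) hn1)
    have h3 : 4 * K * C ^ 6 * oscConst K * n * u * Real.exp (-(δ * s * k)) ≤
        4 * K * C ^ 6 * oscConst K * n * u * (u ^ 5)⁻¹ :=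
      mul_le_mul_of_nonneg_left hexp (by positivity)
    rw [hlast]
    refine (mul_le_mul_of_nonneg_left (add_le_add (add_le_add h1 h2) h3) (by linarith)).trans_eq ?_
    rw [mul_assoc _ u, hu5, hV₁]; ring
  have hηρ : η ^ k ≤ ρ ^ k := pow_le_pow_left₀ hη.le ((le_max_left _ _).trans (le_max_left _ _)) k
  have hθρ : θ ^ k ≤ ρ ^ k :=
    pow_le_pow_left₀ h.theta_pos.le ((le_max_right _ _).trans (le_max_left _ _)) k
  have huρ : u⁻¹ ≤ ρ ^ k := by
    rw [hu, ← inv_pow]; exact pow_le_pow_left₀ (by positivity) (le_max_right _ _) k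
  have hu2 : (u ^ 2)⁻¹ ≤ ρ ^ k :=
    le_trans (inv_anti₀ hu0 (le_self_pow₀ hu1 (by norm_num))) huρ
  have hn2 : 1 ≤ n ^ 2 := one_le_pow₀ hn1
  have hn3 : n ≤ n ^ 2 := le_self_pow₀ hn1 (by norm_num)
  have hr0 : 0 ≤ ρ ^ k := by positivity
  clear_value Q R u n V₁ ρ
  have g1 : C * (n * (K₀ * η ^ k)) ≤ n ^ 2 * (C * (K₀ * ρ ^ k)) := by
    calc C * (n * (K₀ * η ^ k)) = n * (C * (K₀ * η ^ k)) := by ring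
      _ ≤ _ := by gcongr
  have g2 : C ^ 2 * θ ^ k ≤ n ^ 2 * (C ^ 2 * ρ ^ k) :=
    le_trans (by gcongr) (le_mul_of_one_le_left (by positivity) hn2)
  have g3 : C * (u ^ 2)⁻¹ ≤ n ^ 2 * (C * ρ ^ k) :=
    le_trans (by gcongr) (le_mul_of_one_le_left (by positivity) hn2)
  have g4 : C * (n ^ 2 * V₁) * u⁻¹ ≤ C * (n ^ 2 * V₁) * ρ ^ k := by gcongr
  have hn0 : 0 ≤ n := by linarith
  calc _ ≤ n * (C * (n * (K₀ * η ^ k)) + C ^ 2 * θ ^ k + C * (u ^ 2)⁻¹ +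
        C / (u ^ 2)⁻¹ * (u * (n ^ 2 * V₁ * (u ^ 4)⁻¹))) := by
        have hCu : 0 ≤ C / (u ^ 2)⁻¹ := by positivity
        rw [← hu] at hmain
        exact hmain.trans (mul_le_mul_of_nonneg_left (add_le_add_right
          (mul_le_mul_of_nonneg_left (mul_le_mul_of_nonneg_left hV hu0.le) hCu) _) hn0)
    _ = n * (C * (n * (K₀ * η ^ k)) + C ^ 2 * θ ^ k + C * (u ^ 2)⁻¹ +
        C * (n ^ 2 * V₁) * u⁻¹) := by congr 2; field_simp
    _ ≤ n * (n ^ 2 * (C * (K₀ * ρ ^ k)) + n ^ 2 * (C ^ 2 * ρ ^ k) + n ^ 2 * (C * ρ ^ k) +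
        C * (n ^ 2 * V₁) * ρ ^ k) :=
        mul_le_mul_of_nonneg_left (add_le_add (add_le_add (add_le_add g1 g2) g3) g4) hn0
    _ = n ^ 3 * ((C * K₀ + C ^ 2 + C + C * V₁) * ρ ^ k) := by ring
    _ ≤ ((L + 1) * (k + 1)) ^ 3 * ((C * K₀ + C ^ 2 + C + C * V₁) * ρ ^ k) := by gcongr
    _ = (L + 1) ^ 3 * (C * K₀ + C ^ 2 + C + C * V₁) * ((k + 1) ^ 3 * ρ ^ k) := by ring
    _ ≤ (L + 1) ^ 3 * (C * K₀ + C ^ 2 + C + C * V₁) * (c * τ ^ k) := by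
        exact mul_le_mul_of_nonneg_left (hcτ k) (by positivity)
    _ = _ := by ring

theorem exists_norm_trigSum_words_le (h : GibbsWeights A P W C θ) {K : ℕ}
    (hA : ∀ a ∈ A, 1 ≤ a ∧ a + 1 ≤ K) (hK : 2 ≤ K) (hAK : A.card ≤ K) {δ : ℝ} (hδ : 0 < δ)
    (hδ1 : δ ≤ 1 / 2) {K₀ η : ℝ} (hK₀ : 0 < K₀) (hη : 0 < η) (hη1 : η < 1)
    (hp : ∀ n, ∑ a ∈ (words A n).filter
      (fun a => 0 ≤ Real.log (P a) + (1 + 2 * δ) * Real.log (den a)), P a ≤ K₀ * η ^ n)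
    {x₀ : ℝ} (hx₀ : x₀ ∈ Icc (0 : ℝ) 1) :
    ∃ c σ : ℝ, 0 < c ∧ 0 < σ ∧ ∀ ξ : ℝ, 1 ≤ ξ →
      ∃ m₀, ∀ m ≥ m₀, ‖trigSum (words A m) W ξ x₀‖ ≤ c * ξ ^ (-σ) := by
  have hC : 0 < C := one_pos.trans_le h.one_le
  obtain ⟨s, c, τ, hs, hc, hτ, hτ1, hk⟩ :=
    h.norm_trigSum_words_le_pow hA hK hAK hδ hδ1 hK₀ hη hη1 hp hx₀
  have hlτ : Real.log τ < 0 := Real.log_neg hτ hτ1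
  refine ⟨(c + C) / τ, -Real.log τ / (6 * s), by positivity,
    div_pos (by linarith) (by positivity), fun ξ hξ => ?_⟩
  have hξ0 : 0 < ξ := by linarith
  have hlξ := Real.log_nonneg hξ
  set k := ⌊Real.log ξ / (6 * s)⌋₊ with hkdef
  have h1 : (k : ℝ) ≤ Real.log ξ / (6 * s) := Nat.floor_le (by positivity)
  have h2 : Real.log ξ / (6 * s) < k + 1 := Nat.lt_floor_add_one _
  have h3 : τ ^ (k + 1) ≤ ξ ^ (-(-Real.log τ / (6 * s))) := by
    rw [Real.rpow_def_of_pos hξ0, ← Real.log_le_iff_le_exp (by positivity), Real.log_pow]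
    have h4 := mul_le_mul_of_nonpos_right h2.le hlτ.le
    push_cast
    refine h4.trans_eq ?_
    ring
  suffices hs : ∃ m₀, ∀ m ≥ m₀, ‖trigSum (words A m) W ξ x₀‖ ≤ (c + C) * τ ^ k by
    obtain ⟨m₀, hm₀⟩ := hs
    refine ⟨m₀, fun m hm => (hm₀ m hm).trans ?_⟩
    calc (c + C) * τ ^ k = (c + C) / τ * τ ^ (k + 1) := by field_simp; ring
      _ ≤ _ := by gcongr
  rcases Nat.eq_zero_or_pos k with hk0 | hk0
  · refine ⟨0, fun m _ => (h.norm_trigSum_words_le m ξ x₀).trans ?_⟩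
    rw [hk0]; linarith
  · have h6 : 0 < 6 * s := by positivity
    rw [le_div_iff₀ h6] at h1
    rw [div_lt_iff₀ h6] at h2
    obtain ⟨m₀, hm₀⟩ := hk k hk0 ξ
      (by rw [← Real.le_log_iff_exp_le hξ0]; linarith)
      (by rw [← Real.log_le_iff_le_exp hξ0]; linarith)
    refine ⟨m₀, fun m hm => (hm₀ m hm).trans ?_⟩
    gcongr
    linarith

end GibbsWeights

end

section

theorem mem_Ioo_of_mem_gaussSet {x : ℝ} (hx : x ∈ gaussSet) : x ∈ Ioo (0 : ℝ) 1 :=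
  ⟨lt_of_le_of_ne hx.1.1 fun h => hx.2 ⟨0, by simp [h]⟩,
    lt_of_le_of_ne hx.1.2 fun h => hx.2 ⟨1, by simp [h]⟩⟩

theorem mem_gaussSet_of_mem_Ioo {x : ℝ} (hx : x ∈ Ioo (0 : ℝ) 1) (h : Irrational x) : x ∈ gaussSet :=
  ⟨Ioo_subset_Icc_self hx, h⟩

theorem one_lt_inv_of_mem_gaussSet {x : ℝ} (hx : x ∈ gaussSet) : 1 < x⁻¹ :=
  (one_lt_inv₀ (mem_Ioo_of_mem_gaussSet hx).1).2 (mem_Ioo_of_mem_gaussSet hx).2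

theorem gaussMap_add_cfDigit1 {x : ℝ} (hx : x ∈ gaussSet) : gaussMap x + cfDigit1 x = x⁻¹ := by
  have h := one_lt_inv_of_mem_gaussSet hx
  rw [gaussMap, cfDigit1, natCast_floor_eq_intCast_floor (by linarith), Int.fract_add_floor]

theorem invBranch1_gaussMap {x : ℝ} (hx : x ∈ gaussSet) :
    invBranch1 (cfDigit1 x) (gaussMap x) = x := by
  rw [invBranch1, gaussMap_add_cfDigit1 hx, inv_inv]

theorem gaussMap_mem_gaussSet {x : ℝ} (hx : x ∈ gaussSet) : gaussMap x ∈ gaussSet := by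
  refine ⟨⟨Int.fract_nonneg _, (Int.fract_lt_one _).le⟩, ?_⟩
  rw [gaussMap, Int.fract]
  exact (irrational_inv_iff.2 hx.2).sub_intCast _

theorem invBranch1_mem_gaussSet {a : ℕ} (ha : 1 ≤ a) {y : ℝ} (hy : y ∈ gaussSet) :
    invBranch1 a y ∈ gaussSet := by
  have h := mem_Ioo_of_mem_gaussSet hy
  have ha' : (1 : ℝ) ≤ a := by exact_mod_cast ha
  exact mem_gaussSet_of_mem_Ioo
    ⟨inv_pos.2 (by linarith [h.1]), inv_lt_one_of_one_lt₀ (by linarith [h.1])⟩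
    (irrational_inv_iff.2 (hy.2.add_natCast a))

theorem gaussMap_invBranch1 (a : ℕ) {y : ℝ} (hy : y ∈ gaussSet) : gaussMap (invBranch1 a y) = y := by
  have h := mem_Ioo_of_mem_gaussSet hy
  rw [gaussMap, invBranch1, inv_inv, Int.fract_add_natCast, Int.fract_eq_self.2 ⟨h.1.le, h.2⟩]

theorem cfDigit1_invBranch1 (a : ℕ) {y : ℝ} (hy : y ∈ gaussSet) : cfDigit1 (invBranch1 a y) = a := by
  have h := mem_Ioo_of_mem_gaussSet hy
  rw [cfDigit1, invBranch1, inv_inv, Nat.floor_add_natCast h.1.le, Nat.floor_eq_zero.2 h.2, zero_add]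

theorem invBranch_mem_gaussSet {l : List ℕ} (hl : ∀ a ∈ l, 1 ≤ a) {y : ℝ} (hy : y ∈ gaussSet) :
    invBranch l y ∈ gaussSet := by
  induction l with
  | nil => exact hy
  | cons a l ih =>
    exact invBranch1_mem_gaussSet (hl a (by simp)) (ih fun x hx => hl x (by simp [hx]))

theorem mem_cylinder_nil {x : ℝ} : x ∈ cylinder [] ↔ x ∈ gaussSet := by
  simp [_root_.cylinder]

theorem mem_cylinder_cons {a : ℕ} {l : List ℕ} {x : ℝ} :
    x ∈ cylinder (a :: l) ↔ x ∈ gaussSet ∧ cfDigit1 x = a ∧ gaussMap x ∈ cylinder l := by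
  simp only [_root_.cylinder, mem_ofPred_eq]
  constructor
  · rintro ⟨hx, h⟩
    exact ⟨hx, h ⟨0, by simp⟩, gaussMap_mem_gaussSet hx, fun i => h i.succ⟩
  · rintro ⟨hx, h0, _, h⟩
    refine ⟨hx, fun i => ?_⟩
    rcases i with ⟨i, hi⟩
    cases i with
    | zero => exact h0
    | succ i => exact h ⟨i, by simpa using hi⟩

theorem mem_cylinder {l : List ℕ} (hl : ∀ a ∈ l, 1 ≤ a) {x : ℝ} :
    x ∈ cylinder l ↔ ∃ y ∈ gaussSet, invBranch l y = x := by
  induction l generalizing x with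
  | nil => simp [mem_cylinder_nil]
  | cons a l ih =>
    rw [mem_cylinder_cons, ih fun x hx => hl x (by simp [hx])]
    constructor
    · rintro ⟨hx, rfl, y, hy, hyx⟩
      refine ⟨y, hy, ?_⟩
      change invBranch1 _ (invBranch l y) = x
      rw [hyx, invBranch1_gaussMap hx]
    · rintro ⟨y, hy, rfl⟩
      have hy' : invBranch l y ∈ gaussSet := invBranch_mem_gaussSet (fun x hx => hl x (by simp [hx])) hy
      exact ⟨invBranch_mem_gaussSet hl hy, cfDigit1_invBranch1 a hy', y, hy,
        (gaussMap_invBranch1 a hy').symm⟩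

theorem mem_badSet {A : Finset ℕ} {x : ℝ} :
    x ∈ badSet A ↔ x ∈ gaussSet ∧ cfDigit1 x ∈ A ∧ gaussMap x ∈ badSet A := by
  simp only [badSet, mem_ofPred_eq]
  constructor
  · rintro ⟨hx, h⟩
    exact ⟨hx, h 0, gaussMap_mem_gaussSet hx, fun i => h (i + 1)⟩
  · rintro ⟨hx, h0, _, h⟩
    refine ⟨hx, fun i => ?_⟩
    cases i with
    | zero => exact h0
    | succ i => exact h i

theorem invBranch_mem_badSet {A : Finset ℕ} (hA : ∀ a ∈ A, 1 ≤ a) {l : List ℕ} (hl : ∀ a ∈ l, a ∈ A)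
    {y : ℝ} (hy : y ∈ badSet A) : invBranch l y ∈ badSet A := by
  induction l with
  | nil => exact hy
  | cons a l ih =>
    have h := ih fun x hx => hl x (by simp [hx])
    rw [mem_badSet]
    exact ⟨invBranch1_mem_gaussSet (hA _ (hl a (by simp))) h.1,
      (cfDigit1_invBranch1 a h.1).symm ▸ hl a (by simp), (gaussMap_invBranch1 a h.1).symm ▸ h⟩

theorem invBranch_mem_cylinder {l : List ℕ} (hl : ∀ a ∈ l, 1 ≤ a) {y : ℝ} (hy : y ∈ gaussSet) :
    invBranch l y ∈ cylinder l := (mem_cylinder hl).2 ⟨y, hy, rfl⟩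

theorem mem_cylinder_inter_badSet {A : Finset ℕ} (hA : ∀ a ∈ A, 1 ≤ a) {l : List ℕ}
    (hl : ∀ a ∈ l, a ∈ A) {x : ℝ} :
    x ∈ cylinder l ∩ badSet A ↔ ∃ y ∈ badSet A, invBranch l y = x := by
  constructor
  · intro h
    induction l generalizing x with
    | nil => exact ⟨x, h.2, rfl⟩
    | cons a l ih =>
      rw [mem_inter_iff, mem_cylinder_cons] at h
      obtain ⟨y, hy, hyx⟩ := ih (fun x hx => hl x (by simp [hx])) ⟨h.1.2.2, (mem_badSet.1 h.2).2.2⟩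
      refine ⟨y, hy, ?_⟩
      change invBranch1 a (invBranch l y) = x
      rw [hyx, ← h.1.2.1, invBranch1_gaussMap h.1.1]
  · rintro ⟨y, hy, rfl⟩
    exact ⟨invBranch_mem_cylinder (fun a ha => hA a (hl a ha)) hy.1, invBranch_mem_badSet hA hl hy⟩

theorem cylinder_append {l k : List ℕ} (hl : ∀ a ∈ l, 1 ≤ a) (hk : ∀ a ∈ k, 1 ≤ a) {y : ℝ}
    (hy : y ∈ cylinder k) : invBranch l y ∈ cylinder (l ++ k) := by
  obtain ⟨z, hz, rfl⟩ := (mem_cylinder hk).1 hy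
  rw [← invBranch_append]
  exact invBranch_mem_cylinder (fun a ha => (List.mem_append.1 ha).elim (hl a) (hk a)) hz

/-- Every point of `badSet A` has a word of digits of each length. -/
theorem exists_mem_words_mem_cylinder {A : Finset ℕ} {x : ℝ} (hx : x ∈ badSet A) (n : ℕ) :
    ∃ l ∈ words A n, x ∈ cylinder l := by
  induction n generalizing x with
  | zero => exact ⟨[], by simp [words], mem_cylinder_nil.2 hx.1⟩
  | succ n ih =>
    rw [mem_badSet] at hx
    obtain ⟨l, hl, hxl⟩ := ih hx.2.2
    refine ⟨cfDigit1 x :: l, ?_, mem_cylinder_cons.2 ⟨hx.1, rfl, hxl⟩⟩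
    rw [mem_words] at *
    simpa [hl.1] using ⟨hx.2.1, hl.2⟩

theorem eq_of_mem_cylinder {l k : List ℕ} (h : l.length = k.length) {x : ℝ} (hl : x ∈ cylinder l)
    (hk : x ∈ cylinder k) : l = k :=
  List.ext_get h fun i h1 h2 => (hl.2 ⟨i, h1⟩).symm.trans (hk.2 ⟨i, h2⟩)

theorem mem_of_mem_cylinder {A : Finset ℕ} {l : List ℕ} {x : ℝ} (hx : x ∈ badSet A)
    (hl : x ∈ cylinder l) : ∀ a ∈ l, a ∈ A := by
  obtain ⟨k, hk, hxk⟩ := exists_mem_words_mem_cylinder hx l.length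
  rw [mem_words] at hk
  rw [eq_of_mem_cylinder hk.1.symm hl hxk]
  exact hk.2

theorem measurable_gaussMap : Measurable gaussMap := measurable_inv.fract

theorem measurable_cfDigit1 : Measurable cfDigit1 := measurable_inv.nat_floor

theorem measurable_cfDigit (i : ℕ) : Measurable (cfDigit i) :=
  measurable_cfDigit1.comp (measurable_gaussMap.iterate i)

theorem measurableSet_gaussSet : MeasurableSet gaussSet :=
  measurableSet_Icc.inter (countable_range ((↑) : ℚ → ℝ)).measurableSet.compl

theorem measurableSet_cylinder (l : List ℕ) : MeasurableSet (cylinder l) := by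
  have : cylinder l = gaussSet ∩ ⋂ i : Fin l.length, cfDigit i.1 ⁻¹' {l.get i} := by
    ext x; simp [_root_.cylinder]
  rw [this]
  exact measurableSet_gaussSet.inter
    (MeasurableSet.iInter fun i => measurable_cfDigit _ (measurableSet_singleton _))

theorem measurableSet_badSet (A : Finset ℕ) : MeasurableSet (badSet A) := by
  have : badSet A = gaussSet ∩ ⋂ i : ℕ, cfDigit i ⁻¹' (A : Set ℕ) := by
    ext x; simp [badSet]
  rw [this]
  exact measurableSet_gaussSet.inter
    (MeasurableSet.iInter fun i => measurable_cfDigit _ A.measurableSet)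

end

section

theorem birkhoff_succ (φ : ℝ → ℝ) (n : ℕ) (x : ℝ) :
    birkhoff φ (n + 1) x = φ x + birkhoff φ n (gaussMap x) := by
  simp only [birkhoff, Finset.sum_range_succ', Function.iterate_succ_apply, Function.iterate_zero_apply]
  ring

/-- The Birkhoff sum of `φ` along the branch `invBranch l`. -/
noncomputable def branchSum (φ : ℝ → ℝ) (l : List ℕ) (y : ℝ) : ℝ := birkhoff φ l.length (invBranch l y)

theorem branchSum_nil (φ : ℝ → ℝ) (y : ℝ) : branchSum φ [] y = 0 := by simp [branchSum, birkhoff]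

theorem branchSum_cons (φ : ℝ → ℝ) (a : ℕ) {l : List ℕ} (hl : ∀ a ∈ l, 1 ≤ a) {y : ℝ}
    (hy : y ∈ gaussSet) :
    branchSum φ (a :: l) y = φ (invBranch (a :: l) y) + branchSum φ l y := by
  have : gaussMap (invBranch (a :: l) y) = invBranch l y :=
    gaussMap_invBranch1 a (invBranch_mem_gaussSet hl hy)
  rw [branchSum, List.length_cons, birkhoff_succ, this, branchSum]

theorem branchSum_append (φ : ℝ → ℝ) {l k : List ℕ} (hl : ∀ a ∈ l, 1 ≤ a) (hk : ∀ a ∈ k, 1 ≤ a)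
    {y : ℝ} (hy : y ∈ gaussSet) :
    branchSum φ (l ++ k) y = branchSum φ l (invBranch k y) + branchSum φ k y := by
  induction l with
  | nil => simp [branchSum_nil]
  | cons a l ih =>
    have hl' : ∀ x ∈ l, 1 ≤ x := fun x hx => hl x (by simp [hx])
    rw [List.cons_append, branchSum_cons φ a hl' (invBranch_mem_gaussSet hk hy),
      branchSum_cons φ a (fun x hx => (List.mem_append.1 hx).elim (hl' x) (hk x)) hy, ih hl',
      ← List.cons_append, invBranch_append]
    ring

theorem mem_cylinder_concat {l : List ℕ} {a : ℕ} {x : ℝ} :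
    x ∈ cylinder (l ++ [a]) ↔ x ∈ cylinder l ∧ cfDigit l.length x = a := by
  induction l generalizing x with
  | nil =>
    rw [List.nil_append, mem_cylinder_cons, mem_cylinder_nil, mem_cylinder_nil]
    exact ⟨fun h => ⟨h.1, h.2.1⟩, fun h => ⟨h.1, h.2, gaussMap_mem_gaussSet h.1⟩⟩
  | cons b l ih =>
    rw [List.cons_append, mem_cylinder_cons, ih, mem_cylinder_cons, and_assoc, and_assoc]
    rfl

theorem sum_measureReal_inter_preimage {μ : Measure ℝ} [IsFiniteMeasure μ] {A : Finset ℕ}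
    {g : ℝ → ℕ} (hg : Measurable g) (h : ∀ᵐ x ∂μ, g x ∈ A) {s : Set ℝ} (hs : MeasurableSet s) :
    ∑ a ∈ A, μ.real (s ∩ g ⁻¹' {a}) = μ.real s := by
  rw [← measureReal_biUnion_finset]
  · refine measureReal_congr ?_
    filter_upwards [h] with x hx
    refine propext ?_
    change x ∈ (⋃ a ∈ A, s ∩ g ⁻¹' {a}) ↔ x ∈ s
    simp only [mem_iUnion, mem_inter_iff, mem_preimage, mem_singleton_iff, exists_prop]
    exact ⟨fun ⟨_, _, h, _⟩ => h, fun h => ⟨_, hx, h, rfl⟩⟩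
  · intro a _ b _ hab
    refine Set.disjoint_left.2 fun x hx hx' => hab ?_
    exact hx.2.symm.trans hx'.2
  · exact fun a _ => hs.inter (hg (measurableSet_singleton a))

section Gibbs

variable {A : Finset ℕ} {φ : ℝ → ℝ} {μ : Measure ℝ} [IsProbabilityMeasure μ]

theorem ae_mem_badSet (hμ : μ (badSet A) = 1) : ∀ᵐ x ∂μ, x ∈ badSet A :=
  (prob_compl_eq_zero_iff (measurableSet_badSet A)).2 hμ

theorem sum_measureReal_cylinder_concat (hμ : μ (badSet A) = 1) (l : List ℕ) :
    ∑ a ∈ A, μ.real (cylinder (l ++ [a])) = μ.real (cylinder l) := by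
  rw [← sum_measureReal_inter_preimage (measurable_cfDigit l.length)
    ((ae_mem_badSet hμ).mono fun x hx => hx.2 l.length) (measurableSet_cylinder l)]
  refine Finset.sum_congr rfl fun a _ => congrArg _ ?_
  ext x
  exact mem_cylinder_concat

theorem sum_measureReal_cylinder_cons (hμ : μ (badSet A) = 1) (hinv : GaussInvariant μ)
    (l : List ℕ) : ∑ a ∈ A, μ.real (cylinder (a :: l)) = μ.real (cylinder l) := by
  have h1 : μ.real (cylinder l) = μ.real (gaussMap ⁻¹' cylinder l) := by
    rw [measureReal_def, measureReal_def, hinv _ (measurableSet_cylinder l)]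
  rw [h1, ← sum_measureReal_inter_preimage measurable_cfDigit1
    ((ae_mem_badSet hμ).mono fun x hx => hx.2 0) (measurable_gaussMap (measurableSet_cylinder l))]
  refine Finset.sum_congr rfl fun a _ => measureReal_congr ?_
  filter_upwards [ae_mem_badSet hμ] with x hx
  refine propext ?_
  change x ∈ cylinder (a :: l) ↔ _
  rw [mem_cylinder_cons]
  exact ⟨fun h => ⟨h.2.2, h.2.1⟩, fun h => ⟨hx.1, h.2, h.1⟩⟩

theorem measureReal_cylinder_nil (hμ : μ (badSet A) = 1) : μ.real (cylinder []) = 1 := by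
  have : μ (cylinder []) = 1 := by
    refine (prob_compl_eq_zero_iff (measurableSet_cylinder [])).1 ?_
    exact (ae_mem_badSet hμ).mono fun x hx => mem_cylinder_nil.2 hx.1
  simp [measureReal_def, this]

theorem gibbs_bounds (hμ : μ (badSet A) = 1) {C : ℝ} (hC : 1 ≤ C)
    (hG : ∀ l : List ℕ, l ≠ [] → (∀ a ∈ l, a ∈ A) → ∀ x ∈ badSet A,
      C⁻¹ * Real.exp (branchSum φ l x) ≤ μ.real (cylinder l) ∧
        μ.real (cylinder l) ≤ C * Real.exp (branchSum φ l x))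
    {l : List ℕ} (hl : ∀ a ∈ l, a ∈ A) {x : ℝ} (hx : x ∈ badSet A) :
    Real.exp (branchSum φ l x) ≤ C * μ.real (cylinder l) ∧
      μ.real (cylinder l) ≤ C * Real.exp (branchSum φ l x) := by
  by_cases h : l = []
  · subst h
    rw [measureReal_cylinder_nil hμ, branchSum_nil]
    simp [hC]
  · have := hG l h hl x hx
    rwa [inv_mul_le_iff₀ (by linarith)] at this

theorem abs_branchSum_sub_le (hA : ∀ a ∈ A, 1 ≤ a) {H θ : ℝ} (hH : 0 ≤ H) (hθ : 0 ≤ θ)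
    (hθ1 : θ < 1)
    (hφ : ∀ l : List ℕ, l ≠ [] → (∀ a ∈ l, a ∈ A) → ∀ x ∈ cylinder l ∩ badSet A,
      ∀ y ∈ cylinder l ∩ badSet A, |φ x - φ y| ≤ H * θ ^ l.length)
    {l c : List ℕ} (hl : ∀ a ∈ l, a ∈ A) (hc : ∀ a ∈ c, a ∈ A) {x y : ℝ}
    (hx : x ∈ cylinder c ∩ badSet A) (hy : y ∈ cylinder c ∩ badSet A) :
    |branchSum φ l x - branchSum φ l y| ≤ H * θ ^ c.length / (1 - θ) := by
  have key : |branchSum φ l x - branchSum φ l y| ≤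
      H * θ ^ c.length * ∑ i ∈ Finset.range l.length, θ ^ i := by
    induction l with
    | nil => simp [branchSum_nil]
    | cons a l ih =>
      have hl' : ∀ x ∈ l, x ∈ A := fun x hx => hl x (by simp [hx])
      rw [branchSum_cons φ a (fun b hb => hA b (hl' b hb)) hx.2.1,
        branchSum_cons φ a (fun b hb => hA b (hl' b hb)) hy.2.1, List.length_cons,
        Finset.sum_range_succ, mul_add]
      have hm : ∀ b ∈ (a :: l) ++ c, b ∈ A := fun b hb => (List.mem_append.1 hb).elim (hl b) (hc b)
      have h1 : ∀ z ∈ cylinder c ∩ badSet A, invBranch (a :: l) z ∈ cylinder ((a :: l) ++ c) ∩ badSet A :=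
        fun z hz => ⟨cylinder_append (fun b hb => hA b (hl b hb)) (fun b hb => hA b (hc b hb)) hz.1,
          invBranch_mem_badSet hA hl hz.2⟩
      have h2 := hφ _ (by simp) hm _ (h1 x hx) _ (h1 y hy)
      have h3 : H * θ ^ ((a :: l) ++ c).length ≤ H * θ ^ c.length * θ ^ l.length := by
        rw [mul_assoc, ← pow_add]
        refine mul_le_mul_of_nonneg_left (pow_le_pow_of_le_one hθ hθ1.le ?_) hH
        simp only [List.length_append, List.length_cons]
        omega
      have h4 := ih hl'
      rw [abs_le] at *
      constructor <;> linarith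
  refine key.trans ?_
  rw [div_eq_mul_inv]
  refine mul_le_mul_of_nonneg_left ?_ (by positivity)
  rw [← tsum_geometric_of_lt_one hθ hθ1]
  exact (summable_geometric_of_lt_one hθ hθ1).sum_le_tsum _ fun i _ => by positivity

theorem abs_exp_sub_exp_le {u v t : ℝ} (h : |u - v| ≤ t) :
    |Real.exp u - Real.exp v| ≤ Real.exp v * (t * Real.exp t) := by
  have h1 : Real.exp u - Real.exp v = Real.exp v * (Real.exp (u - v) - 1) := by
    rw [mul_sub, ← Real.exp_add]; ring_nf
  rw [h1, abs_mul, abs_of_pos (Real.exp_pos v)]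
  refine mul_le_mul_of_nonneg_left ?_ (Real.exp_pos v).le
  have ht : 0 ≤ t := (abs_nonneg _).trans h
  rw [abs_le] at h ⊢
  have e1 := Real.add_one_le_exp (u - v)
  have e2 := Real.add_one_le_exp t
  have e3 := Real.add_one_le_exp (-t)
  have e4 : Real.exp (u - v) ≤ Real.exp t := Real.exp_le_exp.2 h.2
  have e5 : Real.exp t * Real.exp (-t) = 1 := by rw [← Real.exp_add]; simp
  have e6 := mul_le_mul_of_nonneg_left e3 (Real.exp_pos t).le
  have e7 := mul_le_mul_of_nonneg_left e2 ht
  constructor <;> nlinarith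

/-- Cylinder measures and branch weights of a Gibbs measure form a system of Gibbs weights. -/
theorem exists_gibbsWeights (hA : ∀ a ∈ A, 1 ≤ a) (hμ : μ (badSet A) = 1) (hinv : GaussInvariant μ)
    (hφ : LocHolderOn A φ) (hG : IsGibbsOn A φ μ) {x₀ : ℝ} (hx₀ : x₀ ∈ badSet A) :
    ∃ C θ, GibbsWeights A (fun l => μ.real (cylinder l)) (fun l => Real.exp (branchSum φ l x₀)) C θ := by
  obtain ⟨C, hC, hG⟩ := hG
  obtain ⟨H, hH, θ, hθ, hφ⟩ := hφ
  have hG' := fun (l : List ℕ) (hl : ∀ a ∈ l, a ∈ A) (x : ℝ) (hx : x ∈ badSet A) =>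
    gibbs_bounds (φ := φ) hμ hC hG hl hx
  have hA' : ∀ l : List ℕ, (∀ a ∈ l, a ∈ A) → ∀ a ∈ l, 1 ≤ a := fun l hl a ha => hA a (hl a ha)
  have happ : ∀ l k : List ℕ, (∀ a ∈ l, a ∈ A) → (∀ a ∈ k, a ∈ A) → ∀ a ∈ l ++ k, a ∈ A :=
    fun l k hl hk a ha => (List.mem_append.1 ha).elim (hl a) (hk a)
  have hC0 : 0 < C := by linarith
  set E : ℝ := H / (1 - θ) with hE
  have hE0 : 0 < E := div_pos hH (by linarith [hθ.2])
  have hC3 : C ≤ C ^ 3 := le_self_pow₀ hC (by norm_num)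
  have hD0 : 0 ≤ C * (E * Real.exp E) := by positivity
  have hpos : ∀ l : List ℕ, (∀ a ∈ l, a ∈ A) → 0 < μ.real (cylinder l) := fun l hl => by
    have := (hG' l hl x₀ hx₀).1
    exact pos_of_mul_pos_right ((Real.exp_pos _).trans_le this) hC0.le
  have hwapp : ∀ l k : List ℕ, (∀ a ∈ l, a ∈ A) → (∀ a ∈ k, a ∈ A) →
      Real.exp (branchSum φ (l ++ k) x₀) =
        Real.exp (branchSum φ l (invBranch k x₀)) * Real.exp (branchSum φ k x₀) := fun l k hl hk => by
    rw [branchSum_append φ (hA' l hl) (hA' k hk) hx₀.1, Real.exp_add]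
  refine ⟨C ^ 3 + C * (E * Real.exp E), θ,
    { one_le := ?_, pos := hpos, nil := measureReal_cylinder_nil hμ,
      sum_append := fun l _ => sum_measureReal_cylinder_concat hμ l,
      sum_cons := fun l _ => sum_measureReal_cylinder_cons hμ hinv l,
      le_mul := ?_, mul_le := ?_, weight_pos := fun l _ => Real.exp_pos _,
      weight_le := ?_, le_weight := ?_,
      theta_pos := hθ.1, theta_lt_one := hθ.2, distortion := ?_ }⟩
  · linarith
  · intro l k hl hk
    have hTk := invBranch_mem_badSet hA hk hx₀
    have hPl := hpos l hl
    have hPk := hpos k hk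
    calc μ.real (cylinder (l ++ k)) ≤ C * Real.exp (branchSum φ (l ++ k) x₀) :=
          (hG' _ (happ l k hl hk) x₀ hx₀).2
      _ = C * (Real.exp (branchSum φ l (invBranch k x₀)) * Real.exp (branchSum φ k x₀)) := by
          rw [hwapp l k hl hk]
      _ ≤ C * ((C * μ.real (cylinder l)) * (C * μ.real (cylinder k))) := by
          gcongr
          · exact (hG' l hl _ hTk).1
          · exact (hG' k hk _ hx₀).1
      _ = C ^ 3 * (μ.real (cylinder l) * μ.real (cylinder k)) := by ring
      _ ≤ _ := by gcongr; linarith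
  · intro l k hl hk
    have hTk := invBranch_mem_badSet hA hk hx₀
    have hPlk := hpos _ (happ l k hl hk)
    calc μ.real (cylinder l) * μ.real (cylinder k)
        ≤ (C * Real.exp (branchSum φ l (invBranch k x₀))) * (C * Real.exp (branchSum φ k x₀)) := by
          gcongr
          · exact (hG' l hl _ hTk).2
          · exact (hG' k hk _ hx₀).2
      _ = C ^ 2 * Real.exp (branchSum φ (l ++ k) x₀) := by rw [hwapp l k hl hk]; ring
      _ ≤ C ^ 2 * (C * μ.real (cylinder (l ++ k))) := by
          gcongr; exact (hG' _ (happ l k hl hk) x₀ hx₀).1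
      _ = C ^ 3 * μ.real (cylinder (l ++ k)) := by ring
      _ ≤ _ := by gcongr; linarith
  · intro l hl
    have := hpos l hl
    exact ((hG' l hl x₀ hx₀).1).trans (by gcongr; linarith)
  · intro l hl
    exact ((hG' l hl x₀ hx₀).2).trans (by gcongr; linarith)
  · intro l c b hl hc hb _
    rw [hwapp l (c ++ b) hl (happ c b hc hb), hwapp l c hl hc,
      mul_div_cancel_right₀ _ (Real.exp_ne_zero _), mul_div_cancel_right₀ _ (Real.exp_ne_zero _)]
    have hTc : invBranch c x₀ ∈ cylinder c ∩ badSet A :=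
      (mem_cylinder_inter_badSet hA hc).2 ⟨x₀, hx₀, rfl⟩
    have hTcb : invBranch (c ++ b) x₀ ∈ cylinder c ∩ badSet A := by
      rw [invBranch_append]
      exact (mem_cylinder_inter_badSet hA hc).2 ⟨_, invBranch_mem_badSet hA hb hx₀, rfl⟩
    have h1 := abs_branchSum_sub_le hA hH.le hθ.1.le hθ.2 hφ hl hc hTcb hTc
    have h2 : H * θ ^ c.length / (1 - θ) = E * θ ^ c.length := by rw [hE]; ring
    rw [h2] at h1
    have hθc : θ ^ c.length ≤ 1 := pow_le_one₀ hθ.1.le hθ.2.le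
    have hθc0 : 0 < θ ^ c.length := pow_pos hθ.1 _
    have hPl := hpos l hl
    calc _ ≤ Real.exp (branchSum φ l (invBranch c x₀)) *
          (E * θ ^ c.length * Real.exp (E * θ ^ c.length)) := abs_exp_sub_exp_le h1
      _ ≤ (C * μ.real (cylinder l)) * (E * θ ^ c.length * Real.exp E) := by
          gcongr
          · exact (hG' l hl _ hTc.2).1
          · nlinarith
      _ = C * (E * Real.exp E) * θ ^ c.length * μ.real (cylinder l) := by ring
      _ ≤ _ := by gcongr; nlinarith [pow_pos hC0 3]

end Gibbs

end

section

theorem logAbsDerivGauss_eq (x : ℝ) : logAbsDerivGauss x = 2 * Real.log x⁻¹ := by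
  rw [logAbsDerivGauss, one_div, Real.log_inv, Real.log_inv, Real.log_pow]
  push_cast; ring

theorem aff_concat (l : List ℕ) {a : ℕ} {y : ℝ} (hy : 0 < y + a) :
    aff (l ++ [a]) y = aff l (invBranch [a] y) * (y + a) := by
  simp only [aff, den_concat, den'_concat, invBranch_cons, invBranch_nil]
  push_cast
  field_simp
  ring

theorem branchSum_logAbsDerivGauss {l : List ℕ} (hl : ∀ a ∈ l, 1 ≤ a) {y : ℝ} (hy : y ∈ gaussSet) :
    branchSum logAbsDerivGauss l y = 2 * Real.log (aff l y) := by
  induction l using List.reverseRecOn generalizing y with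
  | nil => simp [branchSum_nil, aff]
  | append_singleton l a ih =>
    rw [forall_mem_concat] at hl
    have ha : ∀ b ∈ [a], 1 ≤ b := by simpa using hl.2
    have hya : 0 < y + a := add_pos_of_pos_of_nonneg (mem_Ioo_of_mem_gaussSet hy).1 (by positivity)
    have hTy := invBranch_mem_gaussSet ha hy
    rw [branchSum_append _ hl.1 ha hy, ih hl.1 hTy,
      branchSum_cons _ a (l := []) (by simp) hy, branchSum_nil, logAbsDerivGauss_eq,
      aff_concat l hya, Real.log_mul (aff_pos hl.1 (mem_Ioo_of_mem_gaussSet hTy).1.le).ne' hya.ne',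
      invBranch_cons, invBranch_nil, inv_inv]
    ring

/-- An almost additive observable on words has linear growth. -/
theorem abs_le_of_almostAdditive {A : Finset ℕ} {D : List ℕ → ℝ} {C : ℝ} (h0 : D [] = 0)
    (hD : ∀ n m, ∀ a ∈ words A n, ∀ b ∈ words A m, |D (a ++ b) - D a - D b| ≤ C) (n : ℕ)
    {l : List ℕ} (hl : l ∈ words A n) : |D l| ≤ (C + ∑ a ∈ A, |D [a]|) * n := by
  induction n generalizing l with
  | zero =>
    rw [mem_words, List.length_eq_zero_iff] at hl
    rw [hl.1, h0]; simp
  | succ n ih =>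
    cases l with
    | nil => simp [mem_words] at hl
    | cons a l =>
      rw [mem_words] at hl
      have ha : a ∈ A := hl.2 a (by simp)
      have hl' : l ∈ words A n := mem_words.2 ⟨by simpa using hl.1, fun x hx => hl.2 x (by simp [hx])⟩
      have h1 := hD 1 n [a] (mem_words.2 (by simp [ha])) l hl'
      have h2 := ih hl'
      have h3 : |D [a]| ≤ ∑ a ∈ A, |D [a]| :=
        Finset.single_le_sum (f := fun a => |D [a]|) (fun _ _ => abs_nonneg _) ha
      rw [List.singleton_append] at h1
      push_cast
      rw [mul_add, mul_one]
      rw [abs_le] at h1 h2 ⊢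
      have h4 := neg_abs_le (D [a])
      have h5 := le_abs_self (D [a])
      constructor <;> linarith

theorem measurePreserving_gaussMap {μ : Measure ℝ} (hinv : GaussInvariant μ) : MeasurePreserving gaussMap μ μ :=
  ⟨measurable_gaussMap, Measure.ext fun s hs => by
    rw [Measure.map_apply measurable_gaussMap hs, hinv s hs]⟩

theorem integrable_birkhoff {μ : Measure ℝ} (hinv : GaussInvariant μ) {f : ℝ → ℝ} (hf : Integrable f μ) (n : ℕ) :
    Integrable (birkhoff f n) μ ∧ ∫ x, birkhoff f n x ∂μ = n * ∫ x, f x ∂μ := by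
  have hk : ∀ k ∈ Finset.range n, Integrable (fun x => f (gaussMap^[k] x)) μ := fun k _ =>
    ((measurePreserving_gaussMap hinv).iterate k).integrable_comp_of_integrable hf
  refine ⟨integrable_finsetSum _ hk, ?_⟩
  simp only [birkhoff]
  rw [integral_finsetSum _ hk]
  have : ∀ k ∈ Finset.range n, ∫ x, f (gaussMap^[k] x) ∂μ = ∫ x, f x ∂μ := fun k _ => by
    have hp := (measurePreserving_gaussMap hinv).iterate k
    conv_rhs => rw [← hp.map_eq]
    rw [integral_map hp.measurable.aemeasurable (by rw [hp.map_eq]; exact hf.aestronglyMeasurable)]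
  rw [Finset.sum_congr rfl this]
  simp

section Gibbs

variable {A : Finset ℕ} {μ : Measure ℝ} [IsProbabilityMeasure μ]

theorem abs_integral_sub_sum_le (hμ : μ (badSet A) = 1) (n : ℕ) {g : ℝ → ℝ} (hg : Integrable g μ)
    {v : List ℕ → ℝ} {ε : ℝ}
    (h : ∀ a ∈ words A n, ∀ x ∈ cylinder a ∩ badSet A, |g x - v a| ≤ ε) :
    |∫ x, g x ∂μ - ∑ a ∈ words A n, μ.real (cylinder a) * v a| ≤ ε := by
  have hint : ∀ a ∈ words A n, Integrable ((cylinder a).indicator fun _ => v a) μ :=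
    fun a _ => (integrable_const (v a)).indicator (measurableSet_cylinder a)
  have h1 : ∑ a ∈ words A n, μ.real (cylinder a) * v a =
      ∫ x, ∑ a ∈ words A n, (cylinder a).indicator (fun _ => v a) x ∂μ := by
    rw [integral_finsetSum _ hint]
    refine Finset.sum_congr rfl fun a _ => ?_
    rw [integral_indicator_const _ (measurableSet_cylinder a), smul_eq_mul]
  rw [h1, ← integral_sub hg (integrable_finsetSum _ hint), ← Real.norm_eq_abs]
  refine (norm_integral_le_of_norm_le_const (C := ε) ?_).trans (by simp)
  filter_upwards [ae_mem_badSet hμ] with x hx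
  obtain ⟨a, ha, hxa⟩ := exists_mem_words_mem_cylinder hx n
  rw [Finset.sum_eq_single a, indicator_of_mem hxa]
  · exact h a ha x ⟨hxa, hx⟩
  · intro b hb hba
    refine indicator_of_notMem (fun hxb => hba ?_) _
    exact eq_of_mem_cylinder ((mem_words.1 hb).1.trans (mem_words.1 ha).1.symm) hxb hxa
  · exact fun h => absurd ha h

theorem ae_logAbsDerivGauss_mem_Icc (hμ : μ (badSet A) = 1) {K : ℕ} (hAK : ∀ a ∈ A, a + 1 ≤ K) :
    ∀ᵐ x ∂μ, logAbsDerivGauss x ∈ Icc 0 (2 * Real.log K) := by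
  filter_upwards [ae_mem_badSet hμ] with x hx
  rw [logAbsDerivGauss_eq]
  have h1 := one_lt_inv_of_mem_gaussSet hx.1
  have h2 : x⁻¹ ≤ K := by
    have h3 : ((cfDigit1 x + 1 : ℕ) : ℝ) ≤ K := by exact_mod_cast hAK _ (hx.2 0)
    have h4 := gaussMap_add_cfDigit1 hx.1
    have h5 := (mem_Ioo_of_mem_gaussSet (gaussMap_mem_gaussSet hx.1)).2
    push_cast at h3
    linarith
  constructor
  · have := Real.log_nonneg h1.le
    linarith
  · have := Real.log_le_log (by linarith) h2
    linarith

theorem integrable_logAbsDerivGauss (hμ : μ (badSet A) = 1) {K : ℕ} (hAK : ∀ a ∈ A, a + 1 ≤ K) :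
    Integrable logAbsDerivGauss μ := by
  refine Integrable.of_mem_Icc 0 (2 * Real.log K) ?_ (ae_logAbsDerivGauss_mem_Icc hμ hAK)
  exact (Real.measurable_log.comp ((measurable_id.pow_const 2).const_div 1)).aemeasurable

theorem lyapunov_nonneg (hμ : μ (badSet A) = 1) {K : ℕ} (hAK : ∀ a ∈ A, a + 1 ≤ K) :
    0 ≤ lyapunov μ :=
  integral_nonneg_of_ae ((ae_logAbsDerivGauss_mem_Icc hμ hAK).mono fun _ hx => hx.1)

theorem tendsto_mean_log_den (hA : ∀ a ∈ A, 1 ≤ a) (hμ : μ (badSet A) = 1) (hinv : GaussInvariant μ)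
    {K : ℕ} (hAK : ∀ a ∈ A, a + 1 ≤ K) :
    Tendsto (QuasiBernoulli.mean A (fun l => μ.real (cylinder l)) fun l => Real.log (den l)) atTop
      (𝓝 (lyapunov μ / 2)) := by
  have key : ∀ n : ℕ, |(n : ℝ) * lyapunov μ -
      2 * ∑ a ∈ words A n, μ.real (cylinder a) * Real.log (den a)| ≤ 2 * Real.log 2 := fun n => by
    have hi := integrable_birkhoff hinv (integrable_logAbsDerivGauss hμ hAK) n
    have h := abs_integral_sub_sum_le hμ n hi.1 (v := fun a => 2 * Real.log (den a))
      (ε := 2 * Real.log 2) ?_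
    · rw [hi.2] at h
      have e : 2 * ∑ a ∈ words A n, μ.real (cylinder a) * Real.log (den a) =
          ∑ a ∈ words A n, μ.real (cylinder a) * (2 * Real.log (den a)) := by
        rw [Finset.mul_sum]
        exact Finset.sum_congr rfl fun a _ => by ring
      rw [e]
      exact h
    · intro a ha x hx
      rw [mem_words] at ha
      have ha1 : ∀ b ∈ a, 1 ≤ b := fun b hb => hA b (ha.2 b hb)
      obtain ⟨y, hy, rfl⟩ := (mem_cylinder_inter_badSet hA ha.2).1 hx
      have h1 : birkhoff logAbsDerivGauss n (invBranch a y) = 2 * Real.log (aff a y) := by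
        rw [← branchSum_logAbsDerivGauss ha1 hy.1, branchSum, ha.1]
      have hy' := mem_Ioo_of_mem_gaussSet hy.1
      have hd : (0 : ℝ) < den a := by exact_mod_cast den_pos ha1
      have h2 := Real.log_le_log hd (den_le_aff a hy'.1.le)
      have h3 := Real.log_le_log (aff_pos ha1 hy'.1.le) (aff_le ha1 hy'.2.le)
      rw [Real.log_mul two_ne_zero hd.ne'] at h3
      rw [h1, abs_le]
      have h4 := Real.log_nonneg (one_le_two (α := ℝ))
      constructor <;> linarith
  have hlim : Tendsto (fun n : ℕ => Real.log 2 / (n : ℝ)) atTop (𝓝 0) :=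
    tendsto_const_div_atTop_nhds_zero_nat _
  rw [tendsto_iff_dist_tendsto_zero]
  refine squeeze_zero' (Eventually.of_forall fun _ => dist_nonneg) ?_ hlim
  filter_upwards [eventually_gt_atTop 0] with n hn
  have hn' : (0 : ℝ) < n := by exact_mod_cast hn
  have h := key n
  rw [Real.dist_eq, QuasiBernoulli.mean, abs_le]
  rw [abs_le] at h
  set S := ∑ a ∈ words A n, μ.real (cylinder a) * Real.log (den a)
  have e1 : S / n - lyapunov μ / 2 = (2 * S - n * lyapunov μ) / (2 * n) := by field_simp
  have e2 : Real.log 2 / n = (2 * Real.log 2) / (2 * n) := by field_simp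
  rw [e1, e2, ← neg_div]
  constructor <;> gcongr <;> linarith

theorem tsum_word_negMulLog (hμ : μ (badSet A) = 1) (hA : ∀ a ∈ A, 1 ≤ a) (n : ℕ) :
    ∑' l : Word n, Real.negMulLog (μ (cylinder l.1)).toReal =
      ∑ l ∈ words A n, μ.real (cylinder l) * -Real.log (μ.real (cylinder l)) := by
  have h1 := tsum_subtype {l : List ℕ | l.length = n ∧ ∀ a ∈ l, 0 < a}
    (fun l => Real.negMulLog (μ (cylinder l)).toReal)
  refine h1.trans ?_
  rw [tsum_eq_sum (s := words A n)]
  · refine Finset.sum_congr rfl fun l hl => ?_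
    rw [mem_words] at hl
    rw [indicator_of_mem (show l ∈ {l : List ℕ | l.length = n ∧ ∀ a ∈ l, 0 < a} from
      ⟨hl.1, fun a ha => hA a (hl.2 a ha)⟩), Real.negMulLog, measureReal_def]
    ring
  · intro l hl
    by_cases h : l ∈ {l : List ℕ | l.length = n ∧ ∀ a ∈ l, 0 < a}
    · rw [indicator_of_mem h]
      have : μ (cylinder l) = 0 := by
        refine measure_eq_zero_iff_ae_notMem.2 ?_
        filter_upwards [ae_mem_badSet hμ] with x hx hxl
        exact hl (mem_words.2 ⟨h.1, mem_of_mem_cylinder hx hxl⟩)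
      simp [this]
    · exact indicator_of_notMem h _

/-- Decay of the exponential sums attached to a Gibbs measure of dimension larger than `1/2`. -/
theorem exists_norm_trigSum_branchSum_le (hA : ∀ a ∈ A, 1 ≤ a) (hμ : μ (badSet A) = 1)
    (hinv : GaussInvariant μ) {W : List ℕ → ℝ} {C θ : ℝ}
    (hW : GibbsWeights A (fun l => μ.real (cylinder l)) W C θ)
    {h : ℝ} (hent : HasEntropy μ h) (hdim : 1 / 2 < h / lyapunov μ)
    {x₀ : ℝ} (hx₀ : x₀ ∈ Icc (0 : ℝ) 1) :
    ∃ c σ : ℝ, 0 < c ∧ 0 < σ ∧ ∀ ξ, 1 ≤ ξ → ∃ m₀, ∀ m ≥ m₀,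
      ‖trigSum (words A m) W ξ x₀‖ ≤ c * ξ ^ (-σ) := by
  obtain ⟨K, hK2, hKA, hAK⟩ : ∃ K : ℕ, 2 ≤ K ∧ A.card ≤ K ∧ ∀ a ∈ A, a + 1 ≤ K := by
    refine ⟨2 + A.card + ∑ a ∈ A, (a + 1), by omega, by omega, fun a ha => ?_⟩
    have := Finset.single_le_sum (f := fun a => a + 1) (fun _ _ => Nat.zero_le _) ha
    omega
  set lam := lyapunov μ with hlam
  have hlam0 : 0 < lam := by
    refine lt_of_le_of_ne (lyapunov_nonneg hμ hAK) fun h0 => ?_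
    rw [← h0, div_zero] at hdim
    linarith
  have hhl : lam / 2 < h := by
    rw [lt_div_iff₀ hlam0] at hdim
    linarith
  set P : List ℕ → ℝ := fun l => μ.real (cylinder l) with hP
  obtain ⟨δ, hδ0, hδ1, hδ⟩ : ∃ δ : ℝ, 0 < δ ∧ δ ≤ 1 / 2 ∧ (1 + 2 * δ) * (lam / 2) < h := by
    refine ⟨min (1 / 2) ((h - lam / 2) / (2 * lam)),
      lt_min (by norm_num) (div_pos (by linarith) (by linarith)), min_le_left _ _, ?_⟩
    have h1 := min_le_right (1 / 2) ((h - lam / 2) / (2 * lam))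
    rw [le_div_iff₀ (by linarith)] at h1
    linarith
  set D : List ℕ → ℝ := fun l => -Real.log (P l) - (1 + 2 * δ) * Real.log (den l) with hD
  have hCpos : 0 < C := one_pos.trans_le hW.one_le
  have hadd : ∀ n m, ∀ a ∈ words A n, ∀ b ∈ words A m,
      |D (a ++ b) - D a - D b| ≤ Real.log C + 2 * Real.log 2 := by
    intro n m a ha b hb
    rw [mem_words] at ha hb
    have ha1 : ∀ x ∈ a, 1 ≤ x := fun x hx => hA x (ha.2 x hx)
    have hb1 : ∀ x ∈ b, 1 ≤ x := fun x hx => hA x (hb.2 x hx)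
    have hab : ∀ x ∈ a ++ b, x ∈ A := fun x hx => (List.mem_append.1 hx).elim (ha.2 x) (hb.2 x)
    have hpa := hW.pos a ha.2
    have hpb := hW.pos b hb.2
    have hpab := hW.pos _ hab
    have hda : (0 : ℝ) < den a := by exact_mod_cast den_pos ha1
    have hdb : (0 : ℝ) < den b := by exact_mod_cast den_pos hb1
    have hdab : (0 : ℝ) < den (a ++ b) := by exact_mod_cast den_pos fun x hx => hA x (hab x hx)
    have p1 := Real.log_le_log hpab (hW.le_mul a b ha.2 hb.2)
    have p2 := Real.log_le_log (mul_pos hpa hpb) (hW.mul_le a b ha.2 hb.2)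
    rw [Real.log_mul hCpos.ne' (mul_pos hpa hpb).ne', Real.log_mul hpa.ne' hpb.ne'] at p1
    rw [Real.log_mul hCpos.ne' hpab.ne', Real.log_mul hpa.ne' hpb.ne'] at p2
    have d1 : (den a : ℝ) * den b ≤ den (a ++ b) := by exact_mod_cast (den_mul_den_le a b).1
    have d2 : (den (a ++ b) : ℝ) ≤ 2 * (den a * den b) := by exact_mod_cast den_append_le ha1 hb1
    have d1 := Real.log_le_log (mul_pos hda hdb) d1
    have d2 := Real.log_le_log hdab d2
    rw [Real.log_mul hda.ne' hdb.ne'] at d1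
    rw [Real.log_mul two_ne_zero (mul_pos hda hdb).ne', Real.log_mul hda.ne' hdb.ne'] at d2
    have e : D (a ++ b) - D a - D b = -(Real.log (P (a ++ b)) - Real.log (P a) - Real.log (P b)) -
        (1 + 2 * δ) * (Real.log (den (a ++ b)) - Real.log (den a) - Real.log (den b)) := by
      simp only [hD]; ring
    have hl2 := Real.log_nonneg (one_le_two (α := ℝ))
    have q1 := mul_nonneg (by linarith : 0 ≤ 1 + 2 * δ)
      (by linarith : 0 ≤ Real.log (den (a ++ b)) - Real.log (den a) - Real.log (den b))
    have q2 : (1 + 2 * δ) * (Real.log (den (a ++ b)) - Real.log (den a) - Real.log (den b)) ≤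
        2 * Real.log 2 := mul_le_mul (by linarith) (by linarith) (by linarith) (by norm_num)
    rw [e, abs_le]
    constructor <;> linarith
  have hD0 : D [] = 0 := by
    have : P [] = 1 := hW.nil
    simp [hD, this]
  have hmean : Tendsto (QuasiBernoulli.mean A P D) atTop (𝓝 (h - (1 + 2 * δ) * (lam / 2))) := by
    have h1 : Tendsto (QuasiBernoulli.mean A P fun l => -Real.log (P l)) atTop (𝓝 h) := by
      refine hent.congr fun n => ?_
      rw [tsum_word_negMulLog hμ hA, QuasiBernoulli.mean]
    have h2 := (tendsto_mean_log_den hA hμ hinv hAK).const_mul (1 + 2 * δ)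
    refine (h1.sub h2).congr fun n => ?_
    simp only [QuasiBernoulli.mean]
    rw [← mul_div_assoc, ← sub_div, Finset.mul_sum, ← Finset.sum_sub_distrib]
    congr 1
    refine Finset.sum_congr rfl fun a _ => ?_
    simp only [hD, hP]
    ring
  obtain ⟨K₀, η, hK₀, hη, hη1, hp⟩ := hW.exists_sum_nonpos_le hadd
    (fun n a ha => abs_le_of_almostAdditive hD0 hadd n ha) (by linarith) hmean
  refine hW.exists_norm_trigSum_words_le (fun a ha => ⟨hA a ha, hAK a ha⟩) hK2 hKA hδ0 hδ1 hK₀ hη hη1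
    (fun n => ?_) hx₀
  refine le_of_eq_of_le ?_ (hp n)
  refine Finset.sum_congr (Finset.filter_congr fun a _ => ?_) fun _ _ => rfl
  simp only [hD]
  constructor <;> intro h <;> linarith

end Gibbs

end

section

theorem fourier_coe_eq_e (n : ℤ) (x : ℝ) : fourier n (x : UnitAddCircle) = e (n * x) := by
  rw [fourier_coe_apply, e]
  congr 1
  push_cast
  ring

theorem isProbabilityMeasure_volume_unitAddCircle :
    IsProbabilityMeasure (volume : Measure UnitAddCircle) :=
  ⟨UnitAddCircle.measure_univ⟩

theorem integral_fourier_of_ne_zero {n : ℤ} (hn : n ≠ 0) : ∫ x : UnitAddCircle, fourier n x = 0 :=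
  integral_eq_zero_of_add_right_eq_neg (fourier_add_half_inv_index hn one_pos)

theorem norm_sum_div_le {f : ℕ → ℂ} {c : ℝ} (hc : 0 ≤ c) (h : ∀ k, ‖f k‖ ≤ c) (N : ℕ) :
    ‖(∑ k ∈ Finset.range N, f k) / N‖ ≤ c := by
  rw [norm_div, Complex.norm_natCast]
  refine div_le_of_le_mul₀ (Nat.cast_nonneg N) hc ?_
  refine (norm_sum_le_of_le _ fun k _ => h k).trans ?_
  simp [mul_comm]

/-- Weyl's criterion for averages of continuous functions on the circle. -/
theorem tendsto_average_of_weyl {u : ℕ → ℝ}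
    (h : ∀ n : ℤ, n ≠ 0 →
      Tendsto (fun N : ℕ => (∑ k ∈ Finset.range N, e (n * u k)) / (N : ℂ)) atTop (𝓝 0))
    (f : C(UnitAddCircle, ℂ)) :
    Tendsto (fun N : ℕ => (∑ k ∈ Finset.range N, f (u k)) / (N : ℂ)) atTop
      (𝓝 (∫ x : UnitAddCircle, f x)) := by
  have := isProbabilityMeasure_volume_unitAddCircle
  have hint : ∀ g : C(UnitAddCircle, ℂ), Integrable (fun x => g x) (volume : Measure UnitAddCircle) :=
    fun g => g.continuous.integrable_of_hasCompactSupport (HasCompactSupport.of_compactSpace _)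
  have hspan : ∀ g ∈ Submodule.span ℂ (range (fourier (T := (1 : ℝ)))),
      Tendsto (fun N : ℕ => (∑ k ∈ Finset.range N, g (u k)) / (N : ℂ)) atTop
        (𝓝 (∫ x : UnitAddCircle, g x)) := by
    intro g hg
    induction hg using Submodule.span_induction with
    | mem g hg =>
      obtain ⟨n, rfl⟩ := hg
      by_cases hn : n = 0
      · subst hn
        have : ∫ x : UnitAddCircle, fourier 0 x = 1 := by
          simp [Measure.real]
        rw [this]
        refine tendsto_const_nhds.congr' ?_
        filter_upwards [eventually_gt_atTop 0] with N hN
        have : (N : ℂ) ≠ 0 := by exact_mod_cast hN.ne'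
        simp [this]
      · rw [integral_fourier_of_ne_zero hn]
        simpa only [fourier_coe_eq_e] using h n hn
    | zero => simp
    | add f g _ _ hf hg =>
      simp only [ContinuousMap.add_apply]
      rw [integral_add (hint f) (hint g)]
      refine (hf.add hg).congr fun N => ?_
      rw [Finset.sum_add_distrib, add_div]
    | smul c f _ hf =>
      simp only [ContinuousMap.smul_apply, smul_eq_mul]
      rw [integral_const_mul]
      refine (hf.const_mul c).congr fun N => ?_
      rw [← Finset.mul_sum, mul_div_assoc]
  have hdense : f ∈ closure (Submodule.span ℂ (range (fourier (T := (1 : ℝ)))) : Set C(UnitAddCircle, ℂ)) := by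
    rw [← Submodule.topologicalClosure_coe, span_fourier_closure_eq_top]
    trivial
  rw [Metric.tendsto_nhds]
  intro ε hε
  obtain ⟨g, hg, hfg⟩ := Metric.mem_closure_iff.1 hdense (ε / 3) (by positivity)
  have hb : ∀ x, ‖f x - g x‖ ≤ ε / 3 := fun x => by
    rw [← dist_eq_norm]
    exact (ContinuousMap.dist_apply_le_dist x).trans hfg.le
  filter_upwards [Metric.tendsto_nhds.1 (hspan g hg) (ε / 3) (by positivity)] with N hN
  have h1 : ‖(∑ k ∈ Finset.range N, f (u k)) / (N : ℂ) - (∑ k ∈ Finset.range N, g (u k)) / (N : ℂ)‖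
      ≤ ε / 3 := by
    rw [← sub_div, ← Finset.sum_sub_distrib]
    exact norm_sum_div_le (by positivity) (fun k => hb _) N
  have h2 : ‖(∫ x : UnitAddCircle, f x) - ∫ x : UnitAddCircle, g x‖ ≤ ε / 3 := by
    rw [← integral_sub (hint f) (hint g)]
    refine (norm_integral_le_of_norm_le_const (Eventually.of_forall hb)).trans_eq ?_
    rw [Measure.real, UnitAddCircle.measure_univ, ENNReal.toReal_one, mul_one]
  rw [dist_eq_norm] at hN ⊢
  have e1 : (∑ k ∈ Finset.range N, f (u k)) / (N : ℂ) - ∫ x : UnitAddCircle, f x =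
      ((∑ k ∈ Finset.range N, f (u k)) / (N : ℂ) - (∑ k ∈ Finset.range N, g (u k)) / (N : ℂ)) +
      ((∑ k ∈ Finset.range N, g (u k)) / (N : ℂ) - ∫ x : UnitAddCircle, g x) -
      ((∫ x : UnitAddCircle, f x) - ∫ x : UnitAddCircle, g x) := by ring
  rw [e1]
  refine (norm_sub_le _ _).trans_lt ((add_le_add_left (norm_add_le _ _) _).trans_lt ?_)
  linarith

/-- The empirical measure of the first `N + 1` terms of a sequence. -/
noncomputable def empirical {E : Type*} [MeasurableSpace E] (u : ℕ → E) (N : ℕ) :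
    ProbabilityMeasure E :=
  ⟨((N + 1 : ℕ) : ℝ≥0∞)⁻¹ • ∑ k ∈ Finset.range (N + 1), Measure.dirac (u k), ⟨by
    simp only [Measure.smul_apply, Measure.finsetSum_apply, measure_univ, smul_eq_mul,
      Finset.sum_const, Finset.card_range, nsmul_eq_mul, mul_one]
    exact ENNReal.inv_mul_cancel (by positivity) (ENNReal.natCast_ne_top _)⟩⟩

theorem frontier_coe_image_Ico_subset (a b : ℝ) :
    frontier (((↑) : ℝ → UnitAddCircle) '' Ico a b) ⊆ ((↑) : ℝ → UnitAddCircle) '' {a, b} := by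
  have h1 : closure (((↑) : ℝ → UnitAddCircle) '' Ico a b) ⊆ ((↑) : ℝ → UnitAddCircle) '' Icc a b :=
    closure_minimal (image_mono Ico_subset_Icc_self)
      (isCompact_Icc.image (AddCircle.continuous_mk' 1)).isClosed
  have h2 : ((↑) : ℝ → UnitAddCircle) '' Ioo a b ⊆ interior (((↑) : ℝ → UnitAddCircle) '' Ico a b) :=
    interior_maximal (image_mono Ioo_subset_Ico_self)
      (QuotientAddGroup.isOpenMap_coe _ isOpen_Ioo)
  rintro _ ⟨hx, hx'⟩
  obtain ⟨y, hy, rfl⟩ := h1 hx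
  refine ⟨y, ?_, rfl⟩
  by_contra hne
  simp only [mem_insert_iff, mem_singleton_iff, not_or] at hne
  exact hx' (h2 ⟨y, ⟨lt_of_le_of_ne hy.1 (Ne.symm hne.1), lt_of_le_of_ne hy.2 hne.2⟩, rfl⟩)

theorem coe_mem_image_Ico_iff {a b : ℝ} (ha : 0 ≤ a) (hb : b ≤ 1) (x : ℝ) :
    (x : UnitAddCircle) ∈ ((↑) : ℝ → UnitAddCircle) '' Ico a b ↔ Int.fract x ∈ Ico a b := by
  constructor
  · rintro ⟨y, hy, hyx⟩
    have h1 : ((Int.fract x : ℝ) : UnitAddCircle) = x := AddCircle.coe_fract x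
    have h2 : y = Int.fract x :=
      (AddCircle.coe_eq_coe_iff_of_mem_Ico (a := 0) (by simpa using ⟨ha.trans hy.1, hy.2.trans_le hb⟩)
        ⟨Int.fract_nonneg x, by simpa using Int.fract_lt_one x⟩).1 (hyx.trans h1.symm)
    rwa [← h2]
  · intro h
    exact ⟨_, h, AddCircle.coe_fract x⟩

theorem measurableSet_coe_image_Ico (a b : ℝ) :
    MeasurableSet (((↑) : ℝ → UnitAddCircle) '' Ico a b) := by
  rcases lt_or_ge a b with hab | hab
  · rw [← Ioo_insert_left hab, image_insert_eq]
    exact ((QuotientAddGroup.isOpenMap_coe _ isOpen_Ioo).measurableSet).insert _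
  · simp [Ico_eq_empty_of_le hab]

theorem volume_coe_image_Ico {a b : ℝ} (ha : 0 ≤ a) (hb : b ≤ 1) :
    volume (((↑) : ℝ → UnitAddCircle) '' Ico a b) = ENNReal.ofReal (b - a) := by
  have hm := measurableSet_coe_image_Ico a b
  rw [← (UnitAddCircle.measurePreserving_mk 0).measure_preimage hm.nullMeasurableSet, zero_add,
    Measure.restrict_congr_set Ioo_ae_eq_Ioc.symm, Measure.restrict_apply' measurableSet_Ioo]
  have : ((↑) : ℝ → UnitAddCircle) ⁻¹' (((↑) : ℝ → UnitAddCircle) '' Ico a b) ∩ Ioo 0 1 =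
      Ico a b ∩ Ioo 0 1 := by
    ext x
    simp only [mem_inter_iff, mem_preimage, coe_mem_image_Ico_iff ha hb]
    refine and_congr_left fun hx => ?_
    rw [Int.fract_eq_self.2 ⟨hx.1.le, hx.2⟩]
  rw [this, ← Real.volume_Ico]
  refine le_antisymm (measure_mono inter_subset_left) ?_
  rw [measure_congr (Ioo_ae_eq_Ico (μ := volume) (a := a) (b := b)).symm]
  exact measure_mono fun x hx => ⟨Ioo_subset_Ico_self hx, ha.trans_lt hx.1, hx.2.trans_le hb⟩

theorem volume_singleton_unitAddCircle (x : UnitAddCircle) : volume {x} = 0 := by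
  have h0 : volume {(0 : UnitAddCircle)} = 0 := by
    refine le_antisymm (ENNReal.le_of_forall_pos_le_add fun ε hε _ => ?_) (zero_le)
    have h1 : volume {(0 : UnitAddCircle)} ≤ volume (((↑) : ℝ → UnitAddCircle) '' Ico 0 (min ε 1)) :=
      measure_mono (singleton_subset_iff.2 ⟨0, by simpa using hε, rfl⟩)
    rw [volume_coe_image_Ico le_rfl (by simp)] at h1
    refine h1.trans ?_
    rw [zero_add, sub_zero]
    exact (ENNReal.ofReal_le_ofReal (min_le_left _ _)).trans_eq (ENNReal.ofReal_coe_nnreal)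
  have h1 := measure_preimage_add (volume : Measure UnitAddCircle) (-x) {0}
  rw [← h0, ← h1]
  congr 1
  ext y
  simp [eq_comm]

/-- Weyl's criterion. -/
theorem equidistributedMod1_of_weyl {u : ℕ → ℝ}
    (h : ∀ n : ℤ, n ≠ 0 →
      Tendsto (fun N : ℕ => (∑ k ∈ Finset.range N, e (n * u k)) / (N : ℂ)) atTop (𝓝 0)) :
    EquidistributedMod1 u := by
  intro a b ha hab hb
  have := isProbabilityMeasure_volume_unitAddCircle
  set ν : ProbabilityMeasure UnitAddCircle := ⟨volume, inferInstance⟩ with hν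
  have hweak : Tendsto (empirical fun k => (u k : UnitAddCircle)) atTop (𝓝 ν) := by
    rw [ProbabilityMeasure.tendsto_iff_forall_integral_rclike_tendsto ℂ]
    intro f
    have := (tendsto_add_atTop_iff_nat 1).2 (tendsto_average_of_weyl h f.toContinuousMap)
    refine this.congr fun N => ?_
    simp only [empirical, ProbabilityMeasure.coe_mk]
    rw [integral_smul_measure, integral_finsetSum_measure fun _ _ => f.integrable _]
    rw [div_eq_inv_mul, ENNReal.toReal_inv, ENNReal.toReal_natCast, Complex.real_smul]
    simp
  have hfr : (ν : Measure UnitAddCircle) (frontier (((↑) : ℝ → UnitAddCircle) '' Ico a b)) = 0 :=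
    measure_mono_null (frontier_coe_image_Ico_subset a b) (by
      rw [image_pair, insert_eq]
      exact measure_union_null (volume_singleton_unitAddCircle _) (volume_singleton_unitAddCircle _))
  have hlim := ProbabilityMeasure.tendsto_measure_of_null_frontier_of_tendsto' hweak hfr
  have hv : (ν : Measure UnitAddCircle) (((↑) : ℝ → UnitAddCircle) '' Ico a b) = ENNReal.ofReal (b - a) :=
    volume_coe_image_Ico ha hb
  rw [hv] at hlim
  have hlim := (ENNReal.tendsto_toReal ENNReal.ofReal_ne_top).comp hlim
  rw [ENNReal.toReal_ofReal (by linarith)] at hlim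
  rw [← tendsto_add_atTop_iff_nat 1]
  refine hlim.congr fun N => ?_
  simp only [Function.comp, empirical, ProbabilityMeasure.coe_mk, Measure.smul_apply,
    Measure.finsetSum_apply, smul_eq_mul, ENNReal.toReal_mul, ENNReal.toReal_inv,
    ENNReal.toReal_natCast, Measure.dirac_apply' _ (measurableSet_coe_image_Ico a b)]
  rw [div_eq_inv_mul]
  congr 1
  rw [Finset.card_filter, ENNReal.toReal_sum fun k _ => ?_]
  · push_cast
    refine Finset.sum_congr rfl fun k _ => ?_
    rw [indicator_apply]
    simp only [coe_mem_image_Ico_iff ha hb, Pi.one_apply]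
    split_ifs <;> simp
  · rw [indicator_apply]
    split_ifs <;> simp

end

section

theorem sum_rpow_neg_le {σ : ℝ} (h0 : 0 ≤ σ) (h1 : σ ≤ 1 / 2) (n : ℕ) :
    ∑ k ∈ Finset.range n, ((k : ℝ) + 1) ^ (-σ) ≤ 2 * (n : ℝ) ^ (1 - σ) := by
  induction n with
  | zero => simp; positivity
  | succ n ih =>
    rw [Finset.sum_range_succ]
    have hn : (0 : ℝ) < n + 1 := by positivity
    have hb := rpow_one_add_le_one_add_mul_self (s := -(1 / ((n : ℝ) + 1))) (p := 1 - σ)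
      (by rw [neg_le_neg_iff, div_le_one hn]; linarith [n.cast_nonneg (α := ℝ)])
      (by linarith) (by linarith)
    have e1 : 1 + -(1 / ((n : ℝ) + 1)) = n / (n + 1) := by field_simp; ring
    have e2 : ((n : ℝ) + 1) ^ (1 - σ) = (n + 1) * ((n : ℝ) + 1) ^ (-σ) := by
      rw [sub_eq_add_neg, Real.rpow_add hn, Real.rpow_one]
    have hs : 0 < ((n : ℝ) + 1) ^ (-σ) := Real.rpow_pos_of_pos hn _
    rw [e1, Real.div_rpow n.cast_nonneg hn.le, div_le_iff₀ (Real.rpow_pos_of_pos hn _), e2] at hb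
    have e3 : (1 + (1 - σ) * -(1 / ((n : ℝ) + 1))) * ((n + 1) * ((n : ℝ) + 1) ^ (-σ)) =
        (n + σ) * ((n : ℝ) + 1) ^ (-σ) := by field_simp; ring
    rw [e3] at hb
    push_cast
    rw [e2]
    have := mul_le_mul_of_nonneg_right h1 hs.le
    linarith

/-- The exponential sum with frequencies `ν 0, …, ν (N - 1)`. -/
noncomputable def weylSum (ν : ℕ → ℝ) (N : ℕ) (x : ℝ) : ℂ := ∑ i ∈ Finset.range N, e (ν i * x)

theorem continuous_weylSum (ν : ℕ → ℝ) (N : ℕ) : Continuous (weylSum ν N) :=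
  continuous_finsetSum _ fun _ _ => continuous_e.comp (continuous_const.mul continuous_id)

theorem norm_weylSum_le (ν : ℕ → ℝ) (N : ℕ) (x : ℝ) : ‖weylSum ν N x‖ ≤ N :=
  (norm_sum_le_of_le _ fun i _ => (norm_e _).le).trans (by simp)

theorem norm_weylSum_succ_sq (ν : ℕ → ℝ) (N : ℕ) (x : ℝ) :
    ‖weylSum ν (N + 1) x‖ ^ 2 =
      ‖weylSum ν N x‖ ^ 2 + 1 + 2 * (∑ i ∈ Finset.range N, e ((ν N - ν i) * x)).re := by
  rw [weylSum, Finset.sum_range_succ, ← weylSum, ← Complex.normSq_eq_norm_sq, add_comm,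
    Complex.normSq_add, Complex.normSq_eq_norm_sq, Complex.normSq_eq_norm_sq, norm_e, weylSum, map_sum,
    Finset.mul_sum]
  simp only [conj_e, ← e_add]
  rw [show ∑ i ∈ Finset.range N, e (ν N * x + -(ν i * x)) = ∑ i ∈ Finset.range N, e ((ν N - ν i) * x)
    from Finset.sum_congr rfl fun i _ => by ring_nf]
  ring

variable {A : Finset ℕ} {W : List ℕ → ℝ} {C c σ x₀ : ℝ} {ν : ℕ → ℝ}

theorem exists_sum_weight_mul_norm_weylSum_sq_le
    (hW : ∀ n, ∑ a ∈ words A n, W a ≤ C) (hc : 0 ≤ c) (h0 : 0 ≤ σ) (h1 : σ ≤ 1 / 2)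
    (hT : ∀ ξ : ℝ, 1 ≤ ξ → ∃ m₀, ∀ m ≥ m₀, ‖trigSum (words A m) W ξ x₀‖ ≤ c * ξ ^ (-σ))
    (hν : ∀ i j, i ≤ j → ((j - i : ℕ) : ℝ) ≤ ν j - ν i) (N : ℕ) :
    ∃ m₀, ∀ m ≥ m₀, ∑ a ∈ words A m, W a * ‖weylSum ν N (invBranch a x₀)‖ ^ 2 ≤
      N * (C + 4 * c * (N : ℝ) ^ (1 - σ)) := by
  induction N with
  | zero => exact ⟨0, fun m _ => by simp [weylSum]⟩
  | succ N ih =>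
    obtain ⟨m₁, hm₁⟩ := ih
    have hone : ∀ i < N, 1 ≤ ν N - ν i := fun i hi =>
      le_trans (by exact_mod_cast (by omega : 1 ≤ N - i)) (hν i N hi.le)
    choose! M hM using hT
    refine ⟨max m₁ ((Finset.range N).sup fun i => M (ν N - ν i)), fun m hm => ?_⟩
    have hm1 := hm₁ m ((le_max_left _ _).trans hm)
    have hterm : ∀ i ∈ Finset.range N,
        ‖trigSum (words A m) W (ν N - ν i) x₀‖ ≤ c * (((N - 1 - i : ℕ) : ℝ) + 1) ^ (-σ) := fun i hi => by
      have hi' := Finset.mem_range.1 hi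
      have hle : M (ν N - ν i) ≤ m :=
        (Finset.le_sup (f := fun i => M (ν N - ν i)) hi).trans ((le_max_right _ _).trans hm)
      refine (hM _ (hone i hi') m hle).trans (mul_le_mul_of_nonneg_left ?_ hc)
      refine Real.rpow_le_rpow_of_nonpos (by positivity) ?_ (by linarith)
      refine le_trans (le_of_eq ?_) (hν i N hi'.le)
      rw [show N - i = N - 1 - i + 1 by omega]
      push_cast
      ring
    have hsum : ∑ i ∈ Finset.range N, ‖trigSum (words A m) W (ν N - ν i) x₀‖ ≤
        c * (2 * (N : ℝ) ^ (1 - σ)) := by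
      refine (Finset.sum_le_sum hterm).trans ?_
      rw [← Finset.mul_sum, Finset.sum_range_reflect (fun k : ℕ => ((k : ℝ) + 1) ^ (-σ)) N]
      exact mul_le_mul_of_nonneg_left (sum_rpow_neg_le h0 h1 N) hc
    have hcross : ∑ a ∈ words A m,
        W a * (∑ i ∈ Finset.range N, e ((ν N - ν i) * invBranch a x₀)).re ≤
          c * (2 * (N : ℝ) ^ (1 - σ)) := by
      refine le_trans (le_of_eq ?_) ((Complex.re_le_norm _).trans
        ((norm_sum_le (Finset.range N) fun i => trigSum (words A m) W (ν N - ν i) x₀).trans hsum))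
      simp only [trigSum]
      rw [Finset.sum_comm, Complex.re_sum]
      refine Finset.sum_congr rfl fun a _ => ?_
      rw [← Finset.mul_sum, Complex.re_ofReal_mul]
    have hmono : (N : ℝ) ^ (1 - σ) ≤ ((N : ℝ) + 1) ^ (1 - σ) :=
      Real.rpow_le_rpow N.cast_nonneg (by linarith) (by linarith)
    calc _ = ∑ a ∈ words A m, W a * ‖weylSum ν N (invBranch a x₀)‖ ^ 2 + ∑ a ∈ words A m, W a +
          2 * ∑ a ∈ words A m, W a * (∑ i ∈ Finset.range N, e ((ν N - ν i) * invBranch a x₀)).re := by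
          rw [Finset.mul_sum, ← Finset.sum_add_distrib, ← Finset.sum_add_distrib]
          refine Finset.sum_congr rfl fun a _ => ?_
          rw [norm_weylSum_succ_sq]
          ring
      _ ≤ N * (C + 4 * c * (N : ℝ) ^ (1 - σ)) + C + 2 * (c * (2 * (N : ℝ) ^ (1 - σ))) := by
          have := hW m
          gcongr
      _ = (N + 1) * (C + 4 * c * (N : ℝ) ^ (1 - σ)) := by ring
      _ ≤ _ := by push_cast; gcongr

variable {μ : Measure ℝ} [IsProbabilityMeasure μ]

theorem integral_le_of_forall_sum_weight_le (hA : ∀ a ∈ A, 1 ≤ a) (hμ : μ (badSet A) = 1)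
    (hC : 0 ≤ C) (hW : ∀ l : List ℕ, (∀ a ∈ l, a ∈ A) → μ.real (cylinder l) ≤ C * W l)
    (hx₀ : x₀ ∈ Icc (0 : ℝ) 1) {g : ℝ → ℝ} (hg : Continuous g) (hg0 : ∀ x, 0 ≤ g x)
    (hgi : Integrable g μ) {B : ℝ}
    (hB : ∃ m₀, ∀ m ≥ m₀, ∑ a ∈ words A m, W a * g (invBranch a x₀) ≤ B) :
    ∫ x, g x ∂μ ≤ C * B := by
  refine le_of_forall_pos_le_add fun ε hε => ?_
  obtain ⟨m₀, hm₀⟩ := hB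
  obtain ⟨δ, hδ, hgδ⟩ := Metric.uniformContinuousOn_iff.1
    (isCompact_Icc.uniformContinuousOn_of_continuous (hg.continuousOn (s := Icc (0 : ℝ) 1))) ε hε
  obtain ⟨m₁, hm₁⟩ := pow_unbounded_of_one_lt (2 / δ) one_lt_two
  set m := max m₀ m₁
  have h2m : 2 / δ < (2 : ℝ) ^ m :=
    hm₁.trans_le (pow_le_pow_right₀ one_le_two (le_max_right _ _))
  have h := abs_integral_sub_sum_le hμ m hgi (v := fun a => g (invBranch a x₀)) (ε := ε) ?_
  · have h3 : ∑ a ∈ words A m, μ.real (cylinder a) * g (invBranch a x₀) ≤ C * B := by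
      calc _ ≤ ∑ a ∈ words A m, C * W a * g (invBranch a x₀) :=
            Finset.sum_le_sum fun a ha =>
              mul_le_mul_of_nonneg_right (hW a (mem_words.1 ha).2) (hg0 _)
        _ = C * ∑ a ∈ words A m, W a * g (invBranch a x₀) := by
            rw [Finset.mul_sum]; exact Finset.sum_congr rfl fun _ _ => mul_assoc _ _ _
        _ ≤ _ := mul_le_mul_of_nonneg_left (hm₀ m (le_max_left _ _)) hC
    linarith [(abs_le.1 h).2]
  · intro a ha x hx
    have ha1 : ∀ b ∈ a, 1 ≤ b := fun b hb => hA b ((mem_words.1 ha).2 b hb)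
    obtain ⟨y, hy, rfl⟩ := (mem_cylinder_inter_badSet hA (mem_words.1 ha).2).1 hx
    have hyI := Ioo_subset_Icc_self (mem_Ioo_of_mem_gaussSet hy.1)
    have hd : (0 : ℝ) < (den a : ℝ) ^ 2 := by have := den_pos ha1; positivity
    have hlen : (2 : ℝ) ^ m ≤ 2 * (den a : ℝ) ^ 2 := by
      have := two_pow_le_den_sq ha1
      rw [(mem_words.1 ha).1] at this
      exact_mod_cast this
    refine (hgδ _ (invBranch_mem_Icc ha1 hyI) _ (invBranch_mem_Icc ha1 hx₀) ?_).le
    rw [Real.dist_eq]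
    refine (abs_invBranch_sub_le ha1 hyI hx₀).trans_lt ?_
    have h4 : |y - x₀| ≤ 1 := by
      rw [abs_le]; constructor <;> linarith [hyI.1, hyI.2, hx₀.1, hx₀.2]
    rw [div_mul_eq_mul_div, one_mul, div_lt_iff₀ hd]
    rw [div_lt_iff₀ hδ] at h2m
    have h5 := mul_le_mul_of_nonneg_right hlen hδ.le
    linarith

/-- Mean square bound for exponential sums with separated frequencies. -/
theorem exists_integral_norm_weylSum_sq_le (hA : ∀ a ∈ A, 1 ≤ a) (hμ : μ (badSet A) = 1)
    (hinv : GaussInvariant μ) {φ : ℝ → ℝ} (hφ : LocHolderOn A φ) (hG : IsGibbsOn A φ μ)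
    {h : ℝ} (hent : HasEntropy μ h) (hdim : 1 / 2 < h / lyapunov μ) :
    ∃ K σ : ℝ, 0 ≤ K ∧ 0 < σ ∧ ∀ ν : ℕ → ℝ, (∀ i j, i ≤ j → ((j - i : ℕ) : ℝ) ≤ ν j - ν i) →
      ∀ N : ℕ, ∫ x, ‖weylSum ν N x‖ ^ 2 ∂μ ≤ K * (N : ℝ) ^ (2 - σ) := by
  obtain ⟨x₀, hx₀⟩ : (badSet A).Nonempty := by
    rw [nonempty_iff_ne_empty]
    rintro h0
    simp [h0] at hμ
  obtain ⟨C, θ, hW⟩ := exists_gibbsWeights hA hμ hinv hφ hG hx₀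
  have hx₀I := Ioo_subset_Icc_self (mem_Ioo_of_mem_gaussSet hx₀.1)
  obtain ⟨c, σ, hc, hσ, hT⟩ := exists_norm_trigSum_branchSum_le hA hμ hinv hW hent hdim hx₀I
  have hC := hW.one_le
  refine ⟨C * (C + 4 * c), min σ (1 / 2), by positivity, by positivity, fun ν hν N => ?_⟩
  rcases N.eq_zero_or_pos with rfl | hN
  · have : (2 : ℝ) - min σ (1 / 2) ≠ 0 := by linarith [min_le_right σ (1 / 2)]
    simp only [weylSum, Finset.range_zero, Finset.sum_empty, Nat.cast_zero, Real.zero_rpow this]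
    simp
  have hT' : ∀ ξ : ℝ, 1 ≤ ξ → ∃ m₀, ∀ m ≥ m₀,
      ‖trigSum (words A m) (fun l => Real.exp (branchSum φ l x₀)) ξ x₀‖ ≤ c * ξ ^ (-(min σ (1 / 2))) :=
    fun ξ hξ => (hT ξ hξ).imp fun m₀ h m hm => (h m hm).trans (mul_le_mul_of_nonneg_left
      (Real.rpow_le_rpow_of_exponent_le hξ (neg_le_neg (min_le_left _ _))) hc.le)
  have hcont : Continuous fun x => ‖weylSum ν N x‖ ^ 2 := (continuous_weylSum ν N).norm.pow 2
  have hint : Integrable (fun x => ‖weylSum ν N x‖ ^ 2) μ := by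
    refine Integrable.of_bound hcont.aestronglyMeasurable ((N : ℝ) ^ 2) (Eventually.of_forall fun x => ?_)
    rw [Real.norm_of_nonneg (by positivity)]
    gcongr
    exact norm_weylSum_le ν N x
  have key := integral_le_of_forall_sum_weight_le hA hμ (zero_le_one.trans hC) hW.le_weight hx₀I hcont
    (fun x => by positivity) hint (exists_sum_weight_mul_norm_weylSum_sq_le hW.sum_weight_le hc.le
      (by positivity) (min_le_right _ _) hT' hν N)
  refine key.trans ?_
  have hN1 : (1 : ℝ) ≤ N := by exact_mod_cast hN
  have h1 : 1 ≤ (N : ℝ) ^ (1 - min σ (1 / 2)) :=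
    Real.one_le_rpow hN1 (by linarith [min_le_right σ (1 / 2)])
  have h2 : (N : ℝ) ^ (2 - min σ (1 / 2)) = N * (N : ℝ) ^ (1 - min σ (1 / 2)) := by
    rw [show (2 : ℝ) - min σ (1 / 2) = 1 + (1 - min σ (1 / 2)) by ring,
      Real.rpow_add (by positivity), Real.rpow_one]
  rw [h2, mul_assoc C]
  refine mul_le_mul_of_nonneg_left ?_ (zero_le_one.trans hC)
  have h3 := mul_le_mul_of_nonneg_left h1 (zero_le_one.trans hC)
  calc (N : ℝ) * (C + 4 * c * (N : ℝ) ^ (1 - min σ (1 / 2))) ≤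
      (N : ℝ) * (C * (N : ℝ) ^ (1 - min σ (1 / 2)) + 4 * c * (N : ℝ) ^ (1 - min σ (1 / 2))) := by
        gcongr; linarith
    _ = _ := by ring

end

section

theorem ae_tendsto_zero_of_sum_integral_le {Ω : Type*} [MeasurableSpace Ω] {μ : Measure Ω}
    {F : ℕ → Ω → ℝ} (hF0 : ∀ j x, 0 ≤ F j x) (hFi : ∀ j, Integrable (F j) μ) {b : ℕ → ℝ}
    (hb : Summable b) (hFb : ∀ j, ∫ x, F j x ∂μ ≤ b j) :
    ∀ᵐ x ∂μ, Tendsto (fun j => F j x) atTop (𝓝 0) := by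
  have h1 : ∫⁻ x, ∑' j, ENNReal.ofReal (F j x) ∂μ ≠ ∞ := by
    rw [lintegral_tsum fun j => (hFi j).aemeasurable.ennreal_ofReal]
    refine ne_top_of_le_ne_top hb.tsum_ofReal_ne_top (ENNReal.tsum_le_tsum fun j => ?_)
    rw [← ofReal_integral_eq_lintegral_ofReal (hFi j) (Eventually.of_forall (hF0 j))]
    exact ENNReal.ofReal_le_ofReal (hFb j)
  filter_upwards [ae_lt_top' (AEMeasurable.tsum fun j => (hFi j).aemeasurable.ennreal_ofReal) h1]
    with x hx
  have h2 := ENNReal.tendsto_cofinite_zero_of_tsum_ne_top hx.ne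
  rw [Nat.cofinite_eq_atTop] at h2
  have h3 := (ENNReal.tendsto_toReal ENNReal.zero_ne_top).comp h2
  refine h3.congr fun j => ?_
  simp [ENNReal.toReal_ofReal (hF0 j x)]

/-- Averages of a bounded sequence converge to zero if they do so along `j ↦ j ^ L`. -/
theorem tendsto_average_of_tendsto_average_pow {v : ℕ → ℝ} (hv : ∀ k, |v k| ≤ 1) {L : ℕ} (hL : L ≠ 0)
    (h : Tendsto (fun j : ℕ => (∑ k ∈ Finset.range (j ^ L), v k) / ((j ^ L : ℕ) : ℝ)) atTop (𝓝 0)) :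
    Tendsto (fun N : ℕ => (∑ k ∈ Finset.range N, v k) / (N : ℝ)) atTop (𝓝 0) := by
  have hdiv : ∀ N : ℕ, 0 < N → (N + ∑ k ∈ Finset.range N, v k) / (N : ℝ) =
      1 + (∑ k ∈ Finset.range N, v k) / (N : ℝ) := fun N hN => by
    rw [add_div, div_self (by exact_mod_cast hN.ne')]
  have key := tendsto_div_of_monotone_of_exists_subseq_tendsto_div
    (fun N : ℕ => N + ∑ k ∈ Finset.range N, v k) 1
    (monotone_nat_of_le_succ fun n => by
      rw [Finset.sum_range_succ]; push_cast; linarith [(abs_le.1 (hv n)).1])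
    (fun a ha => ⟨fun n => n ^ L, ?_, tendsto_pow_atTop hL, ?_⟩)
  · have := key.sub_const 1
    rw [sub_self] at this
    refine this.congr' ?_
    filter_upwards [eventually_gt_atTop 0] with N hN
    rw [hdiv N hN]
    ring
  · have h1 : Tendsto (fun n : ℕ => (1 + 1 / (n : ℝ)) ^ L) atTop (𝓝 1) := by
      simpa using (tendsto_one_div_atTop_nhds_zero_nat.const_add (1 : ℝ)).pow L
    filter_upwards [h1.eventually (eventually_le_nhds ha), eventually_gt_atTop 0] with n hn hn0
    have hn0' : (0 : ℝ) < n := by exact_mod_cast hn0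
    have e1 : (1 + 1 / (n : ℝ)) = (n + 1) / n := by field_simp
    rw [e1, div_pow, div_le_iff₀ (by positivity)] at hn
    push_cast
    exact hn
  · have := h.const_add 1
    rw [add_zero] at this
    refine this.congr' ?_
    filter_upwards [eventually_gt_atTop 0] with n hn
    rw [hdiv _ (pow_pos hn L)]

theorem ae_tendsto_average_of_integral_sq_le {Ω : Type*} [MeasurableSpace Ω] {μ : Measure Ω}
    [IsFiniteMeasure μ] {v : ℕ → Ω → ℝ} (hvm : ∀ k, Measurable (v k)) (hv : ∀ k x, |v k x| ≤ 1)
    {K σ : ℝ} (hσ : 0 < σ)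
    (hK : ∀ N : ℕ, ∫ x, (∑ k ∈ Finset.range N, v k x) ^ 2 ∂μ ≤ K * (N : ℝ) ^ (2 - σ)) :
    ∀ᵐ x ∂μ, Tendsto (fun N : ℕ => (∑ k ∈ Finset.range N, v k x) / (N : ℝ)) atTop (𝓝 0) := by
  obtain ⟨L, hL⟩ := exists_nat_gt (2 / σ)
  rw [div_lt_iff₀ hσ] at hL
  have hL0 : L ≠ 0 := by rintro rfl; norm_num at hL
  have hK0 : 0 ≤ K := by
    have := (integral_nonneg fun x => sq_nonneg _).trans (hK 1)
    simpa using this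
  have hsum : ∀ N x, |∑ k ∈ Finset.range N, v k x| ≤ N := fun N x =>
    (Finset.abs_sum_le_sum_abs _ _).trans ((Finset.sum_le_sum fun k _ => hv k x).trans (by simp))
  have hmeas : ∀ N, Measurable fun x => ∑ k ∈ Finset.range N, v k x := fun N =>
    Finset.measurable_fun_sum _ fun k _ => hvm k
  have hint : ∀ N, Integrable (fun x => (∑ k ∈ Finset.range N, v k x) ^ 2) μ := fun N => by
    refine Integrable.of_bound ((hmeas N).pow_const 2).aestronglyMeasurable ((N : ℝ) ^ 2)
      (Eventually.of_forall fun x => ?_)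
    rw [Real.norm_eq_abs, abs_pow]
    gcongr
    exact hsum N x
  have hae := ae_tendsto_zero_of_sum_integral_le (μ := μ)
    (F := fun j x => ((∑ k ∈ Finset.range (j ^ L), v k x) / ((j ^ L : ℕ) : ℝ)) ^ 2)
    (fun j x => sq_nonneg _) (fun j => by simp only [div_pow]; exact (hint _).div_const _)
    ((Real.summable_nat_rpow.2 (by norm_num : (-2 : ℝ) < -1)).mul_left K) (fun j => ?_)
  · filter_upwards [hae] with x hx
    refine tendsto_average_of_tendsto_average_pow (fun k => hv k x) hL0 ?_
    rw [tendsto_zero_iff_abs_tendsto_zero]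
    have := hx.sqrt
    simp only [Real.sqrt_sq_eq_abs, Real.sqrt_zero] at this
    exact this
  · simp only [div_pow]
    rw [integral_div]
    rcases j.eq_zero_or_pos with rfl | hj
    · simp [hL0]
    have hj1 : (1 : ℝ) ≤ j := by exact_mod_cast hj
    have hp : (0 : ℝ) < ((j ^ L : ℕ) : ℝ) := by positivity
    rw [div_le_iff₀ (by positivity)]
    refine (hK _).trans ?_
    rw [mul_assoc]
    refine mul_le_mul_of_nonneg_left ?_ hK0
    rw [sub_eq_neg_add, Real.rpow_add hp, Real.rpow_ofNat]
    refine mul_le_mul_of_nonneg_right ?_ (by positivity)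
    push_cast
    rw [← Real.rpow_natCast, ← Real.rpow_mul (by positivity)]
    exact Real.rpow_le_rpow_of_exponent_le hj1 (by linarith)

variable {A : Finset ℕ} {μ : Measure ℝ} [IsProbabilityMeasure μ] {φ : ℝ → ℝ}

theorem ae_tendsto_weylSum_div (hA : ∀ a ∈ A, 1 ≤ a) (hμ : μ (badSet A) = 1)
    (hinv : GaussInvariant μ) (hφ : LocHolderOn A φ) (hG : IsGibbsOn A φ μ)
    {h : ℝ} (hent : HasEntropy μ h) (hdim : 1 / 2 < h / lyapunov μ)
    {ν : ℕ → ℝ} (hν : ∀ i j, i ≤ j → ((j - i : ℕ) : ℝ) ≤ ν j - ν i) :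
    ∀ᵐ x ∂μ, Tendsto (fun N : ℕ => weylSum ν N x / (N : ℂ)) atTop (𝓝 0) := by
  obtain ⟨K, σ, hK0, hσ, hK⟩ := exists_integral_norm_weylSum_sq_le hA hμ hinv hφ hG hent hdim
  have hcont : ∀ k, Continuous fun x => e (ν k * x) := fun k =>
    continuous_e.comp (continuous_const.mul continuous_id)
  have hint : ∀ N, Integrable (fun x => ‖weylSum ν N x‖ ^ 2) μ := fun N => by
    refine Integrable.of_bound ((continuous_weylSum ν N).norm.pow 2).aestronglyMeasurable ((N : ℝ) ^ 2)
      (Eventually.of_forall fun x => ?_)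
    rw [Real.norm_of_nonneg (by positivity)]
    gcongr
    exact norm_weylSum_le ν N x
  have hre := ae_tendsto_average_of_integral_sq_le (μ := μ) (v := fun k x => (e (ν k * x)).re)
    (fun k => (Complex.continuous_re.comp (hcont k)).measurable)
    (fun k x => (Complex.abs_re_le_norm _).trans (norm_e _).le) hσ (fun N => by
      refine (integral_mono_of_nonneg (Eventually.of_forall fun x => sq_nonneg _) (hint N)
        (Eventually.of_forall fun x => ?_)).trans (hK ν hν N)
      rw [← Complex.re_sum, ← sq_abs]
      exact pow_le_pow_left₀ (abs_nonneg _) (Complex.abs_re_le_norm _) 2)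
  have him := ae_tendsto_average_of_integral_sq_le (μ := μ) (v := fun k x => (e (ν k * x)).im)
    (fun k => (Complex.continuous_im.comp (hcont k)).measurable)
    (fun k x => (Complex.abs_im_le_norm _).trans (norm_e _).le) hσ (fun N => by
      refine (integral_mono_of_nonneg (Eventually.of_forall fun x => sq_nonneg _) (hint N)
        (Eventually.of_forall fun x => ?_)).trans (hK ν hν N)
      rw [← Complex.im_sum, ← sq_abs]
      exact pow_le_pow_left₀ (abs_nonneg _) (Complex.abs_im_le_norm _) 2)
  filter_upwards [hre, him] with x hx hy
  have h1 := ((Complex.continuous_ofReal.tendsto 0).comp hx).add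
    (((Complex.continuous_ofReal.tendsto 0).comp hy).mul_const Complex.I)
  simp only [Complex.ofReal_zero, zero_mul, add_zero] at h1
  refine h1.congr fun N => ?_
  simp only [Function.comp, Complex.ofReal_div, ← Complex.re_sum, ← Complex.im_sum,
    Complex.ofReal_natCast]
  rw [div_mul_eq_mul_div, ← add_div, Complex.re_add_im, weylSum]

theorem ae_equidistributedMod1 (hA : ∀ a ∈ A, 1 ≤ a) (hμ : μ (badSet A) = 1)
    (hinv : GaussInvariant μ) (hφ : LocHolderOn A φ) (hG : IsGibbsOn A φ μ)
    {h : ℝ} (hent : HasEntropy μ h) (hdim : 1 / 2 < h / lyapunov μ)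
    {s : ℕ → ℕ} (hs : StrictMono s) : ∀ᵐ x ∂μ, EquidistributedMod1 fun k => (s k : ℝ) * x := by
  have hgap : ∀ i j, i ≤ j → ((j - i : ℕ) : ℝ) ≤ (s j : ℝ) - s i := fun i j hij => by
    have h1 := hs.add_le_nat (j - i) i
    rw [Nat.sub_add_cancel hij] at h1
    have h2 : ((j - i + s i : ℕ) : ℝ) ≤ s j := by exact_mod_cast h1
    push_cast [Nat.cast_sub hij] at h2 ⊢
    linarith
  have hpos : ∀ n : ℕ, 0 < n → ∀ᵐ x ∂μ,
      Tendsto (fun N : ℕ => weylSum (fun k => n * s k) N x / (N : ℂ)) atTop (𝓝 0) := fun n hn =>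
    ae_tendsto_weylSum_div hA hμ hinv hφ hG hent hdim fun i j hij => by
      rw [← mul_sub]
      have hn1 : (1 : ℝ) ≤ n := by exact_mod_cast hn
      exact (hgap i j hij).trans (le_mul_of_one_le_left ((Nat.cast_nonneg _).trans (hgap i j hij)) hn1)
  have hall : ∀ᵐ x ∂μ, ∀ n : ℕ, 0 < n →
      Tendsto (fun N : ℕ => weylSum (fun k => n * s k) N x / (N : ℂ)) atTop (𝓝 0) := by
    rw [ae_all_iff]
    intro n
    by_cases hn : 0 < n
    · filter_upwards [hpos n hn] with x hx _ using hx
    · exact Eventually.of_forall fun x hn' => absurd hn' hn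
  filter_upwards [hall] with x hx
  refine equidistributedMod1_of_weyl fun n hn => ?_
  have h1 := hx n.natAbs (Int.natAbs_pos.2 hn)
  rcases Int.natAbs_eq n with hn' | hn'
  · refine h1.congr fun N => ?_
    rw [weylSum]
    congr 1
    refine Finset.sum_congr rfl fun k _ => ?_
    rw [← mul_assoc]
    conv_rhs => rw [hn', Int.cast_natCast]
  · have h2 := (Complex.continuous_conj.tendsto 0).comp h1
    rw [map_zero] at h2
    refine h2.congr fun N => ?_
    rw [Function.comp, weylSum, map_div₀, map_sum, Complex.conj_natCast]
    congr 1
    refine Finset.sum_congr rfl fun k _ => ?_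
    rw [conj_e, ← mul_assoc, ← neg_mul, ← neg_mul]
    conv_rhs => rw [hn', Int.cast_neg, Int.cast_natCast]

end

end GaussGibbs

/-- For a Gibbs measure for the Gauss map restricted to `B(𝒜)` with
dimension `> 1/2`, for every strictly increasing sequence `(s_k)` of naturals the
sequence `(s_k x)` equidistributes mod 1 for `μ`-a.e. `x`; in particular `μ`-a.e. `x`
is `n`-normal for every `n ≥ 2`. -/
theorem gibbs_badly_approximable_equidistribution
    (A : Finset ℕ) (hA0 : 0 ∉ A)
    (φ : ℝ → ℝ) (μ : MeasureTheory.Measure ℝ) [MeasureTheory.IsProbabilityMeasure μ]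
    (hμX : μ (badSet A) = 1) (hinv : GaussInvariant μ)
    (hφH : LocHolderOn A φ) (hGibbs : IsGibbsOn A φ μ)
    (h : ℝ) (hent : HasEntropy μ h) (hdim : 1/2 < h / lyapunov μ) :
    (∀ s : ℕ → ℕ, StrictMono s →
      ∀ᵐ x ∂μ, EquidistributedMod1 fun k => (s k : ℝ) * x) ∧
    (∀ m : ℕ, 2 ≤ m → ∀ᵐ x ∂μ, EquidistributedMod1 fun k => (m : ℝ) ^ k * x) := by
  have hA : ∀ a ∈ A, 1 ≤ a := fun a ha => Nat.one_le_iff_ne_zero.2 fun h0 => hA0 (h0 ▸ ha)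
  have hs := fun s : ℕ → ℕ => GaussGibbs.ae_equidistributedMod1 (s := s) hA hμX hinv hφH hGibbs hent hdim
  refine ⟨hs, fun m hm => ?_⟩
  simpa using hs (fun k => m ^ k) (pow_right_strictMono₀ hm)
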